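/- Let d₁, d₂ ≥ 1, let 1 ≤ p ≤ 2(d₂+1)/(d₂+3) and 1 ≤ q ≤ 2 ≤ r ≤ ∞. Then there is a constant C > 0 such that for every Schwartz function f on ℝ^{d₁}×ℝ^{d₂} and every μ > 0, ||𝓟_μ f||_{L_x^r L_t^{p'}} ≤ C μ^{2d₂(1/p − 1/2) + (d₁/2)(1/q − 1/r) − 1} ||f||_{L_x^q L_t^p}, where 1/p + 1/p' = 1. -/

import Mathlib

open MeasureTheory
open scoped ENNReal

noncomputable section

/-- Physicists' Hermite polynomial. -/
def physHermite (k : ℕ) (τ : ℝ) : ℝ :=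
  (-1 : ℝ) ^ k * Real.exp (τ ^ 2) * iteratedDeriv k (fun s : ℝ => Real.exp (-s ^ 2)) τ

/-- Hermite function -/
def hermiteFun (k : ℕ) (τ : ℝ) : ℝ :=
  ((2 : ℝ) ^ k * (Nat.factorial k) * Real.sqrt Real.pi) ^ (-(1 : ℝ) / 2) *
    physHermite k τ * Real.exp (-τ ^ 2 / 2)

/-- multi-dim Hermite function -/
def hermiteFunMulti (d : ℕ) (ν : Fin d → ℕ) (x : Fin d → ℝ) : ℝ :=
  ∏ j, hermiteFun (ν j) (x j)

/-- scaled Hermite function Φ^a_ν -/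
def scaledHermite (d : ℕ) (a : ℝ) (ν : Fin d → ℕ) (x : Fin d → ℝ) : ℝ :=
  |a| ^ ((d : ℝ) / 4) * hermiteFunMulti d ν (fun j => Real.sqrt |a| * x j)

/-- spectral projection P_k(a) -/
def hermiteProj (d k : ℕ) (a : ℝ) (φ : (Fin d → ℝ) → ℂ) (x : Fin d → ℝ) : ℂ :=
  ∑ ν ∈ Finset.Nat.antidiagonalTuple d k,
    (∫ y : Fin d → ℝ, φ y * (scaledHermite d a ν y : ℂ)) * (scaledHermite d a ν x : ℂ)

/-- surface measure on unit sphere -/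
def sphereMeasure (n : ℕ) : Measure (Metric.sphere (0 : EuclideanSpace ℝ (Fin n)) 1) :=
  (volume : Measure (EuclideanSpace ℝ (Fin n))).toSphere

/-- inverse partial Fourier transform in t -/
def partialFT (d₁ d₂ : ℕ) (f : (Fin d₁ → ℝ) × (Fin d₂ → ℝ) → ℂ)
    (lam : Fin d₂ → ℝ) (x : Fin d₁ → ℝ) : ℂ :=
  ∫ t : Fin d₂ → ℝ, f (x, t) * Complex.exp (Complex.I * (∑ j, lam j * t j : ℝ))

/-- the restriction operator 𝓟_μ -/
def restOp (d₁ d₂ : ℕ) (μ : ℝ) (f : (Fin d₁ → ℝ) × (Fin d₂ → ℝ) → ℂ)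
    (x : Fin d₁ → ℝ) (t : Fin d₂ → ℝ) : ℂ :=
  (1 / (2 * Real.pi) : ℝ) * ∑' k : ℕ,
    ((μ ^ (d₂ - 1) / (2 * (k : ℝ) + d₁) ^ d₂ : ℝ) : ℂ) *
      ∫ ε : Metric.sphere (0 : EuclideanSpace ℝ (Fin d₂)) 1,
        hermiteProj d₁ k (μ / (2 * (k : ℝ) + d₁))
          (partialFT d₁ d₂ f (fun j => μ / (2 * (k : ℝ) + d₁) * (ε : EuclideanSpace ℝ (Fin d₂)) j)) x *
        Complex.exp (-Complex.I *
          (μ * (∑ j, t j * (ε : EuclideanSpace ℝ (Fin d₂)) j) / (2 * (k : ℝ) + d₁) : ℝ))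
        ∂(sphereMeasure d₂)

/-- L^p norm (extended) of an ℝ≥0∞-valued function -/
def lpNormENN {α : Type*} [MeasurableSpace α] (p : ℝ≥0∞) (g : α → ℝ≥0∞) (μ : Measure α) : ℝ≥0∞ :=
  if p = ∞ then essSup g μ
  else (∫⁻ a, g a ^ p.toReal ∂μ) ^ (1 / p.toReal)

/-- mixed norm ‖f‖_{L_x^q L_t^p} -/
def mixedNorm (d₁ d₂ : ℕ) (q p : ℝ≥0∞) (f : (Fin d₁ → ℝ) × (Fin d₂ → ℝ) → ℂ) : ℝ≥0∞ :=
  lpNormENN p (fun t => eLpNorm (fun x => f (x, t)) q volume) volume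

end

section

open Set Metric
open scoped Pointwise RealInnerProductSpace

theorem lintegral_rpow_le_of_forall_dual {α : Type*} [MeasurableSpace α] {μ : Measure α}
    [SigmaFinite μ] {S : α → ℝ≥0∞} (hS : Measurable S) {q q' : ℝ} (hq : q.HolderConjugate q')
    (R : ℝ≥0∞)
    (h : ∀ g : α → ℝ≥0∞, Measurable g → ∫⁻ x, g x ^ q' ∂μ < ∞ →
      ∫⁻ x, S x * g x ∂μ ≤ R * (∫⁻ x, g x ^ q' ∂μ) ^ (1 / q')) :
    (∫⁻ x, S x ^ q ∂μ) ^ (1 / q) ≤ R := by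
  have hq0 := hq.pos
  have hq'0 := hq.symm.pos
  set T : ℕ → α → ℝ≥0∞ := fun n => (spanningSets μ n).indicator (fun x => min (S x) n) with hT
  have hTm : ∀ n, Measurable (T n) := fun n =>
    (hS.min measurable_const).indicator (measurableSet_spanningSets μ n)
  have hTS : ∀ n x, T n x ≤ S x := by
    intro n x
    exact (Set.indicator_le_self _ _ x).trans (min_le_left _ _)
  have hfin : ∀ n, ∫⁻ x, T n x ^ q ∂μ < ∞ := by
    intro n
    calc ∫⁻ x, T n x ^ q ∂μ
        ≤ ∫⁻ x, (spanningSets μ n).indicator (fun _ => (n : ℝ≥0∞) ^ q) x ∂μ := by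
          apply lintegral_mono
          intro x
          by_cases hx : x ∈ spanningSets μ n
          · simp only [hT, Set.indicator_of_mem hx]
            gcongr
            exact min_le_right _ _
          · simp [hT, Set.indicator_of_notMem hx, hq0]
      _ = (n : ℝ≥0∞) ^ q * μ (spanningSets μ n) := by
          rw [lintegral_indicator (measurableSet_spanningSets μ n)]
          simp
      _ < ∞ := ENNReal.mul_lt_top (ENNReal.rpow_lt_top_of_nonneg hq0.le (by simp))
          (measure_spanningSets_lt_top μ n)
  have key : ∀ n, ∫⁻ x, T n x ^ q ∂μ ≤ R ^ q := by
    intro n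
    set I := ∫⁻ x, T n x ^ q ∂μ with hI
    have h1 : I ≤ R * I ^ (1 / q') := by
      have := h (fun x => T n x ^ (q - 1)) ((hTm n).pow_const _) ?_
      · have e : ∀ x, (T n x ^ (q - 1)) ^ q' = T n x ^ q := by
          intro x
          rw [← ENNReal.rpow_mul, hq.sub_one_mul_conj]
        simp only [e] at this
        refine le_trans ?_ this
        apply lintegral_mono
        intro x
        have : T n x ^ q = T n x * T n x ^ (q - 1) := by
          have h3 : T n x ^ q = T n x ^ (1 + (q - 1)) := by congr 1; ring
          rw [h3, ENNReal.rpow_add_of_nonneg _ _ zero_le_one (by linarith [hq.lt]),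
            ENNReal.rpow_one]
        simp only [this]
        gcongr
        exact hTS n x
      · have e : ∀ x, (T n x ^ (q - 1)) ^ q' = T n x ^ q := by
          intro x
          rw [← ENNReal.rpow_mul, hq.sub_one_mul_conj]
        simp only [e]
        exact hfin n
    by_cases hI0 : I = 0
    · rw [hI0]; exact zero_le
    have h2 : I ^ (1 / q) ≤ R := by
      have e : I = I ^ (1 / q) * I ^ (1 / q') := by
        rw [← ENNReal.rpow_add _ _ hI0 (hfin n).ne]
        have := hq.inv_add_inv_eq_one
        simp only [one_div, this, ENNReal.rpow_one]
      rw [e] at h1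
      have e2 : (I ^ (1 / q) * I ^ (1 / q')) ^ (1 / q') = I ^ (1 / q') := by rw [← e]
      rw [e2] at h1
      refine (ENNReal.mul_le_mul_iff_left ?_ ?_).1 h1
      · exact (ENNReal.rpow_pos (pos_iff_ne_zero.2 hI0) (hfin n).ne).ne'
      · exact (ENNReal.rpow_lt_top_of_nonneg (by positivity) (hfin n).ne).ne
    calc I = (I ^ (1 / q)) ^ q := by
          rw [← ENNReal.rpow_mul, one_div, inv_mul_cancel₀ hq0.ne', ENNReal.rpow_one]
      _ ≤ R ^ q := by gcongr
  have hsup : ∫⁻ x, S x ^ q ∂μ ≤ R ^ q := by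
    have : ∀ x, S x ^ q ≤ Filter.liminf (fun n => T n x ^ q) Filter.atTop := by
      intro x
      have ht : Filter.Tendsto (fun n => T n x) Filter.atTop (nhds (S x)) := by
        have : (fun n => T n x) =ᶠ[Filter.atTop] fun n : ℕ => min (S x) n := by
          filter_upwards [Filter.eventually_ge_atTop (spanningSetsIndex μ x)] with n hn
          simp only [hT]
          rw [Set.indicator_of_mem]
          exact monotone_spanningSets μ hn (mem_spanningSetsIndex μ x)
        rw [Filter.tendsto_congr' this]
        have h3 : Filter.Tendsto (fun n : ℕ => min (S x) (n : ℝ≥0∞)) Filter.atTop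
            (nhds (min (S x) ⊤)) :=
          (tendsto_const_nhds).min ENNReal.tendsto_nat_nhds_top
        simpa using h3
      have ht2 := ((ENNReal.continuous_rpow_const (y := q)).tendsto (S x)).comp ht
      exact ht2.liminf_eq.ge
    calc ∫⁻ x, S x ^ q ∂μ ≤ ∫⁻ x, Filter.liminf (fun n => T n x ^ q) Filter.atTop ∂μ :=
          lintegral_mono this
      _ ≤ Filter.liminf (fun n => ∫⁻ x, T n x ^ q ∂μ) Filter.atTop :=
          lintegral_liminf_le fun n => (hTm n).pow_const _
      _ ≤ Filter.liminf (fun _ : ℕ => R ^ q) Filter.atTop :=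
          Filter.liminf_le_liminf (Filter.Eventually.of_forall key)
      _ = R ^ q := by simp
  calc (∫⁻ x, S x ^ q ∂μ) ^ (1 / q) ≤ (R ^ q) ^ (1 / q) := by gcongr
    _ = R := by rw [← ENNReal.rpow_mul, one_div, mul_inv_cancel₀ hq0.ne', ENNReal.rpow_one]

theorem lintegral_rpow_lintegral_le {α β : Type*} [MeasurableSpace α] [MeasurableSpace β]
    {μ : Measure α} {ν : Measure β} [SigmaFinite μ] [SigmaFinite ν] {F : α → β → ℝ≥0∞}
    (hF : Measurable (Function.uncurry F)) {q : ℝ} (hq : 1 ≤ q) :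
    (∫⁻ x, (∫⁻ s, F x s ∂ν) ^ q ∂μ) ^ (1 / q) ≤ ∫⁻ s, (∫⁻ x, F x s ^ q ∂μ) ^ (1 / q) ∂ν := by
  rcases hq.eq_or_lt with rfl | hq1
  · simp only [ENNReal.rpow_one, div_one]
    exact (lintegral_lintegral_swap hF.aemeasurable).le
  have hc : q.HolderConjugate (q / (q - 1)) := Real.HolderConjugate.conjExponent hq1
  refine lintegral_rpow_le_of_forall_dual hF.lintegral_prod_right' hc _ fun g hg _ => ?_
  calc ∫⁻ x, (∫⁻ s, F x s ∂ν) * g x ∂μ = ∫⁻ x, ∫⁻ s, F x s * g x ∂ν ∂μ := by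
        congr 1; ext x
        rw [lintegral_mul_const]
        exact hF.of_uncurry_left
    _ = ∫⁻ s, ∫⁻ x, F x s * g x ∂μ ∂ν := by
        apply lintegral_lintegral_swap
        exact (hF.mul (hg.comp measurable_fst)).aemeasurable
    _ ≤ ∫⁻ s, (∫⁻ x, F x s ^ q ∂μ) ^ (1 / q) *
          (∫⁻ x, g x ^ (q / (q - 1)) ∂μ) ^ (1 / (q / (q - 1))) ∂ν := by
        apply lintegral_mono
        intro s
        exact ENNReal.lintegral_mul_le_Lp_mul_Lq μ hc hF.of_uncurry_right.aemeasurable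
          hg.aemeasurable
    _ = _ := by
        rw [lintegral_mul_const]
        have : Measurable (Function.uncurry fun s x => F x s ^ q) :=
          (hF.comp measurable_swap).pow_const q
        exact (this.lintegral_prod_right').pow_const _

theorem lintegral_comp_abs_le (g : ℝ → ℝ≥0∞) :
    ∫⁻ u, g |u| ≤ 2 * ∫⁻ u in Ioi 0, g u := by
  have h1 : ∫⁻ u, g |u| ≤ (∫⁻ u in Iic 0, g |u|) + ∫⁻ u in Ioi 0, g |u| := by
    calc ∫⁻ u, g |u| = ∫⁻ u in Iic 0 ∪ Ioi 0, g |u| := by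
          rw [Iic_union_Ioi, Measure.restrict_univ]
      _ ≤ _ := lintegral_union_le _ _ _
  have h2 : ∫⁻ u in Ioi (0 : ℝ), g |u| = ∫⁻ u in Ioi 0, g u :=
    setLIntegral_congr_fun measurableSet_Ioi fun u hu => by simp only [abs_of_pos (mem_Ioi.1 hu)]
  have h3 : ∫⁻ u in Iic (0 : ℝ), g |u| = ∫⁻ u in Ioi 0, g |u| := by
    have := (Measure.measurePreserving_neg (volume : Measure ℝ)).setLIntegral_comp_preimage_emb
      (MeasurableEquiv.neg ℝ).measurableEmbedding (fun u => g |u|) (Ici 0)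
    simp only [abs_neg] at this
    rw [Measure.restrict_congr_set (Ioi_ae_eq_Ici (a := (0 : ℝ)) (μ := volume)), ← this]
    congr 2
    ext x; simp
  rw [h3, h2] at h1
  rwa [two_mul]

theorem lintegral_Ioo_rpow_neg {α : ℝ} (hα : α < 1) {ρ : ℝ} (hρ : 0 ≤ ρ) :
    ∫⁻ u in Ioo 0 ρ, ENNReal.ofReal (u ^ (-α)) = ENNReal.ofReal (ρ ^ (1 - α) / (1 - α)) := by
  have hi : IntervalIntegrable (fun u : ℝ => u ^ (-α)) volume 0 ρ :=
    intervalIntegral.intervalIntegrable_rpow' (by linarith)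
  rw [← ofReal_integral_eq_lintegral_ofReal]
  · rw [← integral_Ioc_eq_integral_Ioo, ← intervalIntegral.integral_of_le hρ,
      integral_rpow (Or.inl (by linarith)), Real.zero_rpow (by linarith)]
    congr 2 <;> ring_nf
  · exact ((intervalIntegrable_iff_integrableOn_Ioo_of_le hρ).1 hi)
  · filter_upwards [ae_restrict_mem measurableSet_Ioo] with u hu
    exact Real.rpow_nonneg hu.1.le _

theorem lintegral_Ioi_rpow_neg_two {ρ : ℝ} (hρ : 0 < ρ) :
    ∫⁻ u in Ioi ρ, ENNReal.ofReal (u ^ (-2 : ℝ)) = ENNReal.ofReal ρ⁻¹ := by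
  rw [← ofReal_integral_eq_lintegral_ofReal]
  · rw [integral_Ioi_rpow_of_lt (by norm_num) hρ]
    congr 1
    rw [show (-2 : ℝ) + 1 = -1 by norm_num, Real.rpow_neg_one]
    ring
  · exact integrableOn_Ioi_rpow_of_lt (by norm_num) hρ
  · filter_upwards [ae_restrict_mem measurableSet_Ioi] with u hu
    exact Real.rpow_nonneg (hρ.trans hu).le _

/-- One-sided estimate behind the Hardy-Littlewood-Sobolev inequality on the line. -/
theorem lintegral_truncated_riesz_le {p p' : ℝ} (hp : p.HolderConjugate p') (hp' : 2 < p')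
    {H : ℝ → ℝ≥0∞} (hH : Measurable H) (hH1 : ∫⁻ s, H s ^ p ≤ 1) (t : ℝ) (a : ℝ≥0∞) :
    ∫⁻ s, {s | H s ≤ a}.indicator (fun s => a * H s * ENNReal.ofReal (|t - s| ^ (-(2 / p')))) s ≤
      ENNReal.ofReal (2 / (1 - 2 / p') + 2) * a ^ p := by
  have hp0 := hp.pos
  have hp'0 := hp.symm.pos
  have hα : 2 / p' < 1 := by rw [div_lt_one hp'0]; exact hp'
  rcases eq_or_ne a 0 with rfl | ha0
  · simp [hp0]
  rcases eq_or_ne a ∞ with rfl | hat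
  · rw [ENNReal.top_rpow_of_pos hp0, ENNReal.mul_top]
    · exact le_top
    · simp only [ne_eq, ENNReal.ofReal_eq_zero, not_le]
      have : 0 < 1 - 2 / p' := by linarith
      positivity
  lift a to NNReal using hat
  have ha : (0 : ℝ) < a := by
    have : a ≠ 0 := by simpa using ha0
    exact_mod_cast pos_iff_ne_zero.2 this
  set ρ : ℝ := (a : ℝ) ^ (-p) with hρ
  have hρ0 : 0 < ρ := Real.rpow_pos_of_pos ha _
  set k : ℝ → ℝ≥0∞ := fun u => ENNReal.ofReal (|u| ^ (-(2 / p'))) with hk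
  have hkm : Measurable k := by fun_prop
  have near : ∫⁻ s, {s | |t - s| < ρ}.indicator (fun s => (a : ℝ≥0∞) * k (t - s)) s ≤
      ENNReal.ofReal (2 / (1 - 2 / p') * (a : ℝ) ^ (p - 1)) := by
    calc ∫⁻ s, {s | |t - s| < ρ}.indicator (fun s => (a : ℝ≥0∞) * k (t - s)) s
        = ∫⁻ s, (fun u => a * (Iio ρ).indicator (fun u => ENNReal.ofReal (u ^ (-(2 / p')))) |u|)
            (t - s) := by
          congr 1; ext s
          simp only [indicator_apply, mem_ofPred_eq, mem_Iio, hk]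
          split_ifs <;> simp
      _ = a * ∫⁻ u, (Iio ρ).indicator (fun u => ENNReal.ofReal (u ^ (-(2 / p')))) |u| := by
          rw [lintegral_sub_left_eq_self (fun u =>
            (a : ℝ≥0∞) * (Iio ρ).indicator (fun u => ENNReal.ofReal (u ^ (-(2 / p')))) |u|) t,
            lintegral_const_mul]
          exact ((ENNReal.measurable_ofReal.comp (measurable_id.pow_const _)).indicator
            measurableSet_Iio).comp measurable_id.abs
      _ ≤ a * (2 * ∫⁻ u in Ioi 0,
            (Iio ρ).indicator (fun u => ENNReal.ofReal (u ^ (-(2 / p')))) u) := by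
          gcongr
          exact lintegral_comp_abs_le _
      _ = a * (2 * ENNReal.ofReal (ρ ^ (1 - 2 / p') / (1 - 2 / p'))) := by
          rw [setLIntegral_indicator measurableSet_Iio, inter_comm, Ioi_inter_Iio,
            lintegral_Ioo_rpow_neg hα hρ0.le]
      _ = _ := by
          rw [← ENNReal.ofReal_coe_nnreal, ← ENNReal.ofReal_ofNat,
            ← ENNReal.ofReal_mul (by norm_num), ← ENNReal.ofReal_mul ha.le]
          congr 1
          have e1 : ρ ^ (1 - 2 / p') * a = (a : ℝ) ^ (p - 1) := by
            rw [hρ, ← Real.rpow_mul ha.le]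
            nth_rw 2 [← Real.rpow_one (a : ℝ)]
            rw [← Real.rpow_add ha]
            congr 1
            have h2 := hp.mul_eq_add
            field_simp
            linarith
          rw [← e1]; ring
  have far : ∫⁻ s, H s * {s | ρ ≤ |t - s|}.indicator (fun s => k (t - s)) s ≤
      ENNReal.ofReal (2 * (a : ℝ) ^ (p - 1)) := by
    have hm : MeasurableSet {s | ρ ≤ |t - s|} := by
      apply measurableSet_le measurable_const; fun_prop
    have hgm : Measurable ({s | ρ ≤ |t - s|}.indicator (fun s => k (t - s))) :=
      (hkm.comp (measurable_const.sub measurable_id)).indicator hm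
    have hinteg : ∫⁻ s, ({s | ρ ≤ |t - s|}.indicator (fun s => k (t - s)) s) ^ p' ≤
        ENNReal.ofReal (2 * (a : ℝ) ^ p) := by
      calc ∫⁻ s, ({s | ρ ≤ |t - s|}.indicator (fun s => k (t - s)) s) ^ p'
          = ∫⁻ s, (fun u => (Ici ρ).indicator (fun u => ENNReal.ofReal (u ^ (-2 : ℝ))) |u|)
              (t - s) := by
            congr 1; ext s
            simp only [indicator_apply, mem_ofPred_eq, mem_Ici, hk]
            split_ifs with h
            · rw [ENNReal.ofReal_rpow_of_nonneg (by positivity) hp'0.le, ← Real.rpow_mul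
                (abs_nonneg _)]
              congr 2
              field_simp
            · simp [hp'0]
        _ = ∫⁻ u, (Ici ρ).indicator (fun u => ENNReal.ofReal (u ^ (-2 : ℝ))) |u| :=
            lintegral_sub_left_eq_self (fun u =>
              (Ici ρ).indicator (fun u => ENNReal.ofReal (u ^ (-2 : ℝ))) |u|) t
        _ ≤ 2 * ∫⁻ u in Ioi 0, (Ici ρ).indicator (fun u => ENNReal.ofReal (u ^ (-2 : ℝ))) u :=
            lintegral_comp_abs_le _
        _ = _ := by
            rw [setLIntegral_indicator measurableSet_Ici,
              inter_eq_left.2 (show Ici ρ ⊆ Ioi 0 from fun x hx => hρ0.trans_le hx),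
              ← Measure.restrict_congr_set (Ioi_ae_eq_Ici (a := ρ) (μ := volume)),
              lintegral_Ioi_rpow_neg_two hρ0, ENNReal.ofReal_mul (by norm_num),
              ENNReal.ofReal_ofNat, hρ, ← Real.rpow_neg ha.le, neg_neg]
    calc _ ≤ (∫⁻ s, H s ^ p) ^ (1 / p) *
          (∫⁻ s, ({s | ρ ≤ |t - s|}.indicator (fun s => k (t - s)) s) ^ p') ^ (1 / p') :=
          ENNReal.lintegral_mul_le_Lp_mul_Lq _ hp hH.aemeasurable hgm.aemeasurable
      _ ≤ 1 ^ (1 / p) * (ENNReal.ofReal (2 * (a : ℝ) ^ p)) ^ (1 / p') := by gcongr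
      _ = ENNReal.ofReal ((2 * (a : ℝ) ^ p) ^ (1 / p')) := by
          rw [ENNReal.one_rpow, one_mul, ENNReal.ofReal_rpow_of_nonneg (by positivity)
              (by positivity)]
      _ ≤ _ := by
          apply ENNReal.ofReal_le_ofReal
          rw [Real.mul_rpow (by norm_num) (by positivity), ← Real.rpow_mul ha.le]
          have e2 : p * (1 / p') = p - 1 := by
            have h2 := hp.mul_eq_add
            field_simp
            linarith
          rw [e2]
          gcongr
          calc (2 : ℝ) ^ (1 / p') ≤ 2 ^ (1 : ℝ) := by
                apply Real.rpow_le_rpow_of_exponent_le (by norm_num)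
                rw [div_le_one hp'0]; linarith
            _ = 2 := by norm_num
  calc ∫⁻ s, {s | H s ≤ a}.indicator (fun s => a * H s * k (t - s)) s
      ≤ ∫⁻ s, (a * {s | |t - s| < ρ}.indicator (fun s => (a : ℝ≥0∞) * k (t - s)) s +
          a * (H s * {s | ρ ≤ |t - s|}.indicator (fun s => k (t - s)) s)) := by
        apply lintegral_mono
        intro s
        simp only [indicator_apply, mem_ofPred_eq]
        by_cases h1 : H s ≤ a
        · by_cases h2 : |t - s| < ρ
          · rw [if_pos h1, if_pos h2, mul_assoc]
            refine le_trans ?_ le_self_add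
            gcongr
          · rw [if_pos h1, if_neg h2, if_pos (not_lt.1 h2), mul_assoc]
            exact le_add_self
        · rw [if_neg h1]; exact zero_le
    _ = (a * ∫⁻ s, {s | |t - s| < ρ}.indicator (fun s => (a : ℝ≥0∞) * k (t - s)) s) +
          a * ∫⁻ s, (H s * {s | ρ ≤ |t - s|}.indicator (fun s => k (t - s)) s) := by
        have hm1 : MeasurableSet {s | |t - s| < ρ} := by
          apply measurableSet_lt _ measurable_const; fun_prop
        have hm2 : MeasurableSet {s | ρ ≤ |t - s|} := by
          apply measurableSet_le measurable_const; fun_prop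
        have hk2 : Measurable fun s => k (t - s) := hkm.comp (measurable_const.sub measurable_id)
        rw [lintegral_add_left, lintegral_const_mul, lintegral_const_mul]
        · exact hH.mul (hk2.indicator hm2)
        · exact (hk2.const_mul _).indicator hm1
        · exact ((hk2.const_mul _).indicator hm1).const_mul _
    _ ≤ a * ENNReal.ofReal (2 / (1 - 2 / p') * (a : ℝ) ^ (p - 1)) +
          a * ENNReal.ofReal (2 * (a : ℝ) ^ (p - 1)) := by gcongr
    _ = _ := by
        have h3 : 0 < 1 - 2 / p' := by linarith
        rw [← ENNReal.ofReal_coe_nnreal, ← ENNReal.ofReal_mul ha.le, ← ENNReal.ofReal_mul ha.le,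
          ← ENNReal.ofReal_add (by positivity) (by positivity),
          ENNReal.ofReal_rpow_of_nonneg ha.le hp0.le, ← ENNReal.ofReal_mul (by positivity)]
        congr 1
        have : (a : ℝ) ^ p = a * (a : ℝ) ^ (p - 1) := by
          nth_rw 2 [← Real.rpow_one (a : ℝ)]
          rw [← Real.rpow_add ha]; congr 1; ring
        rw [this]; ring

/-- The Hardy-Littlewood-Sobolev inequality on the line, diagonal case. -/
theorem lintegral_lintegral_riesz_le {p p' : ℝ} (hp : p.HolderConjugate p') (hp' : 2 < p')
    {G H : ℝ → ℝ≥0∞} (hG : Measurable G) (hH : Measurable H) :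
    ∫⁻ t, ∫⁻ s, G t * H s * ENNReal.ofReal (|t - s| ^ (-(2 / p'))) ≤
      ENNReal.ofReal (4 / (1 - 2 / p') + 4) * ((∫⁻ t, G t ^ p) ^ (1 / p) *
        (∫⁻ s, H s ^ p) ^ (1 / p)) := by
  have hp0 := hp.pos
  have hp'0 := hp.symm.pos
  have hα : 2 / p' < 1 := by rw [div_lt_one hp'0]; exact hp'
  have h3 : 0 < 1 - 2 / p' := by linarith
  have normalized : ∀ {G H : ℝ → ℝ≥0∞}, Measurable G → Measurable H → ∫⁻ t, G t ^ p ≤ 1 →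
      ∫⁻ t, H t ^ p ≤ 1 → ∫⁻ t, ∫⁻ s, G t * H s * ENNReal.ofReal (|t - s| ^ (-(2 / p'))) ≤
      ENNReal.ofReal (4 / (1 - 2 / p') + 4) := by
    intro G H hG hH hG1 hH1
    set k : ℝ → ℝ → ℝ≥0∞ := fun t s => ENNReal.ofReal (|t - s| ^ (-(2 / p'))) with hk
    have hkm : Measurable (Function.uncurry k) := by fun_prop
    have hmG : Measurable fun z : ℝ × ℝ => G z.1 := hG.comp measurable_fst
    have hmH : Measurable fun z : ℝ × ℝ => H z.2 := hH.comp measurable_snd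
    have hm1 : MeasurableSet {z : ℝ × ℝ | H z.2 ≤ G z.1} := measurableSet_le hmH hmG
    have hm2 : MeasurableSet {z : ℝ × ℝ | G z.1 ≤ H z.2} := measurableSet_le hmG hmH
    have hM : Measurable fun z : ℝ × ℝ => G z.1 * H z.2 * k z.1 z.2 :=
      (hmG.mul hmH).mul hkm
    calc ∫⁻ t, ∫⁻ s, G t * H s * k t s
        ≤ ∫⁻ t, ∫⁻ s, ({s | H s ≤ G t}.indicator (fun s => G t * H s * k t s) s +
            {t | G t ≤ H s}.indicator (fun t => H s * G t * k s t) t) := by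
          apply lintegral_mono; intro t
          apply lintegral_mono; intro s
          simp only [indicator_apply, mem_ofPred_eq]
          rcases le_total (H s) (G t) with h | h
          · rw [if_pos h]; exact le_self_add
          · rw [if_pos h]
            refine le_trans (le_of_eq ?_) le_add_self
            simp only [hk, abs_sub_comm t s]; ring
      _ = (∫⁻ t, ∫⁻ s, {s | H s ≤ G t}.indicator (fun s => G t * H s * k t s) s) +
            ∫⁻ t, ∫⁻ s, {t | G t ≤ H s}.indicator (fun t => H s * G t * k s t) t := by
          have hM1 : Measurable fun z : ℝ × ℝ =>
              {s | H s ≤ G z.1}.indicator (fun s => G z.1 * H s * k z.1 s) z.2 := hM.indicator hm1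
          rw [← lintegral_add_left hM1.lintegral_prod_right']
          congr 1; ext t
          rw [lintegral_add_left]
          exact hM1.of_uncurry_left (f := fun t s => {s | H s ≤
              G t}.indicator (fun s => G t * H s * k t s) s)
      _ = (∫⁻ t, ∫⁻ s, {s | H s ≤ G t}.indicator (fun s => G t * H s * k t s) s) +
            ∫⁻ s, ∫⁻ t, {t | G t ≤ H s}.indicator (fun t => H s * G t * k s t) t := by
          congr 1
          apply lintegral_lintegral_swap
          have : Measurable fun z : ℝ × ℝ => H z.2 * G z.1 * k z.2 z.1 :=
            (hmH.mul hmG).mul (hkm.comp measurable_swap)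
          exact (this.indicator hm2).aemeasurable
      _ ≤ (∫⁻ t, ENNReal.ofReal (2 / (1 - 2 / p') + 2) * G t ^ p) +
            ∫⁻ s, ENNReal.ofReal (2 / (1 - 2 / p') + 2) * H s ^ p := by
          gcongr with t s
          · exact lintegral_truncated_riesz_le hp hp' hH hH1 t _
          · exact lintegral_truncated_riesz_le hp hp' hG hG1 s _
      _ ≤ ENNReal.ofReal (2 / (1 - 2 / p') + 2) * 1 + ENNReal.ofReal
          (2 / (1 - 2 / p') + 2) * 1 := by
          rw [lintegral_const_mul _ (hG.pow_const _), lintegral_const_mul _ (hH.pow_const _)]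
          gcongr
      _ = _ := by
          rw [mul_one, ← ENNReal.ofReal_add (by positivity) (by positivity)]
          congr 1; ring
  set I := ∫⁻ t, G t ^ p with hI
  set J := ∫⁻ t, H t ^ p with hJ
  have zero_of : ∀ {F : ℝ → ℝ≥0∞}, Measurable F → ∫⁻ t, F t ^ p = 0 → F =ᵐ[volume] 0 := by
    intro F hF h
    rw [lintegral_eq_zero_iff (hF.pow_const _)] at h
    filter_upwards [h] with t ht
    simpa [hp0, hp0.le, not_lt.2 hp0.le] using ht
  rcases eq_or_ne I 0 with hI0 | hI0
  · refine le_trans (le_of_eq ?_) (zero_le)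
    rw [lintegral_eq_zero_iff']
    · filter_upwards [zero_of hG hI0] with t ht
      simp [ht]
    · apply Measurable.aemeasurable
      exact Measurable.lintegral_prod_right' (f := fun z : ℝ × ℝ =>
        G z.1 * H z.2 * ENNReal.ofReal (|z.1 - z.2| ^ (-(2 / p')))) (by fun_prop)
  rcases eq_or_ne J 0 with hJ0 | hJ0
  · refine le_trans (le_of_eq ?_) (zero_le)
    have : ∀ t, ∫⁻ s, G t * H s * ENNReal.ofReal (|t - s| ^ (-(2 / p'))) = 0 := by
      intro t
      rw [lintegral_eq_zero_iff (by fun_prop)]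
      filter_upwards [zero_of hH hJ0] with t ht
      simp [ht]
    simp [this]
  have hC : ENNReal.ofReal (4 / (1 - 2 / p') + 4) ≠ 0 := by
    simp only [ne_eq, ENNReal.ofReal_eq_zero, not_le]; positivity
  have hpos : ∀ x : ℝ≥0∞, x ≠ 0 → x ^ (1 / p) ≠ 0 := fun x hx => by
    simp [ENNReal.rpow_eq_zero_iff, hx, hp0.le]
  rcases eq_or_ne I ∞ with hIt | hIt
  · rw [hIt, ENNReal.top_rpow_of_pos (by positivity), ENNReal.top_mul (hpos _ hJ0), ENNReal.mul_top
      hC]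
    exact le_top
  rcases eq_or_ne J ∞ with hJt | hJt
  · rw [hJt, ENNReal.top_rpow_of_pos (by positivity), ENNReal.mul_top (hpos _ hI0), ENNReal.mul_top
      hC]
    exact le_top
  set c := I ^ (1 / p) with hc
  set d := J ^ (1 / p) with hd
  have hct : c ≠ ∞ := (ENNReal.rpow_lt_top_of_nonneg (by positivity) hIt).ne
  have hdt : d ≠ ∞ := (ENNReal.rpow_lt_top_of_nonneg (by positivity) hJt).ne
  have hc0 : c ≠ 0 := hpos _ hI0
  have hd0 : d ≠ 0 := hpos _ hJ0
  have scaled : ∀ {F : ℝ → ℝ≥0∞}, Measurable F → ∫⁻ t, F t ^ p ≠ 0 → ∫⁻ t, F t ^ p ≠ ∞ →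
      ∫⁻ t, (((∫⁻ t, F t ^ p) ^ (1 / p))⁻¹ * F t) ^ p ≤ 1 := by
    intro F hF h0 ht
    simp only [ENNReal.mul_rpow_of_nonneg _ _ hp0.le]
    rw [lintegral_const_mul _ (hF.pow_const _), ENNReal.inv_rpow, ← ENNReal.rpow_mul,
      one_div, inv_mul_cancel₀ hp0.ne', ENNReal.rpow_one, ENNReal.inv_mul_cancel h0 ht]
  have := normalized (hG.const_mul c⁻¹) (hH.const_mul d⁻¹) (scaled hG hI0 hIt) (scaled hH hJ0 hJt)
  calc ∫⁻ t, ∫⁻ s, G t * H s * ENNReal.ofReal (|t - s| ^ (-(2 / p')))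
      = ∫⁻ t, ∫⁻ s, (c * d) * (c⁻¹ * G t * (d⁻¹ * H s) * ENNReal.ofReal
          (|t - s| ^ (-(2 / p')))) := by
        congr 1; ext t; congr 1; ext s
        calc _ = (c * c⁻¹) * (d * d⁻¹) * (G t * H s * ENNReal.ofReal (|t - s| ^ (-(2 / p')))) := by
              rw [ENNReal.mul_inv_cancel hc0 hct, ENNReal.mul_inv_cancel hd0 hdt]; simp
          _ = _ := by ring
    _ = (c * d) * ∫⁻ t, ∫⁻ s, (c⁻¹ * G t * (d⁻¹ * H s) * ENNReal.ofReal
        (|t - s| ^ (-(2 / p')))) := by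
        rw [← lintegral_const_mul]
        · congr 1; ext t
          rw [lintegral_const_mul]
          fun_prop
        · exact Measurable.lintegral_prod_right' (f := fun z : ℝ × ℝ =>
            c⁻¹ * G z.1 * (d⁻¹ * H z.2) * ENNReal.ofReal (|z.1 - z.2| ^ (-(2 / p')))) (by fun_prop)
    _ ≤ (c * d) * ENNReal.ofReal (4 / (1 - 2 / p') + 4) := by gcongr
    _ = _ := by ring

/-- A quantitative Marcinkiewicz interpolation estimate between `L¹ → L^∞` and `L² → L²`, phrased for
the moduli `φ` of the input and `F` of the output. -/
theorem lintegral_rpow_le_of_forall_split {β γ : Type*} [MeasurableSpace β] [MeasurableSpace γ]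
    {μ : Measure β} {ν : Measure γ} [SigmaFinite μ] [SigmaFinite ν]
    {p p' : ℝ} (hp : p.HolderConjugate p') (hp' : 2 < p') {φ : β → ℝ} {F : γ → ℝ}
    (hφ : Measurable φ) (hφ0 : ∀ x, 0 ≤ φ x) (hF : Measurable F) (hF0 : ∀ y, 0 ≤ F y)
    {A B N : ℝ} (hA : 0 ≤ A) (hB : 0 < B) (hN : 0 < N)
    (hφN : ∫⁻ x, ENNReal.ofReal (φ x ^ p) ∂μ = ENNReal.ofReal N)
    (split : ∀ h : ℝ, 0 < h → ∃ g : γ → ℝ≥0∞, Measurable g ∧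
      (∀ y, ENNReal.ofReal (F y) ≤
        ENNReal.ofReal B * (∫⁻ x in {x | h < φ x}, ENNReal.ofReal (φ x) ∂μ) + g y) ∧
      ∫⁻ y, g y ^ 2 ∂ν ≤ ENNReal.ofReal A * ∫⁻ x in {x | φ x ≤ h}, ENNReal.ofReal (φ x ^ 2) ∂μ) :
    ∫⁻ y, ENNReal.ofReal (F y ^ p') ∂ν ≤
      ENNReal.ofReal (p' / (p' - 2) * 2 ^ p' * (A * B ^ (p' - 2) * N ^ (p' - 1))) := by
  have hp0 := hp.pos
  have hp1 : 0 < p - 1 := by linarith [hp.lt]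
  have hp'0 := hp.symm.pos
  have hmul := hp.mul_eq_add
  set τ : β → ℝ := fun x => 2 * (B * N) * φ x ^ (1 - p) with hτ
  have hτm : Measurable τ := (hφ.pow_const _).const_mul _
  have hτ0 : ∀ x, 0 ≤ τ x := fun x => by have := Real.rpow_nonneg (hφ0 x) (1 - p); positivity
  set D : ℝ → β → ℝ≥0∞ := fun t x => {x | t ≤ τ x}.indicator
    (fun x => ENNReal.ofReal (t ^ (p' - 3)) * ENNReal.ofReal (φ x ^ 2)) x with hD
  have hDm : Measurable (Function.uncurry D) := by
    have : MeasurableSet {z : ℝ × β | z.1 ≤ τ z.2} :=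
      measurableSet_le measurable_fst (hτm.comp measurable_snd)
    refine Measurable.indicator (f := fun z : ℝ × β =>
      ENNReal.ofReal (z.1 ^ (p' - 3)) * ENNReal.ofReal (φ z.2 ^ 2)) ?_ this
    fun_prop
  have level : ∀ t : ℝ, 0 < t → ν {y | t < F y} * ENNReal.ofReal (t ^ (p' - 1)) ≤
      ENNReal.ofReal (4 * A) * ∫⁻ x, D t x ∂μ := by
    intro t ht
    set h : ℝ := (t / (2 * (B * N))) ^ (1 - p)⁻¹ with hh
    have hb : 0 < t / (2 * (B * N)) := by positivity
    have h0 : 0 < h := Real.rpow_pos_of_pos hb _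
    have hh1 : B * (h ^ (1 - p) * N) = t / 2 := by
      rw [hh, ← Real.rpow_mul hb.le, inv_mul_cancel₀ (by linarith), Real.rpow_one]
      field_simp
    obtain ⟨g, hg, hFg, hg2⟩ := split h h0
    have hbig : ENNReal.ofReal B * (∫⁻ x in {x | h < φ x}, ENNReal.ofReal (φ x) ∂μ) ≤
        ENNReal.ofReal (t / 2) := by
      rw [← hh1, ENNReal.ofReal_mul hB.le, ENNReal.ofReal_mul (by positivity), ← hφN,
        ← lintegral_const_mul (ENNReal.ofReal (h ^ (1 - p))) (by fun_prop)]
      refine mul_le_mul_right ?_ _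
      calc ∫⁻ x in {x | h < φ x}, ENNReal.ofReal (φ x) ∂μ
          ≤ ∫⁻ x in {x | h < φ x}, ENNReal.ofReal (h ^ (1 - p)) * ENNReal.ofReal (φ x ^ p) ∂μ := by
            apply setLIntegral_mono' (measurableSet_lt measurable_const hφ)
            intro x hx
            have hx : h < φ x := hx
            have hx0 : 0 < φ x := h0.trans hx
            rw [← ENNReal.ofReal_mul (by positivity)]
            apply ENNReal.ofReal_le_ofReal
            calc φ x = φ x ^ (1 - p) * φ x ^ p := by
                  rw [← Real.rpow_add hx0]; simp
              _ ≤ h ^ (1 - p) * φ x ^ p := by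
                  refine mul_le_mul_of_nonneg_right ?_ (by positivity)
                  exact Real.rpow_le_rpow_of_nonpos h0 hx.le (by linarith)
        _ ≤ _ := setLIntegral_le_lintegral _ _
    have hsub : {y | t < F y} ⊆ {y | ENNReal.ofReal ((t / 2) ^ 2) ≤ g y ^ 2} := by
      intro y hy
      have hy : t < F y := hy
      have h1 : ENNReal.ofReal (t / 2) ≤ g y := by
        by_contra hcon
        push Not at hcon
        have h2 := (hFg y).trans_lt (ENNReal.add_lt_add_of_le_of_lt (by
          exact (hbig.trans_lt ENNReal.ofReal_lt_top).ne) hbig hcon)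
        rw [← ENNReal.ofReal_add (by positivity) (by positivity)] at h2
        have := (ENNReal.ofReal_lt_ofReal_iff (by positivity)).1 h2
        linarith
      show ENNReal.ofReal ((t / 2) ^ 2) ≤ g y ^ 2
      rw [ENNReal.ofReal_pow (by positivity)]
      gcongr
    have hmeas : ν {y | t < F y} ≤ ENNReal.ofReal ((t / 2) ^ (-2 : ℝ)) * ∫⁻ y, g y ^ 2 ∂ν := by
      have h3 := mul_meas_ge_le_lintegral (μ := ν) (hg.pow_const 2) (ENNReal.ofReal ((t / 2) ^ 2))
      calc ν {y | t < F y} ≤ ν {y | ENNReal.ofReal ((t / 2) ^ 2) ≤ g y ^ 2} := measure_mono hsub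
        _ = ENNReal.ofReal ((t / 2) ^ (-2 : ℝ)) * (ENNReal.ofReal ((t / 2) ^ 2) *
              ν {y | ENNReal.ofReal ((t / 2) ^ 2) ≤ g y ^ 2}) := by
            rw [← mul_assoc, ← ENNReal.ofReal_mul (by positivity), Real.rpow_neg (by positivity),
              Real.rpow_ofNat, inv_mul_cancel₀ (by positivity)]
            simp
        _ ≤ _ := by gcongr
    calc ν {y | t < F y} * ENNReal.ofReal (t ^ (p' - 1))
        ≤ ENNReal.ofReal ((t / 2) ^ (-2 : ℝ)) * (ENNReal.ofReal A *
          ∫⁻ x in {x | φ x ≤ h}, ENNReal.ofReal (φ x ^ 2) ∂μ) * ENNReal.ofReal (t ^ (p' - 1)) := by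
          gcongr
          exact hmeas.trans (by gcongr)
      _ = ENNReal.ofReal (4 * A) * (ENNReal.ofReal (t ^ (p' - 3)) *
            ∫⁻ x in {x | φ x ≤ h}, ENNReal.ofReal (φ x ^ 2) ∂μ) := by
          have e1 : ENNReal.ofReal ((t / 2) ^ (-2 : ℝ)) * ENNReal.ofReal (t ^ (p' - 1)) =
              ENNReal.ofReal 4 * ENNReal.ofReal (t ^ (p' - 3)) := by
            rw [← ENNReal.ofReal_mul (by positivity), ← ENNReal.ofReal_mul (by positivity)]
            congr 1
            rw [show p' - 1 = (p' - 3) + (2 : ℝ) by ring, Real.rpow_add ht,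
              Real.rpow_neg (by positivity), Real.rpow_ofNat, Real.rpow_ofNat]
            field_simp
            norm_num
          rw [ENNReal.ofReal_mul (by norm_num)]
          calc _ = (ENNReal.ofReal ((t / 2) ^ (-2 : ℝ)) * ENNReal.ofReal (t ^ (p' - 1))) *
                (ENNReal.ofReal A * ∫⁻ x in {x | φ x ≤ h}, ENNReal.ofReal (φ x ^ 2) ∂μ) := by ring
            _ = _ := by rw [e1]; ring
      _ ≤ ENNReal.ofReal (4 * A) * ∫⁻ x, D t x ∂μ := by
          gcongr
          rw [← lintegral_const_mul _ (by fun_prop),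
            ← lintegral_indicator (measurableSet_le hφ measurable_const)]
          apply lintegral_mono
          intro x
          by_cases hx : φ x ≤ h
          · rw [indicator_of_mem (show x ∈ {x | φ x ≤ h} from hx)]
            rcases (hφ0 x).eq_or_lt with hx0 | hx0
            · simp [← hx0]
            · have : t ≤ τ x := by
                have h5 : h ^ (1 - p) ≤ φ x ^ (1 - p) :=
                  Real.rpow_le_rpow_of_nonpos hx0 hx (by linarith)
                calc t = 2 * (B * (h ^ (1 - p) * N)) := by rw [hh1]; ring
                  _ = 2 * (B * N) * h ^ (1 - p) := by ring
                  _ ≤ 2 * (B * N) * φ x ^ (1 - p) := by gcongr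
              simp only [hD]
              rw [indicator_of_mem (show x ∈ {x | t ≤ τ x} from this)]
          · rw [indicator_of_notMem (show x ∉ {x | φ x ≤ h} from hx)]
            exact zero_le
  have inner : ∀ x, ∫⁻ t in Ioi 0, D t x =
      ENNReal.ofReal ((2 * (B * N)) ^ (p' - 2) / (p' - 2)) * ENNReal.ofReal (φ x ^ p) := by
    intro x
    have e1 : ∫⁻ t in Ioi 0, D t x =
        ∫⁻ t in Ioo 0 (τ x), ENNReal.ofReal (t ^ (-(3 - p'))) * ENNReal.ofReal (φ x ^ 2) := by
      have e2 : ∀ t, D t x = (Iic (τ x)).indicator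
          (fun t => ENNReal.ofReal (t ^ (-(3 - p'))) * ENNReal.ofReal (φ x ^ 2)) t := by
        intro t
        simp only [hD, indicator_apply, mem_ofPred_eq, mem_Iic, neg_sub]
      simp only [e2]
      rw [setLIntegral_indicator measurableSet_Iic, inter_comm, Ioi_inter_Iic,
        Measure.restrict_congr_set Ioo_ae_eq_Ioc]
    rw [e1, lintegral_mul_const _ (by fun_prop), lintegral_Ioo_rpow_neg (by linarith) (hτ0 x),
      ← ENNReal.ofReal_mul (by have := hτ0 x; have : 0 < 1 - (3 - p') := by linarith
                               positivity),
      ← ENNReal.ofReal_mul (by have : 0 < p' - 2 := by linarith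
                               positivity)]
    congr 1
    rcases (hφ0 x).eq_or_lt with hx0 | hx0
    · rw [← hx0, Real.zero_rpow hp0.ne']; simp
    · have e3 : (φ x ^ (1 - p)) ^ (p' - 2) * φ x ^ 2 = φ x ^ p := by
        rw [← Real.rpow_mul hx0.le, ← Real.rpow_natCast, ← Real.rpow_add hx0]
        congr 1
        push_cast
        linarith
      rw [← e3, show 1 - (3 - p') = p' - 2 by ring]
      simp only [hτ]
      rw [Real.mul_rpow (by positivity) (by positivity)]
      ring
  calc ∫⁻ y, ENNReal.ofReal (F y ^ p') ∂ν
      = ENNReal.ofReal p' * ∫⁻ t in Ioi 0, ν {y | t < F y} * ENNReal.ofReal (t ^ (p' - 1)) :=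
        lintegral_rpow_eq_lintegral_meas_lt_mul ν (Filter.Eventually.of_forall hF0)
          hF.aemeasurable hp'0
    _ ≤ ENNReal.ofReal p' * ∫⁻ t in Ioi 0, ENNReal.ofReal (4 * A) * ∫⁻ x, D t x ∂μ := by
        refine mul_le_mul_right ?_ _
        exact setLIntegral_mono' measurableSet_Ioi fun t ht => level t ht
    _ = ENNReal.ofReal p' * (ENNReal.ofReal (4 * A) * ∫⁻ x, ∫⁻ t in Ioi 0, D t x ∂volume ∂μ) := by
        have hDi : Measurable fun t => ∫⁻ x, D t x ∂μ := hDm.lintegral_prod_right'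
        rw [lintegral_const_mul _ hDi, lintegral_lintegral_swap hDm.aemeasurable]
    _ = ENNReal.ofReal p' * (ENNReal.ofReal (4 * A) *
          (ENNReal.ofReal ((2 * (B * N)) ^ (p' - 2) / (p' - 2)) * ENNReal.ofReal N)) := by
        simp only [inner]
        rw [lintegral_const_mul _ (by fun_prop), hφN]
    _ = _ := by
        have h2 : 0 < p' - 2 := by linarith
        rw [← ENNReal.ofReal_mul (by positivity), ← ENNReal.ofReal_mul (by positivity),
          ← ENNReal.ofReal_mul (by positivity)]
        congr 1
        rw [Real.mul_rpow (by norm_num) (by positivity), Real.mul_rpow hB.le hN.le,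
          show p' - 1 = (p' - 2) + 1 by ring, Real.rpow_add hN, Real.rpow_one,
          show (2 : ℝ) ^ p' = 2 ^ (p' - 2) * 2 ^ (2 : ℝ) by
            rw [← Real.rpow_add (by norm_num)]; congr 1; ring, Real.rpow_ofNat]
        ring

theorem abs_inner_sphere_le {E : Type*} [NormedAddCommGroup E] [InnerProductSpace ℝ E] {v : E}
    (hv : ‖v‖ = 1) (ω : sphere (0 : E) 1) :
    |⟪v, (ω : E)⟫| ≤ 1 := by
  have := abs_real_inner_le_norm v (ω : E)
  simpa [hv] using this

section SphereIntegrals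

variable {E : Type*} [NormedAddCommGroup E] [InnerProductSpace ℝ E] [FiniteDimensional ℝ E]
  [MeasurableSpace E] [BorelSpace E]

theorem measurePreserving_sphere_of_linearIsometryEquiv (A : E ≃ₗᵢ[ℝ] E)
    (A' : sphere (0 : E) 1 → sphere (0 : E) 1) (hA : ∀ ω, (A' ω : E) = A ω) :
    MeasurePreserving A' (volume : Measure E).toSphere (volume : Measure E).toSphere := by
  have hc : Continuous A' := by
    rw [continuous_induced_rng]
    have : Subtype.val ∘ A' = fun ω : sphere (0 : E) 1 => A (ω : E) := funext hA
    rw [this]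
    exact A.continuous.comp continuous_subtype_val
  refine ⟨hc.measurable, ?_⟩
  ext s hs
  rw [Measure.map_apply hc.measurable hs, Measure.toSphere_apply' _ hs,
    Measure.toSphere_apply' _ (hc.measurable hs)]
  congr 1
  have hpre := A.measurePreserving.measure_preimage_emb
    A.toHomeomorph.measurableEmbedding (Ioo (0 : ℝ) 1 • ((↑) '' s : Set E))
  rw [← hpre]
  congr 1
  ext x
  simp only [Set.mem_smul, mem_image, mem_preimage, Subtype.exists, exists_and_right,
    exists_eq_right]
  constructor
  · rintro ⟨r, hr, y, ⟨hy, hys⟩, rfl⟩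
    refine ⟨r, hr, A y, ⟨?_, ?_⟩, ?_⟩
    · simpa using hy
    · convert hys; exact (hA ⟨y, hy⟩).symm
    · exact (map_smul A r y).symm
  · rintro ⟨r, hr, y, ⟨hy, hys⟩, hx⟩
    refine ⟨r, hr, A.symm y, ⟨?_, ?_⟩, ?_⟩
    · simpa using hy
    · convert hys; rw [hA]; simp
    · apply A.injective
      simpa using hx

theorem integral_sphere_comp_linearIsometryEquiv {G : Type*} [NormedAddCommGroup G]
    [NormedSpace ℝ G] (A : E ≃ₗᵢ[ℝ] E) {F : E → G} (hF : Continuous F) :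
    ∫ ω : sphere (0 : E) 1, F (A ω) ∂(volume : Measure E).toSphere =
      ∫ ω : sphere (0 : E) 1, F ω ∂(volume : Measure E).toSphere := by
  let A' : sphere (0 : E) 1 → sphere (0 : E) 1 := fun ω => ⟨A ω, by simp⟩
  have := measurePreserving_sphere_of_linearIsometryEquiv A A' fun _ => rfl
  conv_rhs => rw [← this.map_eq]
  rw [integral_map this.measurable.aemeasurable]
  · exact (hF.comp continuous_subtype_val).aestronglyMeasurable

theorem integrable_sphere {G : Type*} [NormedAddCommGroup G] {F : sphere (0 : E) 1 → G}
    (hF : Continuous F) : Integrable F (volume : Measure E).toSphere := by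
  rw [← integrableOn_univ]
  have : SecondCountableTopology E := inferInstance
  exact hF.continuousOn.integrableOn_compact isCompact_univ

/-- Infinitesimal rotation invariance of the surface measure. -/
theorem integral_sphere_inner_sq_mul_cos {v u : E} (hv : ‖v‖ = 1) (hu : ‖u‖ = 1) (hvu : ⟪v, u⟫ = 0)
    (r : ℝ) :
    r * ∫ ω : sphere (0 : E) 1, ⟪u, (ω : E)⟫ ^ 2 * Real.cos (r * ⟪v, (ω : E)⟫)
        ∂(volume : Measure E).toSphere =
      ∫ ω : sphere (0 : E) 1, ⟪v, (ω : E)⟫ * Real.sin (r * ⟪v, (ω : E)⟫)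
        ∂(volume : Measure E).toSphere := by
  have huv : ⟪u, v⟫ = 0 := by rw [real_inner_comm]; exact hvu
  set σ := (volume : Measure E).toSphere
  let a : ℝ → E → ℝ := fun φ x => Real.cos φ * ⟪v, x⟫ - Real.sin φ * ⟪u, x⟫
  let b : ℝ → E → ℝ := fun φ x => -(Real.cos φ * ⟪u, x⟫ + Real.sin φ * ⟪v, x⟫)
  let F : E → ℝ := fun x => ⟪u, x⟫ * Real.sin (r * ⟪v, x⟫)
  have hF : Continuous F := by fun_prop
  have hconst : ∀ φ, ∫ ω : sphere (0 : E) 1, b φ ω * Real.sin (r * a φ ω) ∂σ =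
      ∫ ω : sphere (0 : E) 1, F ω ∂σ := by
    intro φ
    set w : E := Real.cos (φ / 2) • u + Real.sin (φ / 2) • v with hw
    have hww : ‖w‖ = 1 := by
      have : ‖w‖ ^ 2 = 1 := by
        rw [← real_inner_self_eq_norm_sq, hw]
        simp only [inner_add_left, inner_add_right, inner_smul_left, inner_smul_right, hvu, huv,
          real_inner_self_eq_norm_sq, hv, hu]
        simp
        nlinarith [Real.sin_sq_add_cos_sq (φ / 2)]
      nlinarith [norm_nonneg w]
    have hcos : Real.cos φ = 2 * Real.cos (φ / 2) ^ 2 - 1 := by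
      rw [← Real.cos_two_mul]; ring_nf
    have hsin : Real.sin φ = 2 * Real.sin (φ / 2) * Real.cos (φ / 2) := by
      rw [← Real.sin_two_mul]; ring_nf
    have hs := Real.sin_sq_add_cos_sq (φ / 2)
    rw [← integral_sphere_comp_linearIsometryEquiv ((ℝ ∙ w)ᗮ.reflection) hF]
    congr 1; ext ω
    have hrefl : (ℝ ∙ w)ᗮ.reflection (ω : E) = (ω : E) - (2 * ⟪w, (ω : E)⟫) • w := by
      rw [Submodule.reflection_orthogonal_apply, Submodule.reflection_singleton_apply]
      simp [hww]
      module
    have e1 : ⟪u, (ℝ ∙ w)ᗮ.reflection (ω : E)⟫ = b φ ω := by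
      rw [hrefl]
      simp only [b, hw, inner_sub_right, inner_smul_right, inner_add_right, inner_add_left,
        inner_smul_left, conj_trivial, huv, real_inner_self_eq_norm_sq, hu]
      rw [hcos, hsin]; ring
    have e2 : ⟪v, (ℝ ∙ w)ᗮ.reflection (ω : E)⟫ = a φ ω := by
      rw [hrefl]
      simp only [a, hw, inner_sub_right, inner_smul_right, inner_add_right, inner_add_left,
        inner_smul_left, conj_trivial, hvu, real_inner_self_eq_norm_sq, hv]
      rw [hcos, hsin]
      linear_combination (2 * ⟪v, (ω : E)⟫) * hs.symm
    simp only [F, e1, e2]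
  have ha : ∀ φ x, HasDerivAt (fun φ => a φ x) (b φ x) φ := by
    intro φ x
    have := ((Real.hasDerivAt_cos φ).mul_const ⟪v, x⟫).sub
      ((Real.hasDerivAt_sin φ).mul_const ⟪u, x⟫)
    exact this.congr_deriv (by simp only [b]; ring)
  have hb : ∀ φ x, HasDerivAt (fun φ => b φ x) (-a φ x) φ := by
    intro φ x
    have := (((Real.hasDerivAt_cos φ).mul_const ⟪u, x⟫).add
      ((Real.hasDerivAt_sin φ).mul_const ⟪v, x⟫)).neg
    exact this.congr_deriv (by simp only [a]; ring)
  have hderiv : ∀ φ x, HasDerivAt (fun φ => b φ x * Real.sin (r * a φ x))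
      (-a φ x * Real.sin (r * a φ x) + b φ x * (Real.cos (r * a φ x) * (r * b φ x))) φ := by
    intro φ x
    exact (hb φ x).mul (((ha φ x).const_mul r).sin)
  have hab : ∀ φ (ω : sphere (0 : E) 1), |a φ ω| ≤ 2 ∧ |b φ ω| ≤ 2 := by
    intro φ ω
    have h1 := abs_inner_sphere_le hv ω
    have h2 := abs_inner_sphere_le hu ω
    have h3 := Real.abs_cos_le_one φ
    have h4 := Real.abs_sin_le_one φ
    have key : ∀ {c x : ℝ}, |c| ≤ 1 → |x| ≤ 1 → |c * x| ≤ 1 := fun hc hx => by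
      rw [abs_mul]; exact mul_le_one₀ hc (abs_nonneg _) hx
    refine ⟨(abs_sub _ _).trans ?_, ?_⟩
    · linarith [key h3 h1, key h4 h2]
    · simp only [b, abs_neg]
      refine (abs_add_le _ _).trans ?_
      linarith [key h3 h2, key h4 h1]
  have hmain := hasDerivAt_integral_of_dominated_loc_of_deriv_le (μ := σ)
    (F := fun φ (ω : sphere (0 : E) 1) => b φ ω * Real.sin (r * a φ ω))
    (F' := fun φ (ω : sphere (0 : E) 1) => -a φ ω * Real.sin (r * a φ ω) +
      b φ ω * (Real.cos (r * a φ ω) * (r * b φ ω))) (x₀ := 0) (s := univ)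
    (bound := fun _ => 2 + 2 * (1 * (|r| * 2))) Filter.univ_mem ?_ ?_ ?_ ?_ ?_ ?_
  · have hz : HasDerivAt (fun φ => ∫ ω : sphere (0 : E) 1, b φ ω * Real.sin
      (r * a φ ω) ∂σ) 0 0 := by
      simp only [hconst]; exact hasDerivAt_const _ _
    have h0 := hmain.2.unique hz
    simp only [a, b, Real.cos_zero, Real.sin_zero, one_mul, zero_mul, sub_zero, add_zero] at h0
    rw [integral_add (integrable_sphere (by fun_prop)) (integrable_sphere (by fun_prop))] at h0
    have e1 : ∫ ω : sphere (0 : E) 1, -⟪v, (ω : E)⟫ * Real.sin (r * ⟪v, (ω : E)⟫) ∂σ =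
        -∫ ω : sphere (0 : E) 1, ⟪v, (ω : E)⟫ * Real.sin (r * ⟪v, (ω : E)⟫) ∂σ := by
      rw [← integral_neg]; congr 1; ext; ring
    have e2 : ∫ ω : sphere (0 : E) 1, -⟪u, (ω : E)⟫ * (Real.cos (r * ⟪v, (ω : E)⟫) *
        (r * -⟪u, (ω : E)⟫)) ∂σ =
        r * ∫ ω : sphere (0 : E) 1, ⟪u, (ω : E)⟫ ^ 2 * Real.cos (r * ⟪v, (ω : E)⟫) ∂σ := by
      rw [← integral_const_mul]; congr 1; ext; ring
    rw [e1, e2] at h0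
    linarith
  · refine Filter.Eventually.of_forall fun φ => Continuous.aestronglyMeasurable ?_
    simp only [a, b]; fun_prop
  · apply integrable_sphere; simp only [a, b]; fun_prop
  · apply Continuous.aestronglyMeasurable; simp only [a, b]; fun_prop
  · refine Filter.Eventually.of_forall fun ω φ _ => ?_
    obtain ⟨h1, h2⟩ := hab φ ω
    refine (norm_add_le _ _).trans ?_
    simp only [norm_mul, norm_neg, Real.norm_eq_abs]
    have h3 := Real.abs_sin_le_one (r * a φ ω)
    have h4 := Real.abs_cos_le_one (r * a φ ω)
    gcongr
    calc |a φ ω| * |Real.sin (r * a φ ω)| ≤ 2 * 1 := by gcongr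
      _ = 2 := by ring
  · exact integrable_const _
  · exact Filter.Eventually.of_forall fun ω φ _ => hderiv φ ω

end SphereIntegrals

/-- Decay of solutions of `r y'' + 2 m y' + r y = 0`. -/
theorem abs_le_rpow_of_bessel_ode {m M : ℝ} (hm : 0 ≤ m) (hM : 0 ≤ M) {y y₁ y₂ : ℝ → ℝ}
    (h0 : ∀ r, HasDerivAt y (y₁ r) r) (h1 : ∀ r, HasDerivAt y₁ (y₂ r) r)
    (ode : ∀ r, 0 < r → r * y₂ r + 2 * m * y₁ r + r * y r = 0) (hy : |y 1| ≤ M) (hy1 : |y₁ 1| ≤ M)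
    {r : ℝ} (hr : 1 ≤ r) :
    |y r| ≤ (1 + m) * (2 + m) * Real.exp |m * (m - 1)| * M * r ^ (-m) ∧
      |y₁ r| ≤ (1 + m) * (2 + m) * Real.exp |m * (m - 1)| * M * r ^ (-m) := by
  set c := |m * (m - 1)| with hc
  have hc0 : 0 ≤ c := abs_nonneg _
  set w : ℝ → ℝ := fun r => y₁ r + m / r * y r with hw
  set G : ℝ → ℝ := fun r => r ^ (2 * m) * (w r ^ 2 + y r ^ 2) * Real.exp (c / r) with hG
  have hGd : ∀ r, 0 < r → HasDerivAt G (r ^ (2 * m) * Real.exp (c / r) *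
      (2 * (m * (m - 1)) / r ^ 2 * (w r * y r) - c / r ^ 2 * (w r ^ 2 + y r ^ 2))) r := by
    intro r hr
    have hy2 : y₂ r = -(2 * m / r * y₁ r) - y r := by
      have := ode r hr
      field_simp; linarith
    have d1 : HasDerivAt (fun r : ℝ => r ^ (2 * m)) (2 * m * r ^ (2 * m - 1)) r :=
      Real.hasDerivAt_rpow_const (Or.inl hr.ne')
    have d2 : HasDerivAt (fun r : ℝ => m / r) (-m / r ^ 2) r := by
      have := (hasDerivAt_inv hr.ne').const_mul m
      exact (this.congr_deriv (by ring))
    have d3 : HasDerivAt (fun r : ℝ => c / r) (-c / r ^ 2) r := by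
      have := (hasDerivAt_inv hr.ne').const_mul c
      exact (this.congr_deriv (by ring))
    have d4 : HasDerivAt w (y₂ r + (-m / r ^ 2 * y r + m / r * y₁ r)) r :=
        (h1 r).add (d2.mul (h0 r))
    have d5 := (d1.mul ((d4.pow 2).add ((h0 r).pow 2))).mul d3.exp
    refine d5.congr_deriv ?_
    have e : r ^ (2 * m - 1) = r ^ (2 * m) / r := by rw [Real.rpow_sub_one hr.ne']
    have hy1 : y₁ r = w r - m / r * y r := by simp only [hw]; ring
    simp only [Pi.mul_apply, Pi.add_apply, Pi.pow_apply, e, hy2, hy1]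
    generalize w r = W
    generalize y r = Y
    generalize Real.exp (c / r) = X
    generalize r ^ (2 * m) = R
    norm_num
    field_simp
    ring
  have hanti : AntitoneOn G (Ici 1) := by
    apply antitoneOn_of_deriv_nonpos (convex_Ici 1)
    · intro r hr
      exact (hGd r (by have : (1 : ℝ) ≤ r := hr; linarith)).continuousAt.continuousWithinAt
    · intro r hr
      rw [interior_Ici] at hr
      exact (hGd r (by have : (1 : ℝ) < r := hr; linarith)).differentiableAt.differentiableWithinAt
    · intro r hr
      rw [interior_Ici] at hr
      have hr0 : 0 < r := by have : (1 : ℝ) < r := hr; linarith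
      rw [(hGd r hr0).deriv]
      apply mul_nonpos_of_nonneg_of_nonpos (by positivity)
      have e : 2 * (m * (m - 1)) / r ^ 2 * (w r * y r) - c / r ^ 2 * (w r ^ 2 + y r ^ 2) =
          (2 * (m * (m - 1)) * (w r * y r) - c * (w r ^ 2 + y r ^ 2)) / r ^ 2 := by ring
      rw [e]
      apply div_nonpos_of_nonpos_of_nonneg _ (by positivity)
      have h2 : m * (m - 1) * (w r * y r) ≤ c * |w r * y r| := by
        rw [hc, ← abs_mul]; exact le_abs_self _
      have h3 : 2 * |w r * y r| ≤ w r ^ 2 + y r ^ 2 := by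
        rw [abs_mul]
        nlinarith [sq_nonneg (|w r| - |y r|), sq_abs (w r), sq_abs (y r)]
      nlinarith
  have hr0 : 0 < r := by linarith
  have hG1 : G 1 ≤ ((2 + m) * M) ^ 2 * Real.exp c := by
    simp only [hG, hw, Real.one_rpow, one_mul, div_one]
    gcongr
    have a1 : (y₁ 1 + m * y 1) ^ 2 ≤ ((1 + m) * M) ^ 2 := by
      apply sq_le_sq'
      · have := abs_le.1 hy; have := abs_le.1 hy1; nlinarith
      · have := abs_le.1 hy; have := abs_le.1 hy1; nlinarith
    have a2 : y 1 ^ 2 ≤ M ^ 2 := sq_le_sq' (abs_le.1 hy).1 (abs_le.1 hy).2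
    nlinarith [mul_nonneg hm (sq_nonneg M)]
  have hGr := hanti (mem_Ici.2 le_rfl) (mem_Ici.2 hr) hr
  set Q := (2 + m) * M * Real.exp c with hQ
  have hQ0 : 0 ≤ Q := by positivity
  have hE : r ^ (2 * m) * (w r ^ 2 + y r ^ 2) ≤ Q ^ 2 := by
    calc r ^ (2 * m) * (w r ^ 2 + y r ^ 2)
        ≤ r ^ (2 * m) * (w r ^ 2 + y r ^ 2) * Real.exp (c / r) := by
          apply le_mul_of_one_le_right (by positivity)
          exact Real.one_le_exp (by positivity)
      _ ≤ ((2 + m) * M) ^ 2 * Real.exp c := hGr.trans hG1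
      _ ≤ ((2 + m) * M) ^ 2 * (Real.exp c) ^ 2 := by
          gcongr
          exact le_self_pow₀ (Real.one_le_exp hc0) (by norm_num)
      _ = Q ^ 2 := by rw [hQ]; ring
  have hrm : r ^ (2 * m) = (r ^ m) ^ 2 := by
    rw [← Real.rpow_natCast, ← Real.rpow_mul hr0.le]; congr 1; push_cast; ring
  have hrpos : 0 < r ^ m := Real.rpow_pos_of_pos hr0 _
  have hz : |y r| ≤ Q * r ^ (-m) := by
    rw [Real.rpow_neg hr0.le, ← div_eq_mul_inv, le_div_iff₀ hrpos]
    apply le_of_sq_le_sq _ hQ0 |> fun h => h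
    rw [mul_pow, sq_abs]
    rw [hrm] at hE
    nlinarith [sq_nonneg (w r * r ^ m)]
  have hz1 : |w r| ≤ Q * r ^ (-m) := by
    rw [Real.rpow_neg hr0.le, ← div_eq_mul_inv, le_div_iff₀ hrpos]
    apply le_of_sq_le_sq _ hQ0 |> fun h => h
    rw [mul_pow, sq_abs]
    rw [hrm] at hE
    nlinarith [sq_nonneg (y r * r ^ m)]
  have hT : (1 + m) * (2 + m) * Real.exp c * M * r ^ (-m) = (1 + m) * (Q * r ^ (-m)) := by
    rw [hQ]; ring
  have hQr : 0 ≤ Q * r ^ (-m) := by positivity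
  rw [hT]
  constructor
  · nlinarith
  · have e : y₁ r = w r - m / r * y r := by simp only [hw]; ring
    have hmr : m / r ≤ m := div_le_self hm hr
    calc |y₁ r| ≤ |w r| + |m / r * y r| := by rw [e]; exact abs_sub _ _
      _ = |w r| + m / r * |y r| := by rw [abs_mul, abs_of_nonneg (show 0 ≤ m / r by positivity)]
      _ ≤ Q * r ^ (-m) + m * (Q * r ^ (-m)) := by gcongr
      _ = _ := by ring

section SphereDecay

variable {E : Type*} [NormedAddCommGroup E] [InnerProductSpace ℝ E] [FiniteDimensional ℝ E]
  [MeasurableSpace E] [BorelSpace E]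

theorem hasDerivAt_integral_sphere_mul_cos {g : E → ℝ} (hg : Continuous g) {v : E} (hv : ‖v‖ = 1)
    (hb : ∀ ω : sphere (0 : E) 1, |g ω| ≤ 1) (θ r : ℝ) :
    HasDerivAt (fun r => ∫ ω : sphere (0 : E) 1, g ω * Real.cos (r * ⟪v, (ω : E)⟫ + θ)
        ∂(volume : Measure E).toSphere)
      (∫ ω : sphere (0 : E) 1, g ω * (-Real.sin (r * ⟪v, (ω : E)⟫ + θ) * ⟪v, (ω : E)⟫)
        ∂(volume : Measure E).toSphere) r := by
  refine (hasDerivAt_integral_of_dominated_loc_of_deriv_le (x₀ := r) (s := univ)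
    (F := fun r (ω : sphere (0 : E) 1) => g ω * Real.cos (r * ⟪v, (ω : E)⟫ + θ))
    (F' := fun r (ω : sphere (0 : E) 1) =>
      g ω * (-Real.sin (r * ⟪v, (ω : E)⟫ + θ) * ⟪v, (ω : E)⟫))
    (bound := fun _ => 1) Filter.univ_mem ?_ ?_ ?_ ?_ ?_ ?_).2
  · exact Filter.Eventually.of_forall fun r => Continuous.aestronglyMeasurable (by fun_prop)
  · exact integrable_sphere (by fun_prop)
  · exact Continuous.aestronglyMeasurable (by fun_prop)
  · refine Filter.Eventually.of_forall fun ω r _ => ?_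
    rw [Real.norm_eq_abs, abs_mul, abs_mul, abs_neg]
    exact mul_le_one₀ (hb ω) (by positivity)
      (mul_le_one₀ (Real.abs_sin_le_one _) (abs_nonneg _) (abs_inner_sphere_le hv ω))
  · exact integrable_const _
  · refine Filter.Eventually.of_forall fun ω r _ => ?_
    have : HasDerivAt (fun r => r * ⟪v, (ω : E)⟫ + θ) ⟪v, (ω : E)⟫ r := by
      simpa using ((hasDerivAt_id r).mul_const ⟪v, (ω : E)⟫).add_const θ
    exact this.cos.const_mul _

theorem abs_integral_sphere_le {F : sphere (0 : E) 1 → ℝ} (hF : ∀ ω, |F ω| ≤ 1) :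
    |∫ ω, F ω ∂(volume : Measure E).toSphere| ≤ (volume : Measure E).toSphere.real univ := by
  have := norm_integral_le_of_norm_le_const (μ := (volume : Measure E).toSphere) (f := F) (C := 1)
    (Filter.Eventually.of_forall hF)
  simpa using this

end SphereDecay

section SphereKernel

variable {E : Type*} [NormedAddCommGroup E] [InnerProductSpace ℝ E] [FiniteDimensional ℝ E]
  [MeasurableSpace E] [BorelSpace E]

theorem integral_sphere_inner_sq_mul_cos' {v w : E} (hv : ‖v‖ = 1) (hvw : ⟪v, w⟫ = 0) (r : ℝ) :
    r * ∫ ω : sphere (0 : E) 1, ⟪w, (ω : E)⟫ ^ 2 * Real.cos (r * ⟪v, (ω : E)⟫)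
        ∂(volume : Measure E).toSphere =
      ‖w‖ ^ 2 * ∫ ω : sphere (0 : E) 1, ⟪v, (ω : E)⟫ * Real.sin (r * ⟪v, (ω : E)⟫)
        ∂(volume : Measure E).toSphere := by
  rcases eq_or_ne w 0 with rfl | hw
  · simp
  have hn : ‖w‖ ≠ 0 := norm_ne_zero_iff.2 hw
  rw [← integral_sphere_inner_sq_mul_cos (u := ‖w‖⁻¹ • w) hv (by simp [norm_smul, hn])
    (by simp [inner_smul_right, hvw]) r, mul_left_comm]
  refine congrArg (r * ·) ?_
  rw [← integral_const_mul]
  refine integral_congr_ae (.of_forall fun ω => ?_)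
  simp only [real_inner_smul_left]
  field_simp

theorem integral_sphere_inner_mul_inner_mul_cos {v w : E} (hvw : ⟪v, w⟫ = 0) (r : ℝ) :
    ∫ ω : sphere (0 : E) 1, ⟪v, (ω : E)⟫ * ⟪w, (ω : E)⟫ * Real.cos (r * ⟪v, (ω : E)⟫)
        ∂(volume : Measure E).toSphere = 0 := by
  have h := integral_sphere_comp_linearIsometryEquiv ((ℝ ∙ w)ᗮ.reflection)
    (F := fun x : E => ⟪v, x⟫ * ⟪w, x⟫ * Real.cos (r * ⟪v, x⟫)) (by fun_prop)
  have h1 : (ℝ ∙ w)ᗮ.reflection v = v := by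
    apply Submodule.reflection_mem_subspace_eq_self
    rw [Submodule.mem_orthogonal_singleton_iff_inner_left]; exact hvw
  have h2 : (ℝ ∙ w)ᗮ.reflection w = -w :=
      Submodule.reflection_orthogonalComplement_singleton_eq_neg w
  have e1 : ∀ x, ⟪v, (ℝ ∙ w)ᗮ.reflection x⟫ = ⟪v, x⟫ := fun x => by
    conv_lhs => rw [← h1]
    exact LinearIsometryEquiv.inner_map_map _ _ _
  have e2 : ∀ x, ⟪w, (ℝ ∙ w)ᗮ.reflection x⟫ = -⟪w, x⟫ := fun x => by
    rw [← neg_eq_iff_eq_neg, ← inner_neg_left, ← h2]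
    exact LinearIsometryEquiv.inner_map_map _ _ _
  simp only [e1, e2, mul_neg, neg_mul, integral_neg] at h
  linarith

theorem abs_integral_sphere_inner_sq_mul_cos_le {m : ℝ} (hm : 0 ≤ m)
    (hmE : (Module.finrank ℝ E : ℝ) = 2 * m + 1) {v e : E} (hv : ‖v‖ = 1) (he : ‖e‖ = 1) {r : ℝ}
    (hr : 1 ≤ r) :
    |∫ ω : sphere (0 : E) 1, ⟪e, (ω : E)⟫ ^ 2 * Real.cos (r * ⟪v, (ω : E)⟫)
        ∂(volume : Measure E).toSphere| ≤
      (2 * m + 2) * ((1 + m) * (2 + m) * Real.exp |m * (m - 1)| *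
        (volume : Measure E).toSphere.real univ) * r ^ (-m) := by
  set σ := (volume : Measure E).toSphere
  set y : ℝ → ℝ := fun r => ∫ ω : sphere (0 : E) 1, 1 * Real.cos (r * ⟪v, (ω : E)⟫ + 0) ∂σ with hy
  set y₁ : ℝ → ℝ := fun r => ∫ ω : sphere (0 : E) 1,
    1 * (-Real.sin (r * ⟪v, (ω : E)⟫ + 0) * ⟪v, (ω : E)⟫) ∂σ with hy1
  set y₂ : ℝ → ℝ := fun r => ∫ ω : sphere (0 : E) 1,
    ⟪v, (ω : E)⟫ * (-Real.sin (r * ⟪v, (ω : E)⟫ + Real.pi / 2) * ⟪v, (ω : E)⟫) ∂σ with hy2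
  have d0 : ∀ r, HasDerivAt y (y₁ r) r := fun r =>
    hasDerivAt_integral_sphere_mul_cos (g := fun _ => 1) continuous_const hv (by simp) 0 r
  have ey1 : y₁ = fun r => ∫ ω : sphere (0 : E) 1,
      ⟪v, (ω : E)⟫ * Real.cos (r * ⟪v, (ω : E)⟫ + Real.pi / 2) ∂σ := by
    ext r; simp only [hy1]; congr 1; ext ω
    rw [Real.cos_add_pi_div_two, add_zero]; ring
  have d1 : ∀ r, HasDerivAt y₁ (y₂ r) r := fun r => by
    rw [ey1]
    exact hasDerivAt_integral_sphere_mul_cos (g := fun x => ⟪v, x⟫) (by fun_prop) hv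
      (abs_inner_sphere_le hv) _ r
  have ey1' : ∀ r, y₁ r = -∫ ω : sphere (0 : E) 1,
      ⟪v, (ω : E)⟫ * Real.sin (r * ⟪v, (ω : E)⟫) ∂σ := fun r => by
    rw [congrFun ey1 r, ← integral_neg]
    refine integral_congr_ae (.of_forall fun ω => ?_)
    simp only [Real.cos_add_pi_div_two]; ring
  have ey2 : ∀ r, y₂ r = -∫ ω : sphere (0 : E) 1,
      ⟪v, (ω : E)⟫ ^ 2 * Real.cos (r * ⟪v, (ω : E)⟫) ∂σ := fun r => by
    simp only [hy2]
    rw [← integral_neg]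
    refine integral_congr_ae (.of_forall fun ω => ?_)
    simp only [Real.sin_add_pi_div_two]; ring
  have ode : ∀ r, 0 < r → r * y₂ r + 2 * m * y₁ r + r * y r = 0 := by
    classical
    intro r _
    obtain ⟨u, b, hvu, hb⟩ := Orthonormal.exists_orthonormalBasis_extension (𝕜 := ℝ) (v := {v})
      (E := E) (by
        rw [orthonormal_subtype_iff_ite]
        simp [hv])
    have hvu' : v ∈ u := by simpa using hvu
    have hcard : (Fintype.card u : ℝ) = 2 * m + 1 := by
      rw [← hmE, Module.finrank_eq_card_basis b.toBasis]
    have hsum : ∀ ω : sphere (0 : E) 1, ∑ i : u, ⟪(i : E), (ω : E)⟫ ^ 2 = 1 := fun ω => by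
      have := b.sum_sq_inner_right (ω : E)
      simpa [hb] using this
    have e1 : y r = ∑ i : u, ∫ ω : sphere (0 : E) 1,
        ⟪(i : E), (ω : E)⟫ ^ 2 * Real.cos (r * ⟪v, (ω : E)⟫) ∂σ := by
      rw [← integral_finsetSum _ fun i _ => integrable_sphere (by fun_prop)]
      simp only [hy]
      congr 1; ext ω
      rw [← Finset.sum_mul, hsum, add_zero]
    have e2 : ∀ i : u, i ≠ ⟨v, hvu'⟩ → r * ∫ ω : sphere (0 : E) 1,
        ⟪(i : E), (ω : E)⟫ ^ 2 * Real.cos (r * ⟪v, (ω : E)⟫) ∂σ = - y₁ r := by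
      intro i hi
      have ho := b.orthonormal
      rw [hb] at ho
      rw [ey1', neg_neg]
      exact integral_sphere_inner_sq_mul_cos hv (ho.1 i) (ho.2 hi.symm) r
    rw [e1, Finset.mul_sum, ← Finset.add_sum_erase _ _ (Finset.mem_univ (⟨v, hvu'⟩ : u)),
      Finset.sum_congr rfl (fun i hi => e2 i (Finset.ne_of_mem_erase hi)), Finset.sum_const,
      Finset.card_erase_of_mem (Finset.mem_univ _), Finset.card_univ, ey2, nsmul_eq_mul,
      Nat.cast_sub (Fintype.card_pos_iff.2 ⟨⟨v, hvu'⟩⟩), hcard]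
    push_cast
    ring
  have b0 : |y 1| ≤ σ.real univ := abs_integral_sphere_le fun ω => by
    simpa using Real.abs_cos_le_one _
  have b1 : |y₁ 1| ≤ σ.real univ := abs_integral_sphere_le fun ω => by
    rw [one_mul, abs_mul, abs_neg]
    exact mul_le_one₀ (Real.abs_sin_le_one _) (abs_nonneg _) (abs_inner_sphere_le hv ω)
  obtain ⟨k0, k1⟩ := abs_le_rpow_of_bessel_ode hm measureReal_nonneg d0 d1 ode b0 b1 hr
  set Q := (1 + m) * (2 + m) * Real.exp |m * (m - 1)| * σ.real univ
  have hr0 : 0 < r := by linarith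
  set α := ⟪v, e⟫ with hα
  set w := e - α • v with hw
  have hvw : ⟪v, w⟫ = 0 := by
    rw [hw, inner_sub_right, real_inner_smul_right, real_inner_self_eq_norm_sq, hv]; simp [hα]
  have hnorm : α ^ 2 + ‖w‖ ^ 2 = 1 := by
    have e1 : e = α • v + w := by rw [hw]; module
    have : ‖e‖ ^ 2 = α ^ 2 + ‖w‖ ^ 2 := by
      rw [e1, norm_add_sq_real, real_inner_smul_left, hvw, norm_smul, hv]
      simp
    rw [← this, he]; norm_num
  have hsplit : ∫ ω : sphere (0 : E) 1, ⟪e, (ω : E)⟫ ^ 2 * Real.cos (r * ⟪v, (ω : E)⟫) ∂σ =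
      α ^ 2 * (∫ ω : sphere (0 : E) 1, ⟪v, (ω : E)⟫ ^ 2 * Real.cos (r * ⟪v, (ω : E)⟫) ∂σ) +
      2 * α * (∫ ω : sphere (0 : E) 1, ⟪v, (ω : E)⟫ * ⟪w, (ω : E)⟫ *
        Real.cos (r * ⟪v, (ω : E)⟫) ∂σ) +
      ∫ ω : sphere (0 : E) 1, ⟪w, (ω : E)⟫ ^ 2 * Real.cos (r * ⟪v, (ω : E)⟫) ∂σ := by
    rw [← integral_const_mul, ← integral_const_mul, ← integral_add (integrable_sphere (by fun_prop))
      (integrable_sphere (by fun_prop)), ← integral_add (integrable_sphere (by fun_prop))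
      (integrable_sphere (by fun_prop))]
    congr 1; ext ω
    have : ⟪e, (ω : E)⟫ = α * ⟪v, (ω : E)⟫ + ⟪w, (ω : E)⟫ := by
      rw [hw, inner_sub_left, real_inner_smul_left]; ring
    rw [this]; ring
  have h3 : ∫ ω : sphere (0 : E) 1, ⟪w, (ω : E)⟫ ^ 2 * Real.cos (r * ⟪v, (ω : E)⟫) ∂σ =
      -(‖w‖ ^ 2 * y₁ r / r) := by
    have := integral_sphere_inner_sq_mul_cos' hv hvw r
    rw [ey1']
    field_simp
    rw [mul_comm r] at this
    linarith
  have h1 : ∫ ω : sphere (0 : E) 1, ⟪v, (ω : E)⟫ ^ 2 * Real.cos (r * ⟪v, (ω : E)⟫) ∂σ =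
      2 * m / r * y₁ r + y r := by
    have e1 := ode r hr0
    rw [eq_comm, ← sub_eq_zero, ← mul_right_inj' hr0.ne', mul_zero, ← e1, ey2]
    field_simp
    ring
  rw [hsplit, integral_sphere_inner_mul_inner_mul_cos hvw, h1, h3, mul_zero, add_zero]
  have hmr : 2 * m / r ≤ 2 * m := div_le_self (by linarith) hr
  have hα1 : α ^ 2 ≤ 1 := by nlinarith [sq_nonneg ‖w‖]
  have hw1 : ‖w‖ ^ 2 ≤ 1 := by nlinarith [sq_nonneg α]
  have t1 : |α ^ 2 * (2 * m / r * y₁ r + y r)| ≤ 1 * (2 * m * (Q * r ^ (-m)) + Q * r ^ (-m)) := by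
    rw [abs_mul, abs_of_nonneg (sq_nonneg α)]
    gcongr
    refine (abs_add_le _ _).trans ?_
    rw [abs_mul, abs_of_nonneg (show 0 ≤ 2 * m / r by positivity)]
    gcongr
  have t2 : |-(‖w‖ ^ 2 * y₁ r / r)| ≤ Q * r ^ (-m) := by
    rw [abs_neg, abs_div, abs_mul, abs_of_nonneg (sq_nonneg ‖w‖), abs_of_pos hr0]
    refine (div_le_self (by positivity) hr).trans ?_
    calc _ ≤ 1 * |y₁ r| := by gcongr
      _ ≤ _ := by linarith
  refine (abs_add_le _ _).trans ((add_le_add t1 t2).trans (le_of_eq ?_))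
  ring

/-- Stationary phase bound for the Fourier transform of the measure `⟪e, ω⟫² dσ(ω)`. -/
theorem norm_integral_sphere_inner_sq_mul_exp_le {m : ℝ} (hm : 0 ≤ m)
    (hmE : (Module.finrank ℝ E : ℝ) = 2 * m + 1) {e : E} (he : ‖e‖ = 1) {x : E} (hx : x ≠ 0) :
    ‖∫ ω : sphere (0 : E) 1, ((⟪e, (ω : E)⟫ ^ 2 : ℝ) : ℂ) * Complex.exp (Complex.I * ⟪x, (ω : E)⟫)
        ∂(volume : Measure E).toSphere‖ ≤
      (2 * m + 2) * ((1 + m) * (2 + m) * Real.exp |m * (m - 1)| *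
        (volume : Measure E).toSphere.real univ) * ‖x‖ ^ (-m) := by
  set σ := (volume : Measure E).toSphere
  have hr0 : 0 < ‖x‖ := norm_pos_iff.2 hx
  set v := ‖x‖⁻¹ • x with hv
  have hv1 : ‖v‖ = 1 := by simp [hv, norm_smul, hr0.ne']
  have hxv : ∀ z : E, ⟪x, z⟫ = ‖x‖ * ⟪v, z⟫ := fun z => by
    rw [hv, real_inner_smul_left]; field_simp
  have hodd : ∫ ω : sphere (0 : E) 1, ⟪e, (ω : E)⟫ ^ 2 * Real.sin ⟪x, (ω : E)⟫ ∂σ = 0 := by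
    have h := integral_sphere_comp_linearIsometryEquiv (LinearIsometryEquiv.neg ℝ)
      (F := fun z : E => ⟪e, z⟫ ^ 2 * Real.sin ⟪x, z⟫) (by fun_prop)
    simp only [LinearIsometryEquiv.coe_neg, inner_neg_right, Real.sin_neg, neg_sq, mul_neg,
      integral_neg] at h
    linarith
  have hreal : ∫ ω : sphere (0 : E) 1, ((⟪e, (ω : E)⟫ ^ 2 : ℝ) : ℂ) *
      Complex.exp (Complex.I * ⟪x, (ω : E)⟫) ∂σ =
      ((∫ ω : sphere (0 : E) 1, ⟪e, (ω : E)⟫ ^ 2 * Real.cos (‖x‖ * ⟪v, (ω : E)⟫) ∂σ : ℝ) : ℂ) := by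
    have e1 : ∀ ω : sphere (0 : E) 1, ((⟪e, (ω : E)⟫ ^ 2 : ℝ) : ℂ) *
        Complex.exp (Complex.I * ⟪x, (ω : E)⟫) =
        ((⟪e, (ω : E)⟫ ^ 2 * Real.cos (‖x‖ * ⟪v, (ω : E)⟫) : ℝ) : ℂ) +
        ((⟪e, (ω : E)⟫ ^ 2 * Real.sin ⟪x, (ω : E)⟫ : ℝ) : ℂ) * Complex.I := fun ω => by
      rw [← hxv, mul_comm Complex.I, Complex.exp_mul_I]; push_cast; ring
    simp only [e1]
    rw [integral_add (integrable_sphere (by fun_prop)) (integrable_sphere (by fun_prop)),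
      integral_mul_const, integral_complex_ofReal, integral_complex_ofReal, hodd,
          Complex.ofReal_zero,
      zero_mul, add_zero]
  rw [hreal, Complex.norm_real, Real.norm_eq_abs]
  rcases le_total 1 ‖x‖ with h | h
  · exact abs_integral_sphere_inner_sq_mul_cos_le hm hmE hv1 he h
  · refine (abs_integral_sphere_le fun ω => ?_).trans ?_
    · rw [abs_mul, abs_pow]
      exact mul_le_one₀ (pow_le_one₀ (abs_nonneg _) (abs_inner_sphere_le he ω)) (abs_nonneg _)
        (Real.abs_cos_le_one _)
    · have a1 : 1 ≤ ‖x‖ ^ (-m) := Real.one_le_rpow_of_pos_of_le_one_of_nonpos hr0 h (by linarith)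
      have a2 : 1 ≤ Real.exp |m * (m - 1)| := Real.one_le_exp (abs_nonneg _)
      have a3 : 1 ≤ (2 * m + 2) * ((1 + m) * (2 + m) * Real.exp |m * (m - 1)|) * ‖x‖ ^ (-m) := by
        refine one_le_mul_of_one_le_of_one_le (one_le_mul_of_one_le_of_one_le (by linarith)
          (one_le_mul_of_one_le_of_one_le (by nlinarith) a2)) a1
      calc σ.real univ = 1 * σ.real univ := by ring
        _ ≤ (2 * m + 2) * ((1 + m) * (2 + m) * Real.exp |m * (m - 1)|) * ‖x‖ ^ (-m) *
          σ.real univ := by gcongr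
        _ = _ := by ring

end SphereKernel

theorem lintegral_eq_lintegral_Ioi_sphere {E : Type*} [NormedAddCommGroup E]
    [InnerProductSpace ℝ E] [FiniteDimensional ℝ E] [MeasurableSpace E] [BorelSpace E]
    [Nontrivial E] {F : E → ℝ≥0∞} (hF : Measurable F) :
    ∫⁻ x, F x = ∫⁻ r in Ioi (0 : ℝ), ∫⁻ ω : sphere (0 : E) 1,
      ENNReal.ofReal (r ^ (Module.finrank ℝ E - 1)) * F (r • (ω : E))
        ∂(volume : Measure E).toSphere := by
  have hmeas : Measurable fun p : ℝ × sphere (0 : E) 1 => F (p.1 • (p.2 : E)) := by fun_prop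
  calc ∫⁻ x, F x = ∫⁻ x in ({0}ᶜ : Set E), F x := by
        rw [restrict_compl_singleton]
    _ = ∫⁻ x : ({0}ᶜ : Set E), F x ∂(volume : Measure E).comap (↑) := by
        rw [← lintegral_subtype_comap (measurableSet_singleton _).compl]
    _ = ∫⁻ p : sphere (0 : E) 1 × Ioi (0 : ℝ), F ((p.2 : ℝ) • (p.1 : E))
          ∂((volume : Measure E).toSphere.prod (.volumeIoiPow (Module.finrank ℝ E - 1))) := by
        rw [← (volume : Measure E).measurePreserving_homeomorphUnitSphereProd.lintegral_comp_emb
          (Homeomorph.measurableEmbedding _)]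
        congr 1; ext x
        congr 1
        have hx : ‖(x : E)‖ ≠ 0 := norm_ne_zero_iff.2 x.2
        simp [smul_smul, hx]
    _ = ∫⁻ r : Ioi (0 : ℝ), ∫⁻ ω : sphere (0 : E) 1, F ((r : ℝ) • (ω : E))
          ∂(volume : Measure E).toSphere ∂(.volumeIoiPow (Module.finrank ℝ E - 1)) := by
        rw [lintegral_prod_symm']
        fun_prop
    _ = _ := by
        rw [Measure.volumeIoiPow, lintegral_withDensity_eq_lintegral_mul _ (by fun_prop)]
        · rw [← lintegral_subtype_comap measurableSet_Ioi]
          congr 1; ext r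
          rw [lintegral_const_mul _ (by fun_prop)]
          rfl
        · exact Measurable.lintegral_prod_right'
            (f := fun p : Ioi (0 : ℝ) × sphere (0 : E) 1 => F ((p.1 : ℝ) • (p.2 : E))) (by fun_prop)

theorem lintegral_abs_of_sq_mem_Ioo_le {a b ρ : ℝ} (hab : a ≤ b) :
    ∫⁻ u : ℝ, (if u ^ 2 + ρ ∈ Ioo a b then ENNReal.ofReal |u| else 0) ≤ ENNReal.ofReal (b - a) := by
  set A := Real.sqrt (a - ρ)
  set B := Real.sqrt (b - ρ)
  have hA : 0 ≤ A := Real.sqrt_nonneg _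
  have hAB : A ≤ B := Real.sqrt_le_sqrt (by linarith)
  have h1 := lintegral_comp_abs_le
    (fun u => if u ^ 2 + ρ ∈ Ioo a b then ENNReal.ofReal u else 0)
  simp only [sq_abs] at h1
  refine h1.trans ?_
  have h2 : ∫⁻ u in Ioi (0 : ℝ), (if u ^ 2 + ρ ∈ Ioo a b then ENNReal.ofReal u else 0) ≤
      ∫⁻ u in Ioc A B, ENNReal.ofReal u := by
    rw [← lintegral_indicator measurableSet_Ioi, ← lintegral_indicator measurableSet_Ioc]
    refine lintegral_mono fun u => ?_
    by_cases hu : u ∈ Ioi (0 : ℝ)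
    · rw [indicator_of_mem hu]
      split_ifs with h
      · rw [indicator_of_mem]
        have hu0 : (0 : ℝ) < u := hu
        refine ⟨?_, ?_⟩
        · rw [Real.sqrt_lt' hu0]; linarith [h.1]
        · exact Real.le_sqrt_of_sq_le (by linarith [h.2])
      · exact zero_le
    · rw [indicator_of_notMem hu]; exact zero_le
  have h3 : ∫⁻ u in Ioc A B, ENNReal.ofReal u = ENNReal.ofReal ((B ^ 2 - A ^ 2) / 2) := by
    rw [← ofReal_integral_eq_lintegral_ofReal, ← intervalIntegral.integral_of_le hAB, integral_id]
    · exact (intervalIntegral.intervalIntegrable_id (μ := volume)).1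
    · filter_upwards [ae_restrict_mem measurableSet_Ioc] with u hu
      exact hA.trans hu.1.le
  refine (mul_le_mul_right (h2.trans h3.le) 2).trans ?_
  rw [← ENNReal.ofReal_ofNat, ← ENNReal.ofReal_mul (by norm_num)]
  apply ENNReal.ofReal_le_ofReal
  have hA2 : A ^ 2 = max (a - ρ) 0 := by
    rw [Real.sq_sqrt']
  have hB2 : B ^ 2 = max (b - ρ) 0 := by
    rw [Real.sq_sqrt']
  rw [hA2, hB2]
  have := max_sub_max_le_max (b - ρ) 0 (a - ρ) 0
  rw [sub_zero, max_eq_left (a := b - ρ - (a - ρ)) (by linarith)] at this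
  linarith

section Shell

variable {m : ℕ}

theorem lintegral_euclideanSpace_eq_succAbove (i : Fin (m + 1)) (F : ℝ → (Fin m → ℝ) → ℝ≥0∞)
    (hF : Measurable (Function.uncurry F)) :
    ∫⁻ y : EuclideanSpace ℝ (Fin (m + 1)), F (y i) (fun j => y (i.succAbove j)) =
      ∫⁻ z : Fin m → ℝ, ∫⁻ u : ℝ, F u z := by
  rw [lintegral_lintegral_swap (by exact (hF.comp measurable_swap).aemeasurable)]
  change _ = ∫⁻ u : ℝ, ∫⁻ z : Fin m → ℝ, Function.uncurry F (u, z)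
  rw [← lintegral_prod (Function.uncurry F) hF.aemeasurable,
    ← Measure.volume_eq_prod,
    ← (volume_preserving_piFinSuccAbove (fun _ => ℝ) i).lintegral_comp_emb
      (MeasurableEquiv.measurableEmbedding _),
    ← (PiLp.volume_preserving_ofLp (Fin (m + 1))).lintegral_comp_emb
      (MeasurableEquiv.toLp 2 (Fin (m + 1) → ℝ)).symm.measurableEmbedding]
  rfl

theorem lintegral_shell_le (i : Fin (m + 1)) {h : (Fin m → ℝ) → ℝ≥0∞} (hh : Measurable h) {b : ℝ}
    (hb : 1 ≤ b) :
    ∫⁻ y : EuclideanSpace ℝ (Fin (m + 1)), (if ‖y‖ ^ 2 ∈ Ioo 1 (b ^ 2) then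
      ENNReal.ofReal |y i| * h (fun j => y (i.succAbove j)) else 0) ≤
      ENNReal.ofReal (b ^ 2 - 1) * ∫⁻ z, h z := by
  have e := lintegral_euclideanSpace_eq_succAbove i
    (fun u z => if u ^ 2 + ∑ j, z j ^ 2 ∈ Ioo 1 (b ^ 2) then ENNReal.ofReal |u| * h z else 0) (by
      refine Measurable.ite ?_ (by fun_prop) measurable_const
      exact measurableSet_Ioo.preimage (by fun_prop : Measurable fun p : ℝ × (Fin m → ℝ) =>
        p.1 ^ 2 + ∑ j, p.2 j ^ 2))
  have hn : ∀ y : EuclideanSpace ℝ (Fin (m + 1)), ‖y‖ ^ 2 =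
      y i ^ 2 + ∑ j, y (i.succAbove j) ^ 2 := fun y => by
    rw [EuclideanSpace.norm_sq_eq, Fin.sum_univ_succAbove _ i]
    simp
  simp only [hn, e]
  rw [← lintegral_const_mul _ hh]
  refine lintegral_mono fun z => ?_
  calc ∫⁻ u : ℝ, (if u ^ 2 + ∑ j, z j ^ 2 ∈ Ioo 1 (b ^ 2) then ENNReal.ofReal |u| * h z else 0)
      = ∫⁻ u : ℝ, (if u ^ 2 + ∑ j, z j ^ 2 ∈ Ioo 1 (b ^ 2) then ENNReal.ofReal |u| else 0) *
          h z := by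
        congr 1; ext u; split_ifs <;> simp
    _ = (∫⁻ u : ℝ, (if u ^ 2 + ∑ j, z j ^ 2 ∈ Ioo 1 (b ^ 2) then ENNReal.ofReal |u| else 0)) *
          h z := by
        refine lintegral_mul_const _ (Measurable.ite ?_ (by fun_prop) measurable_const)
        exact measurableSet_Ioo.preimage (by fun_prop : Measurable fun u : ℝ =>
          u ^ 2 + ∑ j, z j ^ 2)
    _ ≤ _ := by
        gcongr
        exact lintegral_abs_of_sq_mem_Ioo_le (by nlinarith)

/-- The projection of `|ω i| dσ(ω)` to the hyperplane `ω i = 0` has bounded density. -/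
theorem lintegral_sphere_abs_mul_le (i : Fin (m + 1)) {h : (Fin m → ℝ) → ℝ} (hh : Continuous h)
    (h0 : ∀ z, 0 ≤ h z) :
    ENNReal.ofReal (∫ ω : sphere (0 : EuclideanSpace ℝ (Fin (m + 1))) 1,
        |(ω : EuclideanSpace ℝ (Fin (m + 1))) i| *
          h (fun j => (ω : EuclideanSpace ℝ (Fin (m + 1))) (i.succAbove j))
        ∂(volume : Measure (EuclideanSpace ℝ (Fin (m + 1)))).toSphere) ≤
      3 * ∫⁻ z, ENNReal.ofReal (h z) := by
  set σ := (volume : Measure (EuclideanSpace ℝ (Fin (m + 1)))).toSphere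
  set G : ℝ → sphere (0 : EuclideanSpace ℝ (Fin (m + 1))) 1 → ℝ := fun r ω =>
    r ^ m * (|r * (ω : EuclideanSpace ℝ (Fin (m + 1))) i| *
      h (fun j => r * (ω : EuclideanSpace ℝ (Fin (m + 1))) (i.succAbove j))) with hG
  have hGc : Continuous (Function.uncurry G) := by
    simp only [hG, Function.uncurry_def]
    fun_prop
  set Ψ : ℝ → ℝ := fun r => ∫ ω, G r ω ∂σ with hΨ
  have hΨc : Continuous Ψ := by
    have := continuous_parametric_integral_of_continuous (μ := σ) hGc isCompact_univ
    simpa using this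
  have hΨ1 : ∫ ω : sphere (0 : EuclideanSpace ℝ (Fin (m + 1))) 1,
      |(ω : EuclideanSpace ℝ (Fin (m + 1))) i| *
      h (fun j => (ω : EuclideanSpace ℝ (Fin (m + 1))) (i.succAbove j)) ∂σ = Ψ 1 := by
    simp [hΨ, hG]
  rw [hΨ1]
  set J := ∫⁻ z, ENNReal.ofReal (h z)
  have hshell : ∀ b, 1 ≤ b → ∫⁻ r in Ioo 1 b, ENNReal.ofReal (Ψ r) ≤
      ENNReal.ofReal (b ^ 2 - 1) * J := by
    intro b hb
    refine le_trans (le_of_eq ?_) (lintegral_shell_le i (h := fun z => ENNReal.ofReal (h z))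
      (by fun_prop) hb)
    rw [lintegral_eq_lintegral_Ioi_sphere, ← lintegral_indicator measurableSet_Ioo,
      ← lintegral_indicator measurableSet_Ioi]
    · congr 1; ext r
      by_cases hr : r ∈ Ioi (0 : ℝ)
      · have hr0 : (0 : ℝ) < r := hr
        have hnorm : ∀ ω : sphere (0 : EuclideanSpace ℝ (Fin (m + 1))) 1,
            ‖r • (ω : EuclideanSpace ℝ (Fin (m + 1)))‖ = r := fun ω => by
          rw [norm_smul]; simp [abs_of_pos hr0]
        have hiff : r ^ 2 ∈ Ioo 1 (b ^ 2) ↔ r ∈ Ioo 1 b := by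
          simp only [mem_Ioo]
          rw [sq_lt_sq₀ hr0.le (by linarith), one_lt_sq_iff₀ hr0.le]
        rw [indicator_of_mem hr]
        simp only [hnorm, hiff]
        by_cases hrb : r ∈ Ioo 1 b
        · rw [indicator_of_mem hrb, hΨ]
          simp only [hrb, if_true]
          rw [ofReal_integral_eq_lintegral_ofReal (integrable_sphere (by fun_prop))]
          · congr 1; ext ω
            simp only [hG]
            rw [ENNReal.ofReal_mul (by positivity), ENNReal.ofReal_mul (by positivity)]
            simp
          · exact .of_forall fun ω => mul_nonneg (by positivity) (mul_nonneg (abs_nonneg _) (h0 _))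
        · rw [indicator_of_notMem hrb]
          simp [hrb]
      · rw [indicator_of_notMem hr, indicator_of_notMem]
        intro h1; exact hr (lt_trans zero_lt_one h1.1)
    · refine Measurable.ite (measurableSet_Ioo.preimage (by fun_prop))
        (by fun_prop) measurable_const
  refine le_of_forall_lt_imp_le_of_dense fun c hc => ?_
  have hev : ∀ᶠ r in nhds (1 : ℝ), c < ENNReal.ofReal (Ψ r) :=
    (ENNReal.continuous_ofReal.comp hΨc).continuousAt.eventually (lt_mem_nhds hc)
  obtain ⟨ε, hε, hball⟩ := Metric.eventually_nhds_iff.1 hev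
  set δ := min ε 1
  have hδ : 0 < δ := lt_min hε one_pos
  have hδ1 : δ ≤ 1 := min_le_right _ _
  have h1 : ENNReal.ofReal δ * c ≤ ENNReal.ofReal δ * (3 * J) := by
    calc ENNReal.ofReal δ * c = ∫⁻ r in Ioo 1 (1 + δ), c := by
          rw [setLIntegral_const, Real.volume_Ioo, mul_comm, add_sub_cancel_left]
      _ ≤ ∫⁻ r in Ioo 1 (1 + δ), ENNReal.ofReal (Ψ r) := by
          refine setLIntegral_mono' measurableSet_Ioo fun r hr => (hball ?_).le
          rw [Real.dist_eq, abs_of_pos (by linarith [hr.1])]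
          linarith [hr.2, min_le_left ε 1]
      _ ≤ ENNReal.ofReal ((1 + δ) ^ 2 - 1) * J := hshell _ (by linarith)
      _ ≤ ENNReal.ofReal (δ * 3) * J := by
          gcongr
          nlinarith
      _ = _ := by
          rw [ENNReal.ofReal_mul hδ.le, mul_assoc]; norm_num
  exact (ENNReal.mul_le_mul_iff_right (by simpa using hδ) ENNReal.ofReal_ne_top).1 h1

end Shell

theorem ennreal_two_mul_le_add_sq (a b : ℝ≥0∞) : 2 * a * b ≤ a ^ 2 + b ^ 2 := by
  rcases eq_or_ne a ∞ with rfl | ha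
  · simp
  rcases eq_or_ne b ∞ with rfl | hb
  · simp
  lift a to NNReal using ha
  lift b to NNReal using hb
  exact_mod_cast two_mul_le_add_sq a b

section Bessel

variable {m : ℕ} {H : Type*} [NormedAddCommGroup H] [InnerProductSpace ℂ H]

/-- The (inverse, unnormalised) Fourier transform of a vector valued function on `ℝᵐ`. -/
noncomputable def oscTransform (f : (Fin m → ℝ) → H) (ξ : Fin m → ℝ) : H :=
  ∫ w, Complex.exp (Complex.I * (∑ j, ξ j * w j : ℝ)) • f w

theorem norm_cexp_I_mul_ofReal (x : ℝ) : ‖Complex.exp (Complex.I * x)‖ = 1 := by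
  rw [mul_comm]; exact Complex.norm_exp_ofReal_mul_I x

theorem continuous_oscTransform {f : (Fin m → ℝ) → H} (hf : Integrable f) :
    Continuous (oscTransform f) := by
  refine continuous_of_dominated (bound := fun w => ‖f w‖) ?_ ?_ hf.norm ?_
  · intro ξ
    exact (Continuous.aestronglyMeasurable (by fun_prop)).smul hf.aestronglyMeasurable
  · intro ξ
    exact .of_forall fun w => by rw [norm_smul, norm_cexp_I_mul_ofReal, one_mul]
  · exact .of_forall fun w => by fun_prop

theorem norm_oscTransform_le (f : (Fin m → ℝ) → H) (ξ : Fin m → ℝ) :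
    ‖oscTransform f ξ‖ ≤ ∫ w, ‖f w‖ := by
  refine (norm_integral_le_integral_norm _).trans (le_of_eq ?_)
  congr 1; ext w; rw [norm_smul, norm_cexp_I_mul_ofReal, one_mul]

theorem integral_gaussian_mul_cexp {ε : ℝ} (hε : 0 < ε) (x : Fin m → ℝ) :
    ∫ ξ : Fin m → ℝ, (Real.exp (-ε * ∑ j, ξ j ^ 2) : ℂ) * Complex.exp
        (Complex.I * (∑ j, ξ j * x j : ℝ)) =
      (((Real.pi / ε) ^ ((m : ℝ) / 2) * Real.exp (-(∑ j, x j ^ 2) / (4 * ε)) : ℝ) : ℂ) := by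
  have h := GaussianFourier.integral_cexp_neg_mul_sum_add (ι := Fin m) (b := ε) (by simpa using hε)
    (fun j => Complex.I * x j)
  convert h using 1
  · congr 1; ext ξ
    rw [Complex.ofReal_exp, ← Complex.exp_add]
    congr 1
    push_cast
    congr 1
    rw [Finset.mul_sum]
    refine Finset.sum_congr rfl fun j _ => by ring
  · rw [Complex.ofReal_mul, Complex.ofReal_exp, Complex.ofReal_cpow (by positivity)]
    simp only [Fintype.card_fin]
    push_cast
    congr 2
    rw [← Finset.sum_neg_distrib]
    congr 1
    refine Finset.sum_congr rfl fun j _ => ?_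
    rw [mul_pow, Complex.I_sq]; ring

theorem integral_gaussian_sum_sq {ε : ℝ} (hε : 0 < ε) :
    ∫ x : Fin m → ℝ, Real.exp (-(∑ j, x j ^ 2) / (4 * ε)) = (4 * Real.pi * ε) ^ ((m : ℝ) / 2) := by
  have h := integral_gaussian_mul_cexp (m := m) (ε := 1 / (4 * ε)) (by positivity) 0
  simp only [Pi.zero_apply, mul_zero, Finset.sum_const_zero, Complex.ofReal_zero, Complex.exp_zero,
    mul_one, ne_eq, OfNat.ofNat_ne_zero, not_false_eq_true, zero_pow, neg_zero, zero_div,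
    Real.exp_zero, integral_complex_ofReal] at h
  have h' := Complex.ofReal_injective h
  rw [show 4 * Real.pi * ε = Real.pi / (1 / (4 * ε)) by field_simp, ← h']
  congr 1; ext x; congr 1; ring

theorem integrable_gaussian_sum_sq {ε : ℝ} (hε : 0 < ε) :
    Integrable fun x : Fin m → ℝ => Real.exp (-ε * ∑ j, x j ^ 2) := by
  apply Integrable.of_integral_ne_zero
  have := integral_gaussian_sum_sq (m := m) (ε := 1 / (4 * ε)) (by positivity)
  have e : ∀ x : Fin m → ℝ, -(∑ j, x j ^ 2) / (4 * (1 / (4 * ε))) = -ε * ∑ j, x j ^ 2 := fun x => by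
    field_simp
  simp only [e] at this
  rw [this]
  positivity

/-- Young's inequality for the quadratic form of a nonnegative convolution kernel. -/
theorem lintegral_lintegral_sub_mul_le {g : (Fin m → ℝ) → ℝ≥0∞} (hg : Measurable g)
    (hge : ∀ x, g (-x) = g x) {φ : (Fin m → ℝ) → ℝ≥0∞} (hφ : Measurable φ) :
    ∫⁻ w, ∫⁻ w', g (w' - w) * (φ w * φ w') ≤ (∫⁻ x, g x) * ∫⁻ w, φ w ^ 2 := by
  have h1 : ∫⁻ w, ∫⁻ w', g (w' - w) * φ w ^ 2 = (∫⁻ x, g x) * ∫⁻ w, φ w ^ 2 := by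
    rw [← lintegral_const_mul _ (by fun_prop)]
    congr 1; ext w
    rw [lintegral_mul_const _ (by fun_prop), lintegral_sub_right_eq_self (fun x => g x)]
  have h2 : ∫⁻ w, ∫⁻ w', g (w' - w) * φ w' ^ 2 = (∫⁻ x, g x) * ∫⁻ w, φ w ^ 2 := by
    rw [lintegral_lintegral_swap (by fun_prop), ← h1]
    congr 1; ext w; congr 1; ext w'
    rw [← hge, neg_sub]
  have h3 : ∀ w w', g (w' - w) * (φ w * φ w') ≤
      2⁻¹ * (g (w' - w) * φ w ^ 2 + g (w' - w) * φ w' ^ 2) := by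
    intro w w'
    rw [← mul_add, mul_left_comm (2⁻¹ : ℝ≥0∞)]
    refine mul_le_mul' le_rfl ?_
    rw [mul_comm (2⁻¹ : ℝ≥0∞), ← div_eq_mul_inv, ENNReal.le_div_iff_mul_le (by simp) (by simp)]
    rw [mul_comm, ← mul_assoc]
    exact ennreal_two_mul_le_add_sq _ _
  calc _ ≤ ∫⁻ w, ∫⁻ w', 2⁻¹ * (g (w' - w) * φ w ^ 2 + g (w' - w) * φ w' ^ 2) := by
        exact lintegral_mono fun w => lintegral_mono fun w' => h3 w w'
    _ = 2⁻¹ * ((∫⁻ w, ∫⁻ w', g (w' - w) * φ w ^ 2) + ∫⁻ w, ∫⁻ w', g (w' - w) * φ w' ^ 2) := by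
        rw [← lintegral_add_left (by fun_prop), ← lintegral_const_mul _ (by fun_prop)]
        congr 1; ext w
        rw [← lintegral_add_left (by fun_prop), ← lintegral_const_mul _ (by fun_prop)]
    _ = _ := by
        rw [h1, h2, ← two_mul, ← mul_assoc, ENNReal.inv_mul_cancel (by simp) (by simp), one_mul]

variable [CompleteSpace H]

/-- Gaussian regularised Bessel inequality. -/
theorem integral_exp_mul_norm_sq_oscTransform_le {f : (Fin m → ℝ) → H} (hf : Integrable f)
    {ε : ℝ} (hε : 0 < ε) :
    ENNReal.ofReal (∫ ξ, Real.exp (-ε * ∑ j, ξ j ^ 2) * ‖oscTransform f ξ‖ ^ 2) ≤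
      ENNReal.ofReal ((2 * Real.pi) ^ m) * ∫⁻ w, ENNReal.ofReal (‖f w‖ ^ 2) := by
  set g : (Fin m → ℝ) → ℝ := fun x =>
    (Real.pi / ε) ^ ((m : ℝ) / 2) * Real.exp (-(∑ j, x j ^ 2) / (4 * ε)) with hg
  have hg0 : ∀ x, 0 ≤ g x := fun x => by positivity
  have hfm := hf.aestronglyMeasurable
  have hinner : Integrable (fun p : (Fin m → ℝ) × (Fin m → ℝ) => inner ℂ (f p.1) (f p.2))
      (volume.prod volume) := by
    refine (hf.norm.mul_prod hf.norm).mono' (hfm.comp_fst.inner hfm.comp_snd)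
        (.of_forall fun p => ?_)
    exact norm_inner_le_norm _ _
  have hsq : ∀ ξ, ((‖oscTransform f ξ‖ ^ 2 : ℝ) : ℂ) = ∫ p : (Fin m → ℝ) × (Fin m → ℝ),
      Complex.exp (Complex.I * (∑ j, ξ j * (p.2 - p.1) j : ℝ)) * inner ℂ (f p.1) (f p.2)
        ∂(volume.prod volume) := by
    intro ξ
    have hi : ∀ ξ : Fin m → ℝ, Integrable fun w =>
        Complex.exp (Complex.I * (∑ j, ξ j * w j : ℝ)) • f w := fun ξ =>
      hf.norm.mono' ((Continuous.aestronglyMeasurable (by fun_prop)).smul hfm)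
        (.of_forall fun w => by rw [norm_smul, norm_cexp_I_mul_ofReal, one_mul])
    have e1 : ∀ w', inner ℂ (oscTransform f ξ) (f w') =
        ∫ w, Complex.exp (-(Complex.I * (∑ j, ξ j * w j : ℝ))) * inner ℂ (f w) (f w') := by
      intro w'
      rw [← inner_conj_symm, oscTransform, ← integral_inner (hi ξ), ← integral_conj]
      congr 1; ext w
      rw [inner_conj_symm, inner_smul_left, ← Complex.exp_conj, map_mul, Complex.conj_I,
        Complex.conj_ofReal, neg_mul]
    have e2 : ((‖oscTransform f ξ‖ ^ 2 : ℝ) : ℂ) = ∫ w',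
        Complex.exp (Complex.I * (∑ j, ξ j * w' j : ℝ)) * inner ℂ (oscTransform f ξ) (f w') := by
      have := inner_self_eq_norm_sq_to_K (𝕜 := ℂ) (oscTransform f ξ)
      push_cast
      refine Eq.trans this.symm ?_
      conv_lhs => enter [3]; rw [oscTransform]
      rw [← integral_inner (hi ξ)]
      congr 1; ext w
      rw [inner_smul_right]; push_cast; rfl
    rw [e2, integral_prod_symm]
    · congr 1; ext w'
      rw [e1, ← integral_const_mul]
      congr 1; ext w
      rw [← mul_assoc, ← Complex.exp_add]
      congr 2
      simp only [Pi.sub_apply, mul_sub, Finset.sum_sub_distrib]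
      push_cast; ring
    · refine hinner.norm.mono' ((Continuous.aestronglyMeasurable (by fun_prop)).mul hinner.1)
        (.of_forall fun p => ?_)
      rw [norm_mul, norm_cexp_I_mul_ofReal, one_mul]
  have hgint := integrable_gaussian_sum_sq (m := m) hε
  have hmain : ((∫ ξ, Real.exp (-ε * ∑ j, ξ j ^ 2) * ‖oscTransform f ξ‖ ^ 2 : ℝ) : ℂ) =
      ∫ p : (Fin m → ℝ) × (Fin m → ℝ), (g (p.2 - p.1) : ℂ) * inner ℂ (f p.1) (f p.2)
        ∂(volume.prod volume) := by
    have hsw : Integrable (Function.uncurry fun (ξ : Fin m → ℝ) (p : (Fin m → ℝ) × (Fin m → ℝ)) =>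
        (Real.exp (-ε * ∑ j, ξ j ^ 2) : ℂ) * (Complex.exp
            (Complex.I * (∑ j, ξ j * (p.2 - p.1) j : ℝ)) *
          inner ℂ (f p.1) (f p.2))) (volume.prod (volume.prod volume)) := by
      refine (hgint.mul_prod hinner.norm).mono' ?_ (.of_forall fun q => ?_)
      · refine AEStronglyMeasurable.mul (Continuous.aestronglyMeasurable (by fun_prop))
          (AEStronglyMeasurable.mul (Continuous.aestronglyMeasurable (by fun_prop)) ?_)
        exact hinner.1.comp_snd
      · simp only [Function.uncurry_def]
        rw [norm_mul, norm_mul, norm_cexp_I_mul_ofReal, one_mul, Complex.norm_real,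
          Real.norm_of_nonneg (Real.exp_nonneg _)]
    rw [← integral_complex_ofReal]
    calc _ = ∫ ξ : Fin m → ℝ, ∫ p : (Fin m → ℝ) × (Fin m → ℝ),
        (Real.exp (-ε * ∑ j, ξ j ^ 2) : ℂ) * (Complex.exp
            (Complex.I * (∑ j, ξ j * (p.2 - p.1) j : ℝ)) *
          inner ℂ (f p.1) (f p.2)) ∂(volume.prod volume) := by
          congr 1; ext ξ
          rw [Complex.ofReal_mul, hsq, integral_const_mul]
      _ = _ := by
          rw [integral_integral_swap hsw]
          congr 1; ext p
          simp only [← mul_assoc]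
          rw [integral_mul_const, integral_gaussian_mul_cexp hε]
  have hnn : 0 ≤ ∫ ξ, Real.exp (-ε * ∑ j, ξ j ^ 2) * ‖oscTransform f ξ‖ ^ 2 :=
    integral_nonneg fun ξ => by positivity
  obtain ⟨φ, hφm, hφ⟩ : ∃ φ : (Fin m → ℝ) → H, StronglyMeasurable φ ∧ f =ᵐ[volume] φ :=
    ⟨_, hfm.stronglyMeasurable_mk, hfm.ae_eq_mk⟩
  have hgI : ∫⁻ x, ENNReal.ofReal (g x) = ENNReal.ofReal ((2 * Real.pi) ^ m) := by
    rw [← ofReal_integral_eq_lintegral_ofReal _ (.of_forall hg0)]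
    · simp only [hg]
      rw [integral_const_mul, integral_gaussian_sum_sq hε, ← Real.mul_rpow (by positivity)
        (by positivity), show Real.pi / ε * (4 * Real.pi * ε) = (2 * Real.pi) ^ (2 : ℝ) by
          rw [Real.rpow_two]; field_simp; ring, ← Real.rpow_mul (by positivity), mul_div_cancel₀ _
          (by norm_num), Real.rpow_natCast]
    · have := (integrable_gaussian_sum_sq (m := m) (ε := 1 / (4 * ε)) (by positivity)).const_mul
        ((Real.pi / ε) ^ ((m : ℝ) / 2))
      refine this.congr (.of_forall fun x => ?_)
      simp only [hg]
      congr 2; field_simp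
  calc ENNReal.ofReal (∫ ξ, Real.exp (-ε * ∑ j, ξ j ^ 2) * ‖oscTransform f ξ‖ ^ 2)
      = ‖∫ p : (Fin m → ℝ) × (Fin m → ℝ), (g (p.2 - p.1) : ℂ) * inner ℂ (f p.1) (f p.2)
        ∂(volume.prod volume)‖ₑ := by
        rw [← hmain, ← ofReal_norm, Complex.norm_real, Real.norm_of_nonneg hnn]
    _ ≤ ∫⁻ p : (Fin m → ℝ) × (Fin m → ℝ), ‖(g (p.2 - p.1) : ℂ) * inner ℂ (f p.1) (f p.2)‖ₑ
        ∂(volume.prod volume) := enorm_integral_le_lintegral_enorm _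
    _ ≤ ∫⁻ p : (Fin m → ℝ) × (Fin m → ℝ), ENNReal.ofReal (g (p.2 - p.1)) * (‖φ p.1‖ₑ * ‖φ p.2‖ₑ)
        ∂(volume.prod volume) := by
        refine lintegral_mono_ae ?_
        have h1 := Measure.quasiMeasurePreserving_fst (μ := (volume : Measure (Fin m → ℝ)))
          (ν := (volume : Measure (Fin m → ℝ))) |>.ae_eq_comp hφ
        have h2 := Measure.quasiMeasurePreserving_snd (μ := (volume : Measure (Fin m → ℝ)))
          (ν := (volume : Measure (Fin m → ℝ))) |>.ae_eq_comp hφ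
        filter_upwards [h1, h2] with p hp1 hp2
        simp only [Function.comp_apply] at hp1 hp2
        rw [enorm_mul, ← hp1, ← hp2, ← ofReal_norm, Complex.norm_real,
          Real.norm_of_nonneg (hg0 _)]
        gcongr
        rw [← ofReal_norm, ← ofReal_norm, ← ofReal_norm,
          ← ENNReal.ofReal_mul (norm_nonneg _)]
        exact ENNReal.ofReal_le_ofReal (norm_inner_le_norm _ _)
    _ = ∫⁻ w, ∫⁻ w', ENNReal.ofReal (g (w' - w)) * (‖φ w‖ₑ * ‖φ w'‖ₑ) := by
        rw [lintegral_prod]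
        have := hφm.enorm
        exact Measurable.aemeasurable (by fun_prop)
    _ ≤ (∫⁻ x, ENNReal.ofReal (g x)) * ∫⁻ w, ‖φ w‖ₑ ^ 2 :=
        lintegral_lintegral_sub_mul_le (g := fun x => ENNReal.ofReal (g x)) (by fun_prop)
          (fun x => by simp [hg]) hφm.enorm
    _ = _ := by
        rw [hgI]
        congr 1
        refine lintegral_congr_ae ?_
        filter_upwards [hφ] with w hw
        rw [← hw, ← ofReal_norm, ENNReal.ofReal_pow (norm_nonneg _)]

/-- Bessel's inequality for the vector valued Fourier transform. -/
theorem lintegral_norm_sq_oscTransform_le {f : (Fin m → ℝ) → H} (hf : Integrable f) :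
    ∫⁻ ξ, ENNReal.ofReal (‖oscTransform f ξ‖ ^ 2) ≤
      ENNReal.ofReal ((2 * Real.pi) ^ m) * ∫⁻ w, ENNReal.ofReal (‖f w‖ ^ 2) := by
  have hc := continuous_oscTransform hf
  have hlim : ∀ ξ, Filter.Tendsto (fun k : ℕ =>
      ENNReal.ofReal (Real.exp (-(1 / ((k : ℝ) + 1)) * ∑ j, ξ j ^ 2) * ‖oscTransform f ξ‖ ^ 2))
      Filter.atTop (nhds (ENNReal.ofReal (‖oscTransform f ξ‖ ^ 2))) := by
    intro ξ
    refine (ENNReal.continuous_ofReal.tendsto _).comp ?_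
    have h1 := (tendsto_one_div_add_atTop_nhds_zero_nat (𝕜 := ℝ)).neg.mul_const (∑ j, ξ j ^ 2)
    have h2 := ((Real.continuous_exp.tendsto _).comp h1).mul_const (‖oscTransform f ξ‖ ^ 2)
    simpa using h2
  calc _ = ∫⁻ ξ, (Filter.liminf (fun k : ℕ =>
      ENNReal.ofReal (Real.exp (-(1 / ((k : ℝ) + 1)) * ∑ j, ξ j ^ 2) * ‖oscTransform f ξ‖ ^ 2))
      Filter.atTop) := by
        congr 1; ext ξ; rw [(hlim ξ).liminf_eq]
    _ ≤ Filter.liminf (fun k : ℕ => (∫⁻ ξ,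
      ENNReal.ofReal (Real.exp (-(1 / ((k : ℝ) + 1)) * ∑ j, ξ j ^ 2) * ‖oscTransform f ξ‖ ^ 2)))
      Filter.atTop := lintegral_liminf_le fun k => by fun_prop
    _ ≤ _ := by
        refine Filter.liminf_le_of_le (by isBoundedDefault) fun b hb => ?_
        obtain ⟨k, hk⟩ := hb.exists
        refine hk.trans ?_
        have hk0 : (0 : ℝ) < 1 / ((k : ℝ) + 1) := by positivity
        rw [← ofReal_integral_eq_lintegral_ofReal]
        · exact integral_exp_mul_norm_sq_oscTransform_le hf hk0
        · refine (integrable_gaussian_sum_sq hk0).mul_bdd (c := (∫ w, ‖f w‖) ^ 2)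
            (Continuous.aestronglyMeasurable (by fun_prop)) (.of_forall fun ξ => ?_)
          rw [Real.norm_of_nonneg (by positivity)]
          gcongr
          exact norm_oscTransform_le f ξ
        · exact .of_forall fun ξ => by positivity

end Bessel

section SliceOperator

variable {m : ℕ}

/-- The Fourier transform of `(ω i)² dσ(ω)`, in coordinates adapted to the `i`-th axis. -/
noncomputable def sliceKernel (i : Fin (m + 1)) (τ : ℝ) (z : Fin m → ℝ) : ℂ :=
  ∫ ω : sphere (0 : EuclideanSpace ℝ (Fin (m + 1))) 1,
    (((ω : EuclideanSpace ℝ (Fin (m + 1))) i ^ 2 : ℝ) : ℂ) *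
      Complex.exp (Complex.I * (τ * (ω : EuclideanSpace ℝ (Fin (m + 1))) i +
        ∑ j, z j * (ω : EuclideanSpace ℝ (Fin (m + 1))) (i.succAbove j) : ℝ))
    ∂(volume : Measure (EuclideanSpace ℝ (Fin (m + 1)))).toSphere

theorem abs_coord_sphere_le (i : Fin (m + 1)) (ω : sphere (0 : EuclideanSpace ℝ (Fin (m + 1))) 1) :
    |(ω : EuclideanSpace ℝ (Fin (m + 1))) i| ≤ 1 := by
  have := PiLp.norm_apply_le (ω : EuclideanSpace ℝ (Fin (m + 1))) i
  simpa using this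

theorem continuous_sliceKernel (i : Fin (m + 1)) :
    Continuous fun p : ℝ × (Fin m → ℝ) => sliceKernel i p.1 p.2 := by
  have := continuous_parametric_integral_of_continuous
    (μ := (volume : Measure (EuclideanSpace ℝ (Fin (m + 1)))).toSphere) (s := univ)
    (f := fun (p : ℝ × (Fin m → ℝ)) (ω : sphere (0 : EuclideanSpace ℝ (Fin (m + 1))) 1) =>
    (((ω : EuclideanSpace ℝ (Fin (m + 1))) i ^ 2 : ℝ) : ℂ) *
      Complex.exp (Complex.I * (p.1 * (ω : EuclideanSpace ℝ (Fin (m + 1))) i +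
        ∑ j, p.2 j * (ω : EuclideanSpace ℝ (Fin (m + 1))) (i.succAbove j) : ℝ)))
    (by simp only [Function.uncurry_def]; fun_prop) isCompact_univ
  simpa [sliceKernel] using this

theorem norm_sliceKernel_le (i : Fin (m + 1)) (τ : ℝ) (z : Fin m → ℝ) :
    ‖sliceKernel i τ z‖ ≤ (volume : Measure (EuclideanSpace ℝ (Fin (m + 1)))).toSphere.real
        univ := by
  refine (norm_integral_le_of_norm_le_const (C := 1) (.of_forall fun ω => ?_)).trans (by simp)
  rw [norm_mul, norm_cexp_I_mul_ofReal, mul_one, Complex.norm_real, Real.norm_eq_abs, abs_pow]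
  exact pow_le_one₀ (abs_nonneg _) (abs_coord_sphere_le i ω)

variable {H : Type*} [NormedAddCommGroup H] [InnerProductSpace ℂ H]

/-- Convolution (up to reflection) with a slice of the kernel. -/
noncomputable def sliceOp (i : Fin (m + 1)) (τ : ℝ) (f : (Fin m → ℝ) → H) (z : Fin m → ℝ) : H :=
  ∫ w, sliceKernel i τ (w - z) • f w

theorem norm_sliceOp_le {i : Fin (m + 1)} {τ B : ℝ} (hB : ∀ z, ‖sliceKernel i τ z‖ ≤ B)
    {f : (Fin m → ℝ) → H} (hf : Integrable f) (z : Fin m → ℝ) :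
    ‖sliceOp i τ f z‖ ≤ B * ∫ w, ‖f w‖ := by
  rw [← integral_const_mul]
  refine norm_integral_le_of_norm_le (hf.norm.const_mul B) (.of_forall fun w => ?_)
  rw [norm_smul]
  gcongr
  exact hB _

theorem integrable_sliceKernel_smul (i : Fin (m + 1)) (τ : ℝ) {f : (Fin m → ℝ) → H}
    (hf : Integrable f) (z : Fin m → ℝ) : Integrable fun w => sliceKernel i τ (w - z) • f w := by
  have hk := continuous_sliceKernel i
  refine (hf.norm.const_mul ((volume : Measure
    (EuclideanSpace ℝ (Fin (m + 1)))).toSphere.real univ)).mono' (((hk.comp (f :=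
        fun w => (τ, w - z))
    (by fun_prop)).aestronglyMeasurable).smul hf.1) (.of_forall fun w => ?_)
  rw [norm_smul]
  exact mul_le_mul_of_nonneg_right (norm_sliceKernel_le i τ _) (norm_nonneg _)

theorem continuous_sliceOp (i : Fin (m + 1)) (τ : ℝ) {f : (Fin m → ℝ) → H} (hf : Integrable f) :
    Continuous (sliceOp i τ f) := by
  have hk := continuous_sliceKernel i
  refine continuous_of_dominated (fun z => (integrable_sliceKernel_smul i τ hf z).1)
    (fun z => .of_forall fun w => ?_) (hf.norm.const_mul
      ((volume : Measure (EuclideanSpace ℝ (Fin (m + 1)))).toSphere.real univ))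
          (.of_forall fun w => ?_)
  · rw [norm_smul]
    exact mul_le_mul_of_nonneg_right (norm_sliceKernel_le i τ _) (norm_nonneg _)
  · exact (hk.comp (f := fun z => (τ, w - z)) (by fun_prop)).smul continuous_const

theorem sliceOp_eq_integral_sphere [CompleteSpace H] (i : Fin (m + 1)) (τ : ℝ)
    {f : (Fin m → ℝ) → H} (hf : Integrable f) (z : Fin m → ℝ) :
    sliceOp i τ f z = ∫ ω : sphere (0 : EuclideanSpace ℝ (Fin (m + 1))) 1,
      ((((ω : EuclideanSpace ℝ (Fin (m + 1))) i ^ 2 : ℝ) : ℂ) *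
        Complex.exp (Complex.I * (τ * (ω : EuclideanSpace ℝ (Fin (m + 1))) i -
          ∑ j, z j * (ω : EuclideanSpace ℝ (Fin (m + 1))) (i.succAbove j) : ℝ))) •
      oscTransform f (fun j => (ω : EuclideanSpace ℝ (Fin (m + 1))) (i.succAbove j))
      ∂(volume : Measure (EuclideanSpace ℝ (Fin (m + 1)))).toSphere := by
  set σ := (volume : Measure (EuclideanSpace ℝ (Fin (m + 1)))).toSphere
  have hsw : Integrable (Function.uncurry fun (w : Fin m → ℝ)
      (ω : sphere (0 : EuclideanSpace ℝ (Fin (m + 1))) 1) =>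
      ((((ω : EuclideanSpace ℝ (Fin (m + 1))) i ^ 2 : ℝ) : ℂ) *
        Complex.exp (Complex.I * (τ * (ω : EuclideanSpace ℝ (Fin (m + 1))) i +
          ∑ j, (w - z) j * (ω : EuclideanSpace ℝ (Fin (m + 1))) (i.succAbove j) : ℝ))) • f w)
      (volume.prod σ) := by
    refine (hf.norm.comp_fst σ).mono' ?_ (.of_forall fun p => ?_)
    · exact (Continuous.aestronglyMeasurable (by simp only [Pi.sub_apply]; fun_prop)).smul
        hf.1.comp_fst
    · simp only [Function.uncurry_def]
      rw [norm_smul, norm_mul, norm_cexp_I_mul_ofReal, mul_one, Complex.norm_real,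
        Real.norm_eq_abs, abs_pow]
      exact mul_le_of_le_one_left (norm_nonneg _)
        (pow_le_one₀ (abs_nonneg _) (abs_coord_sphere_le i _))
  have h1 : sliceOp i τ f z = ∫ w, ∫ ω : sphere (0 : EuclideanSpace ℝ (Fin (m + 1))) 1,
      ((((ω : EuclideanSpace ℝ (Fin (m + 1))) i ^ 2 : ℝ) : ℂ) *
        Complex.exp (Complex.I * (τ * (ω : EuclideanSpace ℝ (Fin (m + 1))) i +
          ∑ j, (w - z) j * (ω : EuclideanSpace ℝ (Fin (m + 1))) (i.succAbove j) : ℝ))) • f w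
              ∂σ := by
    rw [sliceOp]
    congr 1; ext w
    rw [integral_smul_const, sliceKernel]
  rw [h1, integral_integral_swap hsw]
  congr 1; ext ω
  rw [oscTransform, ← integral_smul]
  congr 1; ext w
  rw [smul_smul, mul_assoc, ← Complex.exp_add]
  congr 3
  simp only [Pi.sub_apply, sub_mul, Finset.sum_sub_distrib]
  push_cast
  simp only [mul_comm]
  ring

/-- The slice operator is bounded on `L²`. -/
theorem lintegral_norm_sq_sliceOp_le [CompleteSpace H] (i : Fin (m + 1)) (τ : ℝ)
    {f : (Fin m → ℝ) → H} (hf : Integrable f) :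
    ∫⁻ z, ENNReal.ofReal (‖sliceOp i τ f z‖ ^ 2) ≤
      ENNReal.ofReal ((3 * (2 * Real.pi) ^ m) ^ 2) * ∫⁻ w, ENNReal.ofReal (‖f w‖ ^ 2) := by
  set σ := (volume : Measure (EuclideanSpace ℝ (Fin (m + 1)))).toSphere
  set A : ℝ := 3 * (2 * Real.pi) ^ m
  have hA : 0 < A := by positivity
  rcases eq_or_ne (∫⁻ w, ENNReal.ofReal (‖f w‖ ^ 2)) ∞ with hF | hF
  · rw [hF, ENNReal.mul_top]
    · exact le_top
    · simpa using by positivity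
  obtain ⟨F, hF0, hFe⟩ : ∃ F : ℝ, 0 ≤ F ∧ ∫⁻ w, ENNReal.ofReal (‖f w‖ ^ 2) = ENNReal.ofReal F :=
    ⟨_, ENNReal.toReal_nonneg, (ENNReal.ofReal_toReal hF).symm⟩
  rw [hFe, ← ENNReal.ofReal_mul (by positivity)]
  have hUc := continuous_sliceOp i τ hf
  set u := sliceOp i τ f with hu
  have hS : ∀ {h : (Fin m → ℝ) → H} {G : ℝ}, Integrable h → 0 ≤ G →
      ∫⁻ w, ENNReal.ofReal (‖h w‖ ^ 2) = ENNReal.ofReal G →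
      ∫ ω : sphere (0 : EuclideanSpace ℝ (Fin (m + 1))) 1,
          |(ω : EuclideanSpace ℝ (Fin (m + 1))) i| *
        ‖oscTransform h (fun j => (ω : EuclideanSpace ℝ (Fin (m + 1))) (i.succAbove j))‖ ^ 2 ∂σ ≤
        A * G := by
    intro h G hh hG hGe
    have hc := continuous_oscTransform hh
    have h1 := lintegral_sphere_abs_mul_le i (h := fun z => ‖oscTransform h z‖ ^ 2) (by fun_prop)
      (fun z => by positivity)
    have h2 := h1.trans (mul_le_mul' le_rfl (lintegral_norm_sq_oscTransform_le hh))
    rw [hGe, ← ENNReal.ofReal_mul (by positivity), show (3 : ℝ≥0∞) = ENNReal.ofReal 3 by norm_num,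
      ← ENNReal.ofReal_mul (by norm_num), ENNReal.ofReal_le_ofReal_iff (by positivity)] at h2
    calc _ ≤ _ := h2
      _ = A * G := by ring
  have hball : ∀ R : ℕ, ∫⁻ z in closedBall 0 R, ENNReal.ofReal (‖u z‖ ^ 2) ≤
      ENNReal.ofReal (A ^ 2 * F) := by
    intro R
    set D : Set (Fin m → ℝ) := closedBall 0 R
    have hD : MeasurableSet D := isClosed_closedBall.measurableSet
    have hDc : IsCompact D := isCompact_closedBall 0 _
    have hui : IntegrableOn u D := hUc.continuousOn.integrableOn_compact hDc
    have hui2 : IntegrableOn (fun z => ‖u z‖ ^ 2) D :=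
      (hUc.norm.pow 2).continuousOn.integrableOn_compact hDc
    set g := D.indicator u with hg
    have hgi : Integrable g := (integrable_indicator_iff hD).2 hui
    set X := ∫ z in D, ‖u z‖ ^ 2 with hX
    have hX0 : 0 ≤ X := integral_nonneg fun z => by positivity
    have hXe : ∫⁻ z in D, ENNReal.ofReal (‖u z‖ ^ 2) = ENNReal.ofReal X := by
      rw [hX, ofReal_integral_eq_lintegral_ofReal hui2 (.of_forall fun z => by positivity)]
    have hgX : ∫⁻ z, ENNReal.ofReal (‖g z‖ ^ 2) = ENNReal.ofReal X := by
      rw [← hXe, ← lintegral_indicator hD]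
      congr 1; ext z
      by_cases hz : z ∈ D <;> simp [hg, hz]
    have hfc := continuous_oscTransform hf
    have hgc := continuous_oscTransform hgi
    have hform : (X : ℂ) = ∫ ω : sphere (0 : EuclideanSpace ℝ (Fin (m + 1))) 1,
        ((((ω : EuclideanSpace ℝ (Fin (m + 1))) i ^ 2 : ℝ) : ℂ) *
        Complex.exp (Complex.I * (-(τ * (ω : EuclideanSpace ℝ (Fin (m + 1))) i) : ℝ))) *
        inner ℂ (oscTransform f (fun j => (ω : EuclideanSpace ℝ (Fin (m + 1))) (i.succAbove j)))
          (oscTransform g (fun j => (ω : EuclideanSpace ℝ (Fin (m + 1))) (i.succAbove j))) ∂σ := by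
      have hXz : (X : ℂ) = ∫ z, inner ℂ (u z) (g z) := by
        rw [hX, ← integral_indicator hD, ← integral_complex_ofReal]
        refine integral_congr_ae (.of_forall fun z => ?_)
        by_cases hz : z ∈ D
        · simp only [hg, indicator_of_mem hz, inner_self_eq_norm_sq_to_K]
          simp
        · simp [hg, indicator_of_notMem hz]
      have hz : ∀ z, inner ℂ (u z) (g z) = ∫ ω : sphere (0 : EuclideanSpace ℝ (Fin (m + 1))) 1,
          ((((ω : EuclideanSpace ℝ (Fin (m + 1))) i ^ 2 : ℝ) : ℂ) *
          Complex.exp (Complex.I * (-(τ * (ω : EuclideanSpace ℝ (Fin (m + 1))) i) +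
            ∑ j, z j * (ω : EuclideanSpace ℝ (Fin (m + 1))) (i.succAbove j) : ℝ))) *
          inner ℂ (oscTransform f (fun j => (ω : EuclideanSpace ℝ (Fin (m + 1))) (i.succAbove j)))
          (g z) ∂σ := by
        intro z
        rw [hu, sliceOp_eq_integral_sphere i τ hf z, ← inner_conj_symm, ← integral_inner
          (integrable_sphere (by fun_prop)), ← integral_conj]
        refine integral_congr_ae (.of_forall fun ω => ?_)
        simp only [inner_smul_right, map_mul, inner_conj_symm, Complex.conj_ofReal,
          ← Complex.exp_conj, Complex.conj_I]
        congr 3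
        push_cast
        ring
      have hsw : Integrable (Function.uncurry fun (z : Fin m → ℝ)
          (ω : sphere (0 : EuclideanSpace ℝ (Fin (m + 1))) 1) =>
          ((((ω : EuclideanSpace ℝ (Fin (m + 1))) i ^ 2 : ℝ) : ℂ) *
          Complex.exp (Complex.I * (-(τ * (ω : EuclideanSpace ℝ (Fin (m + 1))) i) +
            ∑ j, z j * (ω : EuclideanSpace ℝ (Fin (m + 1))) (i.succAbove j) : ℝ))) *
          inner ℂ (oscTransform f (fun j => (ω : EuclideanSpace ℝ (Fin (m + 1))) (i.succAbove j)))
          (g z)) (volume.prod σ) := by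
        refine ((hgi.norm.const_mul (∫ w, ‖f w‖)).comp_fst σ).mono' ?_ (.of_forall fun p => ?_)
        · refine (Continuous.aestronglyMeasurable (by fun_prop)).mul
            (AEStronglyMeasurable.inner (Continuous.aestronglyMeasurable ?_) hgi.1.comp_fst)
          fun_prop
        · simp only [Function.uncurry_def]
          rw [norm_mul, norm_mul, norm_cexp_I_mul_ofReal, mul_one, Complex.norm_real,
            Real.norm_eq_abs, abs_pow]
          refine (mul_le_of_le_one_left (norm_nonneg _)
            (pow_le_one₀ (abs_nonneg _) (abs_coord_sphere_le i _))).trans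
            ((norm_inner_le_norm _ _).trans ?_)
          exact mul_le_mul_of_nonneg_right (norm_oscTransform_le f _) (norm_nonneg _)
      rw [hXz]
      simp_rw [hz]
      rw [integral_integral_swap hsw]
      refine integral_congr_ae (.of_forall fun ω => ?_)
      have hgint : Integrable fun w => Complex.exp (Complex.I *
          (∑ j, (ω : EuclideanSpace ℝ (Fin (m + 1))) (i.succAbove j) * w j : ℝ)) • g w := by
        refine hgi.norm.mono' ((Continuous.aestronglyMeasurable (by fun_prop)).smul hgi.1)
          (.of_forall fun w => ?_)
        rw [norm_smul, norm_cexp_I_mul_ofReal, one_mul]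
      simp only []
      conv_rhs => rw [oscTransform.eq_def g, ← integral_inner hgint, ← integral_const_mul]
      refine integral_congr_ae (.of_forall fun z => ?_)
      simp only [inner_smul_right]
      rw [Complex.ofReal_add, mul_add, Complex.exp_add]
      simp only [mul_comm (z _)]
      ring
    have hle : X ≤ ∫ ω : sphere (0 : EuclideanSpace ℝ (Fin (m + 1))) 1,
        |(ω : EuclideanSpace ℝ (Fin (m + 1))) i| * (A / 2 *
          ‖oscTransform f (fun j => (ω : EuclideanSpace ℝ (Fin (m + 1))) (i.succAbove j))‖ ^ 2 +
          1 / (2 * A) *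
          ‖oscTransform g (fun j => (ω : EuclideanSpace ℝ (Fin (m + 1))) (i.succAbove j))‖ ^ 2)
              ∂σ := by
      have e1 : X = ‖(X : ℂ)‖ := by rw [Complex.norm_real, Real.norm_of_nonneg hX0]
      rw [e1, hform]
      refine norm_integral_le_of_norm_le (integrable_sphere (by fun_prop)) (.of_forall fun ω => ?_)
      rw [norm_mul, norm_mul, norm_cexp_I_mul_ofReal, mul_one, Complex.norm_real,
        Real.norm_eq_abs, abs_pow]
      set a := ‖oscTransform f (fun j => (ω : EuclideanSpace ℝ (Fin (m + 1))) (i.succAbove j))‖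
      set b := ‖oscTransform g (fun j => (ω : EuclideanSpace ℝ (Fin (m + 1))) (i.succAbove j))‖
      refine mul_le_mul ?_ ((norm_inner_le_norm _ _).trans ?_) (norm_nonneg _) (abs_nonneg _)
      · exact pow_le_of_le_one (abs_nonneg _) (abs_coord_sphere_le i ω) two_ne_zero
      · change a * b ≤ _
        have e : A / 2 * a ^ 2 + 1 / (2 * A) * b ^ 2 - a * b = (A * a - b) ^ 2 / (2 * A) := by
          field_simp; ring
        have : 0 ≤ (A * a - b) ^ 2 / (2 * A) := by positivity
        linarith
    have hsum : X ≤ A / 2 * (A * F) + 1 / (2 * A) * (A * X) := by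
      refine hle.trans ?_
      refine le_trans (le_of_eq ?_) (add_le_add (mul_le_mul_of_nonneg_left (hS hf hF0 hFe)
        (by positivity)) (mul_le_mul_of_nonneg_left (hS hgi hX0 hgX) (by positivity)))
      rw [← integral_const_mul, ← integral_const_mul,
        ← integral_add (integrable_sphere (by fun_prop)) (integrable_sphere (by fun_prop))]
      congr 1; ext ω; ring
    rw [hXe]
    apply ENNReal.ofReal_le_ofReal
    have : 1 / (2 * A) * (A * X) = X / 2 := by field_simp
    nlinarith
  have hmono : Monotone fun R : ℕ => closedBall (0 : Fin m → ℝ) (R : ℝ) := fun a b hab =>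
    closedBall_subset_closedBall (by exact_mod_cast hab)
  have hun : ⋃ R : ℕ, closedBall (0 : Fin m → ℝ) (R : ℝ) = univ := iUnion_closedBall_nat 0
  rw [← setLIntegral_univ, ← hun, setLIntegral_iUnion_of_directed _ hmono.directed_le]
  exact iSup_le hball

end SliceOperator

section SliceLp

variable {m : ℕ}

theorem exists_norm_sliceKernel_le_rpow (i : Fin (m + 1)) {s : ℝ} (hs : 0 ≤ s)
    (hsm : s ≤ (m : ℝ) / 2) :
    ∃ D > 0, ∀ τ : ℝ, τ ≠ 0 → ∀ z, ‖sliceKernel i τ z‖ ≤ D * |τ| ^ (-s) := by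
  set σ := (volume : Measure (EuclideanSpace ℝ (Fin (m + 1)))).toSphere
  set n : ℝ := (m : ℝ) / 2 with hn
  have hn0 : 0 ≤ n := by positivity
  set K : ℝ := (2 * n + 2) * ((1 + n) * (2 + n) * Real.exp |n * (n - 1)| * σ.real univ) with hK
  have hK0 : 0 ≤ K := by positivity
  have hσ0 : 0 ≤ σ.real univ := measureReal_nonneg
  refine ⟨K + σ.real univ + 1, by positivity, fun τ hτ z => ?_⟩
  have hτ0 : 0 < |τ| := abs_pos.2 hτ
  have hpos : 0 ≤ |τ| ^ (-s) := by positivity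
  rcases le_or_gt |τ| 1 with h1 | h1
  · calc _ ≤ σ.real univ := norm_sliceKernel_le i τ z
      _ ≤ (K + σ.real univ + 1) * 1 := by linarith
      _ ≤ _ := by
        gcongr
        exact Real.one_le_rpow_of_pos_of_le_one_of_nonpos hτ0 h1 (by linarith)
  · set x : EuclideanSpace ℝ (Fin (m + 1)) := WithLp.toLp 2 (Fin.insertNth i τ z) with hx
    have hxi : x i = τ := by simp [hx]
    have hle : |τ| ≤ ‖x‖ := by
      have := PiLp.norm_apply_le x i
      rwa [hxi, Real.norm_eq_abs] at this
    have hx0 : x ≠ 0 := by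
      rw [← norm_pos_iff]; exact hτ0.trans_le hle
    have := norm_integral_sphere_inner_sq_mul_exp_le (E := EuclideanSpace ℝ (Fin (m + 1)))
      (m := n) hn0 (by simp [hn]; ring) (e := EuclideanSpace.single i (1 : ℝ)) (by simp) hx0
    have he : sliceKernel i τ z = ∫ ω : sphere (0 : EuclideanSpace ℝ (Fin (m + 1))) 1,
        ((⟪EuclideanSpace.single i (1 : ℝ), (ω : EuclideanSpace ℝ (Fin (m + 1)))⟫ ^ 2 : ℝ) : ℂ) *
        Complex.exp (Complex.I * (⟪x, (ω : EuclideanSpace ℝ (Fin (m + 1)))⟫ : ℝ)) ∂σ := by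
      refine integral_congr_ae (.of_forall fun ω => ?_)
      simp only [PiLp.inner_apply, Fin.sum_univ_succAbove _ i]
      simp [hx, mul_comm]
    rw [he]
    refine this.trans ?_
    calc _ = K * ‖x‖ ^ (-n) := by rw [hK]
      _ ≤ K * |τ| ^ (-n) := by
        exact mul_le_mul_of_nonneg_left
          (Real.rpow_le_rpow_of_nonpos hτ0 hle (neg_nonpos.2 hn0)) hK0
      _ ≤ K * |τ| ^ (-s) := by
        gcongr
        · exact h1.le
      _ ≤ _ := by
        gcongr
        linarith

variable {H : Type*} [NormedAddCommGroup H] [InnerProductSpace ℂ H]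

theorem sliceOp_add {i : Fin (m + 1)} {τ : ℝ} {f g : (Fin m → ℝ) → H} (hf : Integrable f)
    (hg : Integrable g) : sliceOp i τ (f + g) = sliceOp i τ f + sliceOp i τ g := by
  ext z
  simp only [sliceOp, Pi.add_apply, smul_add]
  exact integral_add (integrable_sliceKernel_smul i τ hf z) (integrable_sliceKernel_smul i τ hg z)

theorem lintegral_enorm_sliceOp_rpow_le_of_kernel_le [CompleteSpace H] {p p' : ℝ}
    (hp : p.HolderConjugate p') (hp' : 2 < p') (i : Fin (m + 1)) {τ B : ℝ} (hB : 0 < B)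
    (hK : ∀ z, ‖sliceKernel i τ z‖ ≤ B) {f : (Fin m → ℝ) → H} (hf : Integrable f)
    (hfm : StronglyMeasurable f) :
    (∫⁻ z, ‖sliceOp i τ f z‖ₑ ^ p') ^ (1 / p') ≤
      ENNReal.ofReal ((p' / (p' - 2) * 2 ^ p' * ((3 * (2 * Real.pi) ^ m) ^ 2 * B ^ (p' - 2)))
        ^ (1 / p')) * (∫⁻ w, ‖f w‖ₑ ^ p) ^ (1 / p) := by
  have hp0 : 0 < p := hp.pos
  have hp'0 : 0 < p' := by linarith
  have hp2 : 0 < p' - 2 := by linarith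
  have hC : 0 < p' / (p' - 2) * 2 ^ p' * ((3 * (2 * Real.pi) ^ m) ^ 2 * B ^ (p' - 2)) := by
    positivity
  rcases eq_or_ne (∫⁻ w, ‖f w‖ₑ ^ p) ∞ with htop | htop
  · rw [htop, ENNReal.top_rpow_of_pos (by positivity), ENNReal.mul_top]
    · exact le_top
    · simpa using by positivity
  rcases eq_or_ne (∫⁻ w, ‖f w‖ₑ ^ p) 0 with hzero | hzero
  · have hae : ∀ᵐ w, f w = 0 := by
      rw [lintegral_eq_zero_iff (hfm.enorm.pow_const p)] at hzero
      filter_upwards [hzero] with w hw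
      simpa [ENNReal.rpow_eq_zero_iff, hp0, hp0.not_gt] using hw
    have : ∀ z, sliceOp i τ f z = 0 := fun z => by
      rw [sliceOp]
      refine integral_eq_zero_of_ae ?_
      filter_upwards [hae] with w hw
      simp [hw]
    simp [this, hp'0]
  obtain ⟨N, hN0, hN⟩ : ∃ N : ℝ, 0 < N ∧ ∫⁻ w, ‖f w‖ₑ ^ p = ENNReal.ofReal N :=
    ⟨_, ENNReal.toReal_pos hzero htop, (ENNReal.ofReal_toReal htop).symm⟩
  have hφm : Measurable fun w => ‖f w‖ := hfm.norm.measurable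
  have hN' : ∫⁻ w, ENNReal.ofReal (‖f w‖ ^ p) = ENNReal.ofReal N := by
    rw [← hN]
    congr 1; ext w
    rw [← ENNReal.ofReal_rpow_of_nonneg (norm_nonneg _) hp0.le, ofReal_norm]
  have key := lintegral_rpow_le_of_forall_split (μ := (volume : Measure (Fin m → ℝ)))
    (ν := (volume : Measure (Fin m → ℝ))) hp hp' hφm (fun _ => norm_nonneg _)
    (F := fun z => ‖sliceOp i τ f z‖) (continuous_sliceOp i τ hf).norm.measurable
    (fun _ => norm_nonneg _) (A := (3 * (2 * Real.pi) ^ m) ^ 2) (by positivity) hB hN0 hN' ?_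
  · have e : ∀ z, ENNReal.ofReal (‖sliceOp i τ f z‖ ^ p') = ‖sliceOp i τ f z‖ₑ ^ p' := fun z => by
      rw [← ENNReal.ofReal_rpow_of_nonneg (norm_nonneg _) hp'0.le, ofReal_norm]
    simp only [e] at key
    refine (ENNReal.rpow_le_rpow key (by positivity)).trans (le_of_eq ?_)
    rw [hN, ENNReal.ofReal_rpow_of_nonneg (by positivity) (by positivity),
      ENNReal.ofReal_rpow_of_nonneg hN0.le (by positivity), ← ENNReal.ofReal_mul (by positivity),
      ← mul_assoc (p' / (p' - 2) * 2 ^ p'),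
      Real.mul_rpow (by positivity) (by positivity), ← Real.rpow_mul hN0.le]
    congr 3
    have := hp.inv_add_inv_eq_one
    field_simp at this ⊢
    linarith
  · intro h hh
    have hS : MeasurableSet {w | h < ‖f w‖} := measurableSet_lt measurable_const hφm
    set S := {w | h < ‖f w‖} with hSdef
    have hSc : Sᶜ = {w | ‖f w‖ ≤ h} := by ext w; simp [hSdef]
    have h1 : Integrable (S.indicator f) := hf.indicator hS
    have h2 : Integrable (Sᶜ.indicator f) := hf.indicator hS.compl
    have hsum : sliceOp i τ f = sliceOp i τ (S.indicator f) + sliceOp i τ (Sᶜ.indicator f) := by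
      rw [← sliceOp_add h1 h2, indicator_self_add_compl]
    refine ⟨fun z => ENNReal.ofReal ‖sliceOp i τ (Sᶜ.indicator f) z‖,
      (continuous_sliceOp i τ h2).norm.measurable.ennreal_ofReal, fun z => ?_, ?_⟩
    · have hb := norm_sliceOp_le hK h1 z
      rw [hsum]
      refine (ENNReal.ofReal_le_ofReal (norm_add_le _ _)).trans ?_
      rw [ENNReal.ofReal_add (norm_nonneg _) (norm_nonneg _)]
      refine add_le_add ?_ le_rfl
      refine (ENNReal.ofReal_le_ofReal hb).trans (le_of_eq ?_)
      rw [ENNReal.ofReal_mul hB.le,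
        ofReal_integral_eq_lintegral_ofReal h1.norm (.of_forall fun _ => norm_nonneg _),
        ← lintegral_indicator hS]
      congr 2; ext w
      by_cases hw : w ∈ S <;> simp [hw]
    · have hb := lintegral_norm_sq_sliceOp_le i τ h2
      refine le_trans (le_of_eq ?_) (hb.trans (le_of_eq ?_))
      · congr 1; ext z
        rw [ENNReal.ofReal_pow (norm_nonneg _)]
      · rw [← hSc, ← lintegral_indicator hS.compl]
        congr 2; ext w
        by_cases hw : w ∈ S <;> simp [hw]

/-- The `L^p → L^{p'}` bound for the slices of the kernel. -/
theorem exists_lintegral_enorm_sliceOp_rpow_le {p p' : ℝ} (hp : p.HolderConjugate p')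
    (hp' : 2 < p') (hm : 4 ≤ (m : ℝ) * (p' - 2)) (i : Fin (m + 1)) :
    ∃ C > 0, ∀ (H : Type) [NormedAddCommGroup H] [InnerProductSpace ℂ H] [CompleteSpace H] (τ : ℝ),
      τ ≠ 0 → ∀ f : (Fin m → ℝ) → H, Integrable f → StronglyMeasurable f →
      (∫⁻ z, ‖sliceOp i τ f z‖ₑ ^ p') ^ (1 / p') ≤
        ENNReal.ofReal (C * |τ| ^ (-(2 / p'))) * (∫⁻ w, ‖f w‖ₑ ^ p) ^ (1 / p) := by
  have hp2 : 0 < p' - 2 := by linarith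
  have hp'0 : 0 < p' := by linarith
  obtain ⟨D, hD, hDK⟩ := exists_norm_sliceKernel_le_rpow i (s := 2 / (p' - 2)) (by positivity)
    (by rw [div_le_div_iff₀ hp2 two_pos]; linarith)
  refine ⟨(p' / (p' - 2) * 2 ^ p' * ((3 * (2 * Real.pi) ^ m) ^ 2 * D ^ (p' - 2))) ^ (1 / p'),
    by positivity, fun H _ _ _ τ hτ f hf hfm => ?_⟩
  have hτ0 : 0 < |τ| := abs_pos.2 hτ
  refine (lintegral_enorm_sliceOp_rpow_le_of_kernel_le hp hp' i
    (B := D * |τ| ^ (-(2 / (p' - 2)))) (by positivity) (hDK τ hτ) hf hfm).trans (le_of_eq ?_)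
  congr 2
  rw [Real.mul_rpow hD.le (by positivity), ← Real.rpow_mul hτ0.le,
    show -(2 / (p' - 2)) * (p' - 2) = -2 by field_simp, ← mul_assoc, ← mul_assoc,
    Real.mul_rpow (by positivity) (by positivity), ← Real.rpow_mul hτ0.le]
  congr 2
  · ring_nf
  · ring

end SliceLp

section Combine

variable {m : ℕ} {H : Type} [NormedAddCommGroup H] [InnerProductSpace ℂ H]

theorem stronglyMeasurable_sliceOp (i : Fin (m + 1)) {c : ℝ × (Fin m → ℝ) → H}
    (hc : StronglyMeasurable c) : StronglyMeasurable fun q : ℝ × ℝ × (Fin m → ℝ) =>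
      sliceOp i (q.2.1 - q.1) (fun w => c (q.2.1, w)) q.2.2 := by
  refine StronglyMeasurable.integral_prod_right
    (f := fun (q : ℝ × ℝ × (Fin m → ℝ)) w => sliceKernel i (q.2.1 - q.1) (w - q.2.2) • c (q.2.1, w))
    ?_
  have hk := continuous_sliceKernel i
  have h1 : Continuous fun q : (ℝ × ℝ × (Fin m → ℝ)) × (Fin m → ℝ) =>
      sliceKernel i (q.1.2.1 - q.1.1) (q.2 - q.1.2.2) :=
    hk.comp (f := fun q : (ℝ × ℝ × (Fin m → ℝ)) × (Fin m → ℝ) =>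
      (q.1.2.1 - q.1.1, q.2 - q.1.2.2)) (by fun_prop)
  exact h1.stronglyMeasurable.smul (hc.comp_measurable (by fun_prop))

theorem lintegral_enorm_integral_sliceOp_mul_le [CompleteSpace H] {p p' : ℝ}
    (hp : p.HolderConjugate p') (hp' : 2 < p') (i : Fin (m + 1)) {C : ℝ} (hC : 0 ≤ C)
    (hS : ∀ τ : ℝ, τ ≠ 0 → ∀ f : (Fin m → ℝ) → H, Integrable f → StronglyMeasurable f →
      (∫⁻ z, ‖sliceOp i τ f z‖ₑ ^ p') ^ (1 / p') ≤
        ENNReal.ofReal (C * |τ| ^ (-(2 / p'))) * (∫⁻ w, ‖f w‖ₑ ^ p) ^ (1 / p))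
    {c : ℝ × (Fin m → ℝ) → H} (hc : StronglyMeasurable c) (hci : Integrable c)
    {g : ℝ × (Fin m → ℝ) → ℝ≥0∞} (hg : Measurable g) :
    ∫⁻ t, ‖∫ s, sliceKernel i (s.1 - t.1) (s.2 - t.2) • c s‖ₑ * g t ≤
      ENNReal.ofReal C * ENNReal.ofReal (4 / (1 - 2 / p') + 4) *
        ((∫⁻ s, ‖c s‖ₑ ^ p) ^ (1 / p) * (∫⁻ t, g t ^ p) ^ (1 / p)) := by
  have hp0 := hp.pos
  have hk := continuous_sliceKernel i
  have hKm := (stronglyMeasurable_sliceOp i hc).enorm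
  set N : ℝ → ℝ≥0∞ := fun s => (∫⁻ w, ‖c (s, w)‖ₑ ^ p) ^ (1 / p) with hN
  set G : ℝ → ℝ≥0∞ := fun a => (∫⁻ b, g (a, b) ^ p) ^ (1 / p) with hG
  have hcm := hc.enorm
  have hNm : Measurable N := by
    have : Measurable fun q : ℝ × (Fin m → ℝ) => ‖c q‖ₑ ^ p := hcm.pow_const p
    exact this.lintegral_prod_right'.pow_const _
  have hGm : Measurable G := by
    have : Measurable fun q : ℝ × (Fin m → ℝ) => g q ^ p := hg.pow_const p
    exact this.lintegral_prod_right'.pow_const _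
  have hN' : ∫⁻ s, N s ^ p = ∫⁻ s, ‖c s‖ₑ ^ p := by
    rw [Measure.volume_eq_prod, lintegral_prod _ (hcm.pow_const p).aemeasurable]
    congr 1; ext s
    rw [hN, ← ENNReal.rpow_mul, one_div_mul_cancel hp0.ne', ENNReal.rpow_one]
  have hG' : ∫⁻ s, G s ^ p = ∫⁻ s, g s ^ p := by
    rw [Measure.volume_eq_prod, lintegral_prod _ (hg.pow_const p).aemeasurable]
    congr 1; ext s
    rw [hG, ← ENNReal.rpow_mul, one_div_mul_cancel hp0.ne', ENNReal.rpow_one]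
  have hinteg : ∀ t : ℝ × (Fin m → ℝ),
      Integrable fun s => sliceKernel i (s.1 - t.1) (s.2 - t.2) • c s := by
    intro t
    refine (hci.norm.const_mul ((volume : Measure
      (EuclideanSpace ℝ (Fin (m + 1)))).toSphere.real univ)).mono' (((hk.comp
      (f := fun s : ℝ × (Fin m → ℝ) => (s.1 - t.1, s.2 - t.2))
      (by fun_prop)).aestronglyMeasurable).smul hci.1) (.of_forall fun w => ?_)
    rw [norm_smul]
    exact mul_le_mul_of_nonneg_right (norm_sliceKernel_le i _ _) (norm_nonneg _)
  have hpt : ∀ t : ℝ × (Fin m → ℝ), ‖∫ s, sliceKernel i (s.1 - t.1) (s.2 - t.2) • c s‖ₑ ≤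
      ∫⁻ s, ‖sliceOp i (s - t.1) (fun w => c (s, w)) t.2‖ₑ := by
    intro t
    have e : ∫ s, sliceKernel i (s.1 - t.1) (s.2 - t.2) • c s =
        ∫ s, sliceOp i (s - t.1) (fun w => c (s, w)) t.2 := by
      have h := hinteg t
      rw [Measure.volume_eq_prod] at h ⊢
      rw [integral_prod _ h]
      rfl
    rw [e]
    exact enorm_integral_le_lintegral_enorm _
  have hcae : ∀ᵐ s : ℝ, Integrable fun w => c (s, w) := by
    rw [Measure.volume_eq_prod] at hci
    exact hci.prod_right_ae
  calc _ ≤ ∫⁻ t, (∫⁻ s, ‖sliceOp i (s - t.1) (fun w => c (s, w)) t.2‖ₑ) * g t :=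
        lintegral_mono fun t => mul_le_mul' (hpt t) le_rfl
    _ = ∫⁻ a, ∫⁻ b, ∫⁻ s, ‖sliceOp i (s - a) (fun w => c (s, w)) b‖ₑ * g (a, b) := by
        rw [Measure.volume_eq_prod, lintegral_prod]
        · refine lintegral_congr fun a => lintegral_congr fun b => ?_
          rw [lintegral_mul_const]
          exact (hKm.comp (by fun_prop : Measurable fun s : ℝ => (a, s, b)) :)
        · refine (Measurable.mul ?_ hg).aemeasurable
          have : Measurable fun q : (ℝ × (Fin m → ℝ)) × ℝ =>
              ‖sliceOp i (q.2 - q.1.1) (fun w => c (q.2, w)) q.1.2‖ₑ :=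
            (hKm.comp (by fun_prop : Measurable fun q : (ℝ × (Fin m → ℝ)) × ℝ =>
              (q.1.1, q.2, q.1.2)) :)
          exact this.lintegral_prod_right'
    _ = ∫⁻ a, ∫⁻ s, ∫⁻ b, ‖sliceOp i (s - a) (fun w => c (s, w)) b‖ₑ * g (a, b) := by
        refine lintegral_congr fun a => ?_
        rw [lintegral_lintegral_swap]
        refine Measurable.aemeasurable ?_
        refine Measurable.mul ?_ (hg.comp (by fun_prop))
        exact (hKm.comp (by fun_prop : Measurable fun q : (Fin m → ℝ) × ℝ => (a, q.2, q.1)) :)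
    _ ≤ ∫⁻ a, ∫⁻ s, ENNReal.ofReal C * (G a * N s * ENNReal.ofReal (|a - s| ^ (-(2 / p')))) := by
        refine lintegral_mono fun a => lintegral_mono_ae ?_
        have hne : ∀ᵐ s : ℝ, s ≠ a := by
          rw [ae_iff]; simp
        filter_upwards [hcae, hne] with s hs hsa
        have h1 := ENNReal.lintegral_mul_le_Lp_mul_Lq (volume : Measure (Fin m → ℝ)) hp.symm
          (f := fun b => ‖sliceOp i (s - a) (fun w => c (s, w)) b‖ₑ) (g := fun b => g (a, b))
          (hKm.comp (by fun_prop : Measurable fun b : Fin m → ℝ => (a, s, b)) :).aemeasurable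
          (hg.comp (by fun_prop)).aemeasurable
        refine h1.trans ?_
        have h2 := hS (s - a) (sub_ne_zero.2 hsa) (fun w => c (s, w)) hs
          (hc.comp_measurable (by fun_prop))
        refine (mul_le_mul' h2 le_rfl).trans (le_of_eq ?_)
        rw [ENNReal.ofReal_mul hC, abs_sub_comm]
        simp only [hN, hG]
        ring
    _ = ENNReal.ofReal C *
        ∫⁻ a, ∫⁻ s, (G a * N s * ENNReal.ofReal (|a - s| ^ (-(2 / p')))) := by
        rw [← lintegral_const_mul' _ _ ENNReal.ofReal_ne_top]
        refine lintegral_congr fun a => ?_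
        rw [lintegral_const_mul' _ _ ENNReal.ofReal_ne_top]
    _ ≤ _ := by
        refine (mul_le_mul' le_rfl (lintegral_lintegral_riesz_le hp hp' hGm hNm)).trans
          (le_of_eq ?_)
        rw [hN', hG']
        ring

theorem lintegral_enorm_integral_sliceKernel_mul_le [CompleteSpace H] {p p' : ℝ}
    (hp : p.HolderConjugate p') (hp' : 2 < p') (i : Fin (m + 1)) {C : ℝ} (hC : 0 ≤ C)
    (hS : ∀ τ : ℝ, τ ≠ 0 → ∀ f : (Fin m → ℝ) → H, Integrable f → StronglyMeasurable f →
      (∫⁻ z, ‖sliceOp i τ f z‖ₑ ^ p') ^ (1 / p') ≤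
        ENNReal.ofReal (C * |τ| ^ (-(2 / p'))) * (∫⁻ w, ‖f w‖ₑ ^ p) ^ (1 / p))
    {c : (Fin (m + 1) → ℝ) → H} (hc : StronglyMeasurable c) (hci : Integrable c)
    {g : (Fin (m + 1) → ℝ) → ℝ≥0∞} (hg : Measurable g) :
    ∫⁻ t, ‖∫ s, sliceKernel i (s i - t i) (fun j => s (i.succAbove j) - t (i.succAbove j)) •
        c s‖ₑ * g t ≤
      ENNReal.ofReal C * ENNReal.ofReal (4 / (1 - 2 / p') + 4) *
        ((∫⁻ s, ‖c s‖ₑ ^ p) ^ (1 / p) * (∫⁻ t, g t ^ p) ^ (1 / p)) := by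
  set e := (MeasurableEquiv.piFinSuccAbove (fun _ : Fin (m + 1) => ℝ) i).symm with he
  have hmp : MeasurePreserving e := (volume_preserving_piFinSuccAbove (fun _ => ℝ) i).symm
  have key := lintegral_enorm_integral_sliceOp_mul_le hp hp' i hC hS (c := c ∘ e) (g := g ∘ e)
    (hc.comp_measurable e.measurable) ((hmp.integrable_comp_emb e.measurableEmbedding).2 hci)
    (hg.comp e.measurable)
  simp only [Function.comp_apply] at key
  rw [hmp.lintegral_comp_emb e.measurableEmbedding (fun s => ‖c s‖ₑ ^ p),
    hmp.lintegral_comp_emb e.measurableEmbedding (fun s => g s ^ p)] at key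
  rw [← hmp.lintegral_comp_emb e.measurableEmbedding]
  refine le_trans (le_of_eq ?_) key
  refine lintegral_congr fun t => ?_
  congr 2
  rw [← hmp.integral_comp e.measurableEmbedding]
  refine integral_congr_ae (.of_forall fun s => ?_)
  simp only [he, MeasurableEquiv.piFinSuccAbove_symm_apply, Fin.insertNthEquiv_apply]
  congr 2
  · simp
  · ext j; simp

end Combine

section SteinTomas

/-- The Fourier transform of the surface measure of the unit sphere. -/
noncomputable def sphereKernel (n : ℕ) (x : Fin n → ℝ) : ℂ :=
  ∫ ω : sphere (0 : EuclideanSpace ℝ (Fin n)) 1,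
    Complex.exp (Complex.I * (∑ j, x j * (ω : EuclideanSpace ℝ (Fin n)) j : ℝ))
    ∂(volume : Measure (EuclideanSpace ℝ (Fin n))).toSphere

theorem norm_sphereKernel_le (n : ℕ) (x : Fin n → ℝ) :
    ‖sphereKernel n x‖ ≤ (volume : Measure (EuclideanSpace ℝ (Fin n))).toSphere.real univ := by
  refine (norm_integral_le_of_norm_le_const (C := 1) (.of_forall fun ω => ?_)).trans (by simp)
  rw [norm_cexp_I_mul_ofReal]

theorem continuous_sphereKernel (n : ℕ) : Continuous (sphereKernel n) := by
  have := continuous_parametric_integral_of_continuous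
    (μ := (volume : Measure (EuclideanSpace ℝ (Fin n))).toSphere) (s := univ)
    (f := fun (x : Fin n → ℝ) (ω : sphere (0 : EuclideanSpace ℝ (Fin n)) 1) =>
      Complex.exp (Complex.I * (∑ j, x j * (ω : EuclideanSpace ℝ (Fin n)) j : ℝ)))
    (by simp only [Function.uncurry_def]; fun_prop) isCompact_univ
  simp only [Measure.restrict_univ] at this
  exact this

theorem sphereKernel_eq_sum_sliceKernel {m : ℕ} (x : Fin (m + 1) → ℝ) :
    sphereKernel (m + 1) x = ∑ i, sliceKernel i (x i) (fun j => x (i.succAbove j)) := by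
  simp only [sliceKernel, sphereKernel]
  rw [← integral_finsetSum _ fun i _ => integrable_sphere (by fun_prop)]
  refine integral_congr_ae (.of_forall fun ω => ?_)
  have h1 : ∑ i, ((ω : EuclideanSpace ℝ (Fin (m + 1))) i) ^ 2 = 1 := by
    have := ω.2
    rw [mem_sphere_zero_iff_norm] at this
    rw [← EuclideanSpace.real_norm_sq_eq, this, one_pow]
  simp only [← Fin.sum_univ_succAbove (fun j => x j * (ω : EuclideanSpace ℝ (Fin (m + 1))) j)]
  rw [← Finset.sum_mul, ← Complex.ofReal_sum, h1, Complex.ofReal_one, one_mul]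

/-- Convolution (up to reflection) with the dilated kernel. -/
noncomputable def sphereConv {n : ℕ} {H : Type*} [NormedAddCommGroup H] [NormedSpace ℂ H] (a : ℝ)
    (c : (Fin n → ℝ) → H) (t : Fin n → ℝ) : H :=
  ∫ s, sphereKernel n (a • (s - t)) • c s

variable {n : ℕ} {H : Type} [NormedAddCommGroup H] [InnerProductSpace ℂ H]

theorem integrable_sphereKernel_smul (a : ℝ) {c : (Fin n → ℝ) → H} (hc : Integrable c)
    (t : Fin n → ℝ) : Integrable fun s => sphereKernel n (a • (s - t)) • c s := by
  refine (hc.norm.const_mul ((volume : Measure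
      (EuclideanSpace ℝ (Fin n))).toSphere.real univ)).mono' ((((continuous_sphereKernel n).comp
      (by fun_prop)).aestronglyMeasurable).smul hc.1) (.of_forall fun w => ?_)
  rw [norm_smul]
  exact mul_le_mul_of_nonneg_right (norm_sphereKernel_le n _) (norm_nonneg _)

theorem continuous_sphereConv (a : ℝ) {c : (Fin n → ℝ) → H} (hc : Integrable c) :
    Continuous (sphereConv a c) := by
  refine continuous_of_dominated (fun t => (integrable_sphereKernel_smul a hc t).1)
    (fun z => .of_forall fun w => ?_) (hc.norm.const_mul ((volume : Measure
      (EuclideanSpace ℝ (Fin n))).toSphere.real univ)) (.of_forall fun w => ?_)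
  · rw [norm_smul]
    exact mul_le_mul_of_nonneg_right (norm_sphereKernel_le n _) (norm_nonneg _)
  · exact ((continuous_sphereKernel n).comp (by fun_prop)).smul continuous_const

theorem exists_lintegral_enorm_sphereConv_one_rpow_le {m : ℕ} {p p' : ℝ}
    (hp : p.HolderConjugate p') (hp' : 2 < p') (hm : 4 ≤ (m : ℝ) * (p' - 2)) :
    ∃ C > 0, ∀ (H : Type) [NormedAddCommGroup H] [InnerProductSpace ℂ H] [CompleteSpace H]
      (c : (Fin (m + 1) → ℝ) → H), Integrable c → StronglyMeasurable c →
      (∫⁻ t, ‖sphereConv 1 c t‖ₑ ^ p') ^ (1 / p') ≤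
        ENNReal.ofReal C * (∫⁻ s, ‖c s‖ₑ ^ p) ^ (1 / p) := by
  choose C hC0 hC using fun i => exists_lintegral_enorm_sliceOp_rpow_le hp hp' hm i
  have hK : 0 < 4 / (1 - 2 / p') + 4 := by
    have : 0 < 1 - 2 / p' := by
      rw [sub_pos, div_lt_one (by linarith)]; exact hp'
    positivity
  refine ⟨∑ i, C i * (4 / (1 - 2 / p') + 4), Finset.sum_pos (fun i _ => mul_pos (hC0 i) hK)
    Finset.univ_nonempty, fun H _ _ _ c hci hc => ?_⟩
  have hcont := continuous_sphereConv 1 hci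
  refine lintegral_rpow_le_of_forall_dual (S := fun t => ‖sphereConv 1 c t‖ₑ)
    hcont.enorm.measurable hp.symm _ fun g hg _ => ?_
  have hTm : ∀ i, Continuous fun t : Fin (m + 1) → ℝ => ∫ s : Fin (m + 1) → ℝ, sliceKernel i
      (s i - t i)
      (fun j => s (i.succAbove j) - t (i.succAbove j)) • c s := by
    intro i
    have hk := continuous_sliceKernel i
    refine continuous_of_dominated (fun t => ?_)
      (fun z => .of_forall fun w => ?_) (hci.norm.const_mul ((volume : Measure
      (EuclideanSpace ℝ (Fin (m + 1)))).toSphere.real univ)) (.of_forall fun s => ?_)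
    · exact ((hk.comp (f := fun s : Fin (m + 1) → ℝ => (s i - t i,
        fun j => s (i.succAbove j) - t (i.succAbove j))) (by fun_prop)).aestronglyMeasurable).smul
        hci.1
    · rw [norm_smul]
      exact mul_le_mul_of_nonneg_right (norm_sliceKernel_le i _ _) (norm_nonneg _)
    · exact (hk.comp (f := fun t : Fin (m + 1) → ℝ => (s i - t i,
        fun j => s (i.succAbove j) - t (i.succAbove j))) (by fun_prop)).smul continuous_const
  have hsum : ∀ t : Fin (m + 1) → ℝ, ‖sphereConv 1 c t‖ₑ ≤
      ∑ i, ‖∫ s : Fin (m + 1) → ℝ, sliceKernel i (s i - t i)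
      (fun j => s (i.succAbove j) - t (i.succAbove j)) • c s‖ₑ := by
    intro t
    have : sphereConv 1 c t = ∑ i, ∫ s : Fin (m + 1) → ℝ, sliceKernel i (s i - t i)
        (fun j => s (i.succAbove j) - t (i.succAbove j)) • c s := by
      rw [sphereConv, ← integral_finsetSum]
      · refine integral_congr_ae (.of_forall fun s => ?_)
        simp only [one_smul, sphereKernel_eq_sum_sliceKernel, Finset.sum_smul, Pi.sub_apply]
      · intro i _
        have hk := continuous_sliceKernel i
        refine (hci.norm.const_mul ((volume : Measure
          (EuclideanSpace ℝ (Fin (m + 1)))).toSphere.real univ)).mono' (((hk.comp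
          (f := fun s : Fin (m + 1) → ℝ => (s i - t i,
            fun j => s (i.succAbove j) - t (i.succAbove j)))
          (by fun_prop)).aestronglyMeasurable).smul hci.1) (.of_forall fun w => ?_)
        rw [norm_smul]
        exact mul_le_mul_of_nonneg_right (norm_sliceKernel_le i _ _) (norm_nonneg _)
    rw [this]
    exact enorm_sum_le _ _
  calc _ ≤ ∫⁻ t : Fin (m + 1) → ℝ, ∑ i, ‖∫ s : Fin (m + 1) → ℝ, sliceKernel i (s i - t i)
        (fun j => s (i.succAbove j) - t (i.succAbove j)) • c s‖ₑ * g t := by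
        refine lintegral_mono fun t => ?_
        rw [← Finset.sum_mul]
        exact mul_le_mul' (hsum t) le_rfl
    _ = ∑ i, ∫⁻ t : Fin (m + 1) → ℝ, ‖∫ s : Fin (m + 1) → ℝ, sliceKernel i (s i - t i)
        (fun j => s (i.succAbove j) - t (i.succAbove j)) • c s‖ₑ * g t :=
        lintegral_finsetSum _ fun i _ => (hTm i).enorm.measurable.mul hg
    _ ≤ ∑ i, ENNReal.ofReal (C i) * ENNReal.ofReal (4 / (1 - 2 / p') + 4) *
        ((∫⁻ s, ‖c s‖ₑ ^ p) ^ (1 / p) * (∫⁻ t, g t ^ p) ^ (1 / p)) :=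
        Finset.sum_le_sum fun i _ => lintegral_enorm_integral_sliceKernel_mul_le hp hp' i
          (hC0 i).le (hC i H) hc hci hg
    _ = _ := by
        rw [← Finset.sum_mul, ← mul_assoc,
          ENNReal.ofReal_sum_of_nonneg fun i _ => (mul_pos (hC0 i) hK).le]
        simp only [ENNReal.ofReal_mul (hC0 _).le]

end SteinTomas

section Scaling

theorem lintegral_comp_const_smul {n : ℕ} {a : ℝ} (ha : 0 < a) {F : (Fin n → ℝ) → ℝ≥0∞}
    (hF : Measurable F) :
    ∫⁻ t, F (a • t) = ENNReal.ofReal (a ^ (-(n : ℝ))) * ∫⁻ t, F t := by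
  rw [← lintegral_map hF (measurable_const_smul a), Measure.map_addHaar_smul _ ha.ne',
    lintegral_smul_measure, Module.finrank_fintype_fun_eq_card, Fintype.card_fin,
    abs_of_pos (by positivity), Real.rpow_neg ha.le, Real.rpow_natCast, smul_eq_mul]

theorem sphereConv_eq_smul_sphereConv_one {n : ℕ} {H : Type*} [NormedAddCommGroup H]
    [InnerProductSpace ℂ H] {a : ℝ} (ha : 0 < a) (c : (Fin n → ℝ) → H) (t : Fin n → ℝ) :
    sphereConv a c t = a ^ (-(n : ℝ)) • sphereConv 1 (fun s => c (a⁻¹ • s)) (a • t) := by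
  have h := Measure.integral_comp_smul (volume : Measure (Fin n → ℝ))
    (fun s => sphereKernel n ((1 : ℝ) • (s - a • t)) • c (a⁻¹ • s)) a
  rw [Module.finrank_fintype_fun_eq_card, Fintype.card_fin, abs_of_pos (by positivity)] at h
  rw [Real.rpow_neg ha.le, Real.rpow_natCast, sphereConv, sphereConv, ← h]
  refine integral_congr_ae (.of_forall fun s => ?_)
  simp only [one_smul, smul_sub, inv_smul_smul₀ ha.ne']

/-- The vector valued Stein–Tomas inequality for the dilated sphere. -/
theorem exists_lintegral_enorm_sphereConv_rpow_le {m : ℕ} {p p' : ℝ}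
    (hp : p.HolderConjugate p') (hp' : 2 < p') (hm : 4 ≤ (m : ℝ) * (p' - 2)) :
    ∃ C > 0, ∀ (H : Type) [NormedAddCommGroup H] [InnerProductSpace ℂ H] [CompleteSpace H]
      (a : ℝ), 0 < a → ∀ (c : (Fin (m + 1) → ℝ) → H), Integrable c → StronglyMeasurable c →
      (∫⁻ t, ‖sphereConv a c t‖ₑ ^ p') ^ (1 / p') ≤
        ENNReal.ofReal (C * a ^ (-(2 * ((m : ℝ) + 1) / p'))) *
          (∫⁻ s, ‖c s‖ₑ ^ p) ^ (1 / p) := by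
  obtain ⟨C, hC0, hC⟩ := exists_lintegral_enorm_sphereConv_one_rpow_le hp hp' hm
  refine ⟨C, hC0, fun H _ _ _ a ha c hci hc => ?_⟩
  have hp0 := hp.pos
  have hp'0 := hp.symm.pos
  set n : ℝ := ((m + 1 : ℕ) : ℝ) with hn
  have hcm : StronglyMeasurable fun s => c (a⁻¹ • s) :=
    hc.comp_measurable (measurable_const_smul _)
  have hcim : Integrable fun s => c (a⁻¹ • s) := hci.comp_smul (inv_pos.2 ha).ne'
  have h1 := hC H (fun s => c (a⁻¹ • s)) hcim hcm
  have h2 : ∫⁻ s, ‖c (a⁻¹ • s)‖ₑ ^ p = ENNReal.ofReal (a ^ n) * ∫⁻ s, ‖c s‖ₑ ^ p := by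
    rw [lintegral_comp_const_smul (inv_pos.2 ha) (F := fun s => ‖c s‖ₑ ^ p)
      (hc.enorm.pow_const p), Real.inv_rpow ha.le, Real.rpow_neg ha.le, inv_inv]
  have h3 : ∫⁻ t, ‖sphereConv a c t‖ₑ ^ p' = ENNReal.ofReal ((a ^ (-n)) ^ p') *
      (ENNReal.ofReal (a ^ (-n)) *
        ∫⁻ t, ‖sphereConv 1 (fun s => c (a⁻¹ • s)) t‖ₑ ^ p') := by
    have hcont := continuous_sphereConv 1 hcim
    rw [hn, ← lintegral_comp_const_smul ha (F := fun t =>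
      ‖sphereConv 1 (fun s => c (a⁻¹ • s)) t‖ₑ ^ p') (hcont.enorm.measurable.pow_const p'),
      ← lintegral_const_mul' _ _ ENNReal.ofReal_ne_top]
    refine lintegral_congr fun t => ?_
    rw [sphereConv_eq_smul_sphereConv_one ha, enorm_smul, ENNReal.mul_rpow_of_nonneg _ _ hp'0.le,
      Real.enorm_of_nonneg (by positivity), ENNReal.ofReal_rpow_of_nonneg (by positivity) hp'0.le]
  rw [h3]
  rw [h2, ENNReal.mul_rpow_of_nonneg _ _ (by positivity)] at h1
  rw [ENNReal.mul_rpow_of_nonneg _ _ (by positivity),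
    ENNReal.mul_rpow_of_nonneg _ _ (by positivity)]
  refine (mul_le_mul' le_rfl (mul_le_mul' le_rfl h1)).trans (le_of_eq ?_)
  simp only [← mul_assoc]
  congr 1
  rw [ENNReal.ofReal_rpow_of_nonneg (by positivity) (by positivity),
    ENNReal.ofReal_rpow_of_nonneg (by positivity) (by positivity),
    ENNReal.ofReal_rpow_of_nonneg (by positivity) (by positivity),
    ← ENNReal.ofReal_mul (by positivity), ← ENNReal.ofReal_mul (by positivity),
    ← ENNReal.ofReal_mul (by positivity)]
  congr 1
  rw [mul_right_comm, mul_comm _ C]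
  simp only [mul_assoc, ← Real.rpow_mul ha.le, ← Real.rpow_add ha]
  congr 2
  have := hp.inv_add_inv_eq_one
  have e : 1 / p = 1 - 1 / p' := by simp only [one_div]; linarith
  rw [e, hn]
  push_cast
  field_simp
  ring

end Scaling

section GaussianDecay

/-- A continuous function bounded by a Gaussian. -/
def HasGaussianDecay (f : ℝ → ℝ) : Prop :=
  Continuous f ∧ ∃ C b, 0 < b ∧ ∀ x, |f x| ≤ C * Real.exp (-b * x ^ 2)

namespace HasGaussianDecay

variable {f g : ℝ → ℝ}

theorem const_mul (hf : HasGaussianDecay f) (c : ℝ) : HasGaussianDecay fun x => c * f x := by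
  obtain ⟨hc, C, b, hb, h⟩ := hf
  refine ⟨by fun_prop, |c| * C, b, hb, fun x => ?_⟩
  rw [abs_mul, mul_assoc]
  gcongr
  exact h x

theorem add (hf : HasGaussianDecay f) (hg : HasGaussianDecay g) :
    HasGaussianDecay fun x => f x + g x := by
  obtain ⟨hc, C, b, hb, h⟩ := hf
  obtain ⟨hc', C', b', hb', h'⟩ := hg
  have hC : 0 ≤ C := by simpa using (abs_nonneg _).trans (h 0)
  have hC' : 0 ≤ C' := by simpa using (abs_nonneg _).trans (h' 0)
  refine ⟨by fun_prop, C + C', min b b', lt_min hb hb', fun x => ?_⟩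
  rw [add_mul]
  refine (abs_add_le _ _).trans (add_le_add ((h x).trans ?_) ((h' x).trans ?_))
  · have := min_le_left b b'
    gcongr
  · have := min_le_right b b'
    gcongr

theorem sub (hf : HasGaussianDecay f) (hg : HasGaussianDecay g) :
    HasGaussianDecay fun x => f x - g x := by
  simpa [sub_eq_add_neg] using hf.add (hg.const_mul (-1))

theorem mul (hf : HasGaussianDecay f) (hg : HasGaussianDecay g) :
    HasGaussianDecay fun x => f x * g x := by
  obtain ⟨hc, C, b, hb, h⟩ := hf
  obtain ⟨hc', C', b', hb', h'⟩ := hg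
  have hC : 0 ≤ C := by simpa using (abs_nonneg _).trans (h 0)
  refine ⟨by fun_prop, C * C', b + b', by positivity, fun x => ?_⟩
  rw [abs_mul, neg_add, add_mul, Real.exp_add, mul_mul_mul_comm]
  exact mul_le_mul (h x) (h' x) (abs_nonneg _) (by positivity)

theorem id_mul (hf : HasGaussianDecay f) : HasGaussianDecay fun x => x * f x := by
  obtain ⟨hc, C, b, hb, h⟩ := hf
  have hC : 0 ≤ C := by simpa using (abs_nonneg _).trans (h 0)
  refine ⟨by fun_prop, C * (1 + 2 / b), b / 2, by positivity, fun x => ?_⟩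
  have h1 : |x| ≤ (1 + 2 / b) * Real.exp (b / 2 * x ^ 2) := by
    have h2 := Real.add_one_le_exp (b / 2 * x ^ 2)
    have h3 : |x| ≤ 1 + x ^ 2 := by
      rw [← sq_abs]; nlinarith [sq_nonneg (|x| - 1), abs_nonneg x]
    have h4 : 1 + x ^ 2 ≤ (1 + 2 / b) * (b / 2 * x ^ 2 + 1) := by
      have : (1 + 2 / b) * (b / 2 * x ^ 2 + 1) = 1 + x ^ 2 + (b / 2 * x ^ 2 + 2 / b) := by
        field_simp; ring
      rw [this]
      have : 0 ≤ b / 2 * x ^ 2 + 2 / b := by positivity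
      linarith
    exact h3.trans (h4.trans (by gcongr))
  rw [abs_mul]
  calc |x| * |f x| ≤ ((1 + 2 / b) * Real.exp (b / 2 * x ^ 2)) * (C * Real.exp (-b * x ^ 2)) :=
        mul_le_mul h1 (h x) (abs_nonneg _) (by positivity)
    _ = C * (1 + 2 / b) * (Real.exp (b / 2 * x ^ 2) * Real.exp (-b * x ^ 2)) := by ring
    _ = _ := by rw [← Real.exp_add]; congr 2; ring

theorem comp_mul (hf : HasGaussianDecay f) {a : ℝ} (ha : a ≠ 0) :
    HasGaussianDecay fun x => f (a * x) := by
  obtain ⟨hc, C, b, hb, h⟩ := hf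
  refine ⟨by fun_prop, C, b * a ^ 2, by positivity, fun x => (h (a * x)).trans (le_of_eq ?_)⟩
  congr 2; ring

theorem integrable (hf : HasGaussianDecay f) : Integrable f := by
  obtain ⟨hc, C, b, hb, h⟩ := hf
  exact ((integrable_exp_neg_mul_sq hb).const_mul C).mono' hc.aestronglyMeasurable
    (.of_forall h)

theorem tendsto_cocompact (hf : HasGaussianDecay f) :
    Filter.Tendsto f (Filter.cocompact ℝ) (nhds 0) := by
  obtain ⟨hc, C, b, hb, h⟩ := hf
  refine squeeze_zero_norm h ?_
  rw [← mul_zero C]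
  refine Filter.Tendsto.const_mul C ?_
  refine Real.tendsto_exp_atBot.comp ?_
  have : Filter.Tendsto (fun x : ℝ => ‖x‖ ^ 2) (Filter.cocompact ℝ) Filter.atTop :=
    (Filter.tendsto_pow_atTop two_ne_zero).comp (tendsto_norm_cocompact_atTop (E := ℝ))
  simpa using this.const_mul_atTop_of_neg (neg_lt_zero.2 hb)

theorem sum {ι : Type*} (s : Finset ι) {f : ι → ℝ → ℝ} (hf : ∀ i ∈ s, HasGaussianDecay (f i)) :
    HasGaussianDecay fun x => ∑ i ∈ s, f i x := by
  classical
  induction s using Finset.induction_on with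
  | empty => exact ⟨by simpa using continuous_const, 0, 1, one_pos, fun x => by simp⟩
  | insert i s hi ih =>
    simp only [Finset.sum_insert hi]
    exact (hf i (by simp)).add (ih fun j hj => hf j (by simp [hj]))

/-- The integral of the derivative of `f` vanishes. -/
theorem integral_deriv_eq_zero (hf : HasGaussianDecay f) (hg : HasGaussianDecay g)
    (h : ∀ x, HasDerivAt f (g x) x) : ∫ x, g x = 0 :=
  integral_eq_zero_of_hasDerivAt_of_integrable h hg.integrable hf.integrable

end HasGaussianDecay

end GaussianDecay

section HermiteRecurrence

theorem iteratedDeriv_gaussian_hasDerivAt (k : ℕ) (x : ℝ) :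
    HasDerivAt (iteratedDeriv k fun s : ℝ => Real.exp (-s ^ 2))
      (iteratedDeriv (k + 1) (fun s : ℝ => Real.exp (-s ^ 2)) x) x := by
  rw [iteratedDeriv_succ]
  have hsm : ContDiff ℝ ⊤ fun s : ℝ => Real.exp (-s ^ 2) := by fun_prop
  exact ((hsm.differentiable_iteratedDeriv k (by exact_mod_cast WithTop.coe_lt_top _)) x).hasDerivAt

theorem iteratedDeriv_one_gaussian (x : ℝ) :
    iteratedDeriv 1 (fun s : ℝ => Real.exp (-s ^ 2)) x = -2 * x * Real.exp (-x ^ 2) := by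
  have := iteratedDeriv_gaussian_hasDerivAt 0 x
  rw [iteratedDeriv_zero] at this
  have h2 : HasDerivAt (fun s : ℝ => Real.exp (-s ^ 2)) (-2 * x * Real.exp (-x ^ 2)) x :=
    (((hasDerivAt_pow 2 x).neg).exp).congr_deriv (by simp; ring)
  exact this.unique h2

theorem iteratedDeriv_add_two_gaussian (k : ℕ) (x : ℝ) :
    iteratedDeriv (k + 2) (fun s : ℝ => Real.exp (-s ^ 2)) x =
      -2 * x * iteratedDeriv (k + 1) (fun s : ℝ => Real.exp (-s ^ 2)) x -
        2 * ((k : ℝ) + 1) * iteratedDeriv k (fun s : ℝ => Real.exp (-s ^ 2)) x := by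
  induction k generalizing x with
  | zero =>
    have h1 := iteratedDeriv_gaussian_hasDerivAt 1 x
    have h2 : HasDerivAt (iteratedDeriv 1 fun s : ℝ => Real.exp (-s ^ 2))
        (-2 * x * iteratedDeriv 1 (fun s : ℝ => Real.exp (-s ^ 2)) x - 2 * Real.exp (-x ^ 2))
            x := by
      have e : (iteratedDeriv 1 fun s : ℝ => Real.exp (-s ^ 2)) =
          fun x => -2 * x * iteratedDeriv 0 (fun s : ℝ => Real.exp (-s ^ 2)) x := by
        ext y; rw [iteratedDeriv_one_gaussian, iteratedDeriv_zero]
      have := ((hasDerivAt_id x).const_mul (-2)).fun_mul (iteratedDeriv_gaussian_hasDerivAt 0 x)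
      simp only [id] at this
      rw [← e] at this
      refine this.congr_deriv ?_
      simp only [iteratedDeriv_zero]
      ring
    rw [h1.unique h2]
    simp
  | succ k ih =>
    have h1 := iteratedDeriv_gaussian_hasDerivAt (k + 2) x
    have e : (iteratedDeriv (k + 2) fun s : ℝ => Real.exp (-s ^ 2)) =
      fun x => -2 * x * iteratedDeriv (k + 1) (fun s : ℝ => Real.exp (-s ^ 2)) x -
        2 * ((k : ℝ) + 1) * iteratedDeriv k (fun s : ℝ => Real.exp (-s ^ 2)) x := funext ih
    have h2 := ((((hasDerivAt_id x).const_mul (-2)).fun_mul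
      (iteratedDeriv_gaussian_hasDerivAt (k + 1) x)).fun_sub
      ((iteratedDeriv_gaussian_hasDerivAt k x).const_mul (2 * ((k : ℝ) + 1))))
    simp only [id] at h2
    rw [← e] at h2
    rw [h1.unique h2]
    push_cast
    ring

theorem hermiteFun_eq (k : ℕ) (x : ℝ) :
    hermiteFun k x = ((2 : ℝ) ^ k * (Nat.factorial k) * Real.sqrt Real.pi) ^ (-(1 : ℝ) / 2) *
      (-1) ^ k * (Real.exp (x ^ 2 / 2) * iteratedDeriv k (fun s : ℝ => Real.exp (-s ^ 2)) x) := by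
  have : Real.exp (x ^ 2 / 2) = Real.exp (x ^ 2) * Real.exp (-x ^ 2 / 2) := by
    rw [← Real.exp_add]; ring_nf
  rw [hermiteFun, physHermite, this]
  ring

theorem hermiteNorm_succ (k : ℕ) :
    ((2 : ℝ) ^ k * (Nat.factorial k) * Real.sqrt Real.pi) ^ (-(1 : ℝ) / 2) =
      √(2 * ((k : ℝ) + 1)) *
        ((2 : ℝ) ^ (k + 1) * (Nat.factorial (k + 1)) * Real.sqrt Real.pi) ^ (-(1 : ℝ) / 2) := by
  have e : (2 : ℝ) ^ (k + 1) * (Nat.factorial (k + 1)) * Real.sqrt Real.pi =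
      (2 * ((k : ℝ) + 1)) * ((2 : ℝ) ^ k * (Nat.factorial k) * Real.sqrt Real.pi) := by
    rw [Nat.factorial_succ]; push_cast; ring
  rw [e, Real.mul_rpow (x := 2 * ((k : ℝ) + 1)) (by positivity) (by positivity), ← mul_assoc,
    Real.sqrt_eq_rpow (2 * ((k : ℝ) + 1)), ← Real.rpow_add (by positivity)]
  norm_num

theorem hasDerivAt_hermiteFun (k : ℕ) (x : ℝ) :
    HasDerivAt (hermiteFun k)
      (x * hermiteFun k x - √(2 * ((k : ℝ) + 1)) * hermiteFun (k + 1) x) x := by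
  have h1 : HasDerivAt (fun x : ℝ => Real.exp (x ^ 2 / 2)) (x * Real.exp (x ^ 2 / 2)) x :=
    (((hasDerivAt_pow 2 x).div_const 2).exp).congr_deriv (by simp; ring)
  have h2 := (h1.fun_mul (iteratedDeriv_gaussian_hasDerivAt k x)).const_mul
    (((2 : ℝ) ^ k * (Nat.factorial k) * Real.sqrt Real.pi) ^ (-(1 : ℝ) / 2) * (-1) ^ k)
  rw [← funext (hermiteFun_eq k)] at h2
  refine h2.congr_deriv ?_
  rw [hermiteFun_eq, hermiteFun_eq (k + 1), hermiteNorm_succ]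
  ring

theorem hermiteFun_three_term (k : ℕ) (x : ℝ) :
    √(2 * ((k : ℝ) + 2)) * hermiteFun (k + 2) x =
      2 * x * hermiteFun (k + 1) x - √(2 * ((k : ℝ) + 1)) * hermiteFun k x := by
  have h1 := hermiteNorm_succ k
  have h2 := hermiteNorm_succ (k + 1)
  have hs : √(2 * ((k : ℝ) + 1)) * √(2 * ((k : ℝ) + 1)) = 2 * ((k : ℝ) + 1) :=
    Real.mul_self_sqrt (by positivity)
  push_cast at h2
  rw [add_assoc (k : ℝ), one_add_one_eq_two] at h2
  rw [hermiteFun_eq, hermiteFun_eq (k + 1), hermiteFun_eq k, h1,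
    iteratedDeriv_add_two_gaussian]
  set A := ((2 : ℝ) ^ (k + 1) * (Nat.factorial (k + 1)) * Real.sqrt Real.pi) ^ (-(1 : ℝ) / 2)
  set B := ((2 : ℝ) ^ (k + 2) * (Nat.factorial (k + 2)) * Real.sqrt Real.pi) ^ (-(1 : ℝ) / 2)
  have h2' : A = √(2 * ((k : ℝ) + 2)) * B := h2
  set g0 := iteratedDeriv k (fun s : ℝ => Real.exp (-s ^ 2)) x
  set g1 := iteratedDeriv (k + 1) (fun s : ℝ => Real.exp (-s ^ 2)) x
  set E := Real.exp (x ^ 2 / 2)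
  calc _ = (√(2 * ((k : ℝ) + 2)) * B) * (-1) ^ (k + 2) *
      (E * (-2 * x * g1 - 2 * (k + 1) * g0)) := by
        ring
    _ = A * (-1) ^ (k + 2) * (E * (-2 * x * g1 - (√(2 * ((k : ℝ) + 1)) * √(2 * ((k : ℝ) + 1))) *
        g0)) := by
        rw [← h2', hs]
    _ = _ := by ring

theorem hermiteFun_one (x : ℝ) : √2 * hermiteFun 1 x = 2 * x * hermiteFun 0 x := by
  have h1 := hermiteNorm_succ 0
  simp only [Nat.cast_zero, zero_add, mul_one] at h1
  rw [hermiteFun_eq, hermiteFun_eq 0, h1, iteratedDeriv_one_gaussian, iteratedDeriv_zero]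
  ring

theorem hasDerivAt_hermiteFun_succ (k : ℕ) (x : ℝ) :
    HasDerivAt (hermiteFun (k + 1))
      (-x * hermiteFun (k + 1) x + √(2 * ((k : ℝ) + 1)) * hermiteFun k x) x := by
  refine (hasDerivAt_hermiteFun (k + 1) x).congr_deriv ?_
  have := hermiteFun_three_term k x
  push_cast
  rw [add_assoc (k : ℝ), one_add_one_eq_two]
  linarith

theorem continuous_hermiteFun (k : ℕ) : Continuous (hermiteFun k) :=
  continuous_iff_continuousAt.2 fun x => (hasDerivAt_hermiteFun k x).continuousAt

theorem hermiteFun_zero (x : ℝ) :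
    hermiteFun 0 x = (√Real.pi) ^ (-(1 : ℝ) / 2) * Real.exp (-(1 / 2) * x ^ 2) := by
  simp only [hermiteFun, physHermite, iteratedDeriv_zero, pow_zero, Nat.factorial_zero,
    Nat.cast_one, one_mul, ← Real.exp_add]
  simp
  left
  ring_nf

theorem hasGaussianDecay_hermiteFun (k : ℕ) : HasGaussianDecay (hermiteFun k) := by
  have h0 : HasGaussianDecay (hermiteFun 0) :=
    ⟨continuous_hermiteFun 0, (√Real.pi) ^ (-(1 : ℝ) / 2), 1 / 2, by norm_num, fun x => by
      rw [hermiteFun_zero, abs_of_nonneg (by positivity)]⟩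
  have h : HasGaussianDecay (hermiteFun k) ∧ HasGaussianDecay (hermiteFun (k + 1)) := by
    induction k with
    | zero =>
      refine ⟨h0, ?_⟩
      have e : hermiteFun 1 = fun x => (√2)⁻¹ * (2 * (x * hermiteFun 0 x)) := by
        ext x
        rw [← mul_assoc 2, ← hermiteFun_one, inv_mul_cancel_left₀ (by positivity)]
      rw [zero_add, e]
      exact (h0.id_mul.const_mul 2).const_mul _
    | succ k ih =>
      refine ⟨ih.2, ?_⟩
      have e : hermiteFun (k + 2) = fun x => (√(2 * ((k : ℝ) + 2)))⁻¹ *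
          (2 * (x * hermiteFun (k + 1) x) - √(2 * ((k : ℝ) + 1)) * hermiteFun k x) := by
        ext x
        rw [← mul_assoc 2, ← hermiteFun_three_term, inv_mul_cancel_left₀ (by positivity)]
      rw [show k + 1 + 1 = k + 2 from rfl, e]
      exact ((ih.2.id_mul.const_mul 2).sub (ih.1.const_mul _)).const_mul _
  exact h.1

/-- The derivative of a Hermite function. -/
noncomputable def hermiteDeriv (k : ℕ) (x : ℝ) : ℝ :=
  x * hermiteFun k x - √(2 * ((k : ℝ) + 1)) * hermiteFun (k + 1) x

theorem hasGaussianDecay_hermiteDeriv (k : ℕ) : HasGaussianDecay (hermiteDeriv k) :=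
  (hasGaussianDecay_hermiteFun k).id_mul.sub ((hasGaussianDecay_hermiteFun (k + 1)).const_mul _)

theorem hasDerivAt_hermiteDeriv (k : ℕ) (x : ℝ) :
    HasDerivAt (hermiteDeriv k) ((x ^ 2 - (2 * (k : ℝ) + 1)) * hermiteFun k x) x := by
  have := ((hasDerivAt_id x).fun_mul (hasDerivAt_hermiteFun k x)).fun_sub
    ((hasDerivAt_hermiteFun_succ k x).const_mul (√(2 * ((k : ℝ) + 1))))
  refine this.congr_deriv ?_
  have hs : √(2 * ((k : ℝ) + 1)) * √(2 * ((k : ℝ) + 1)) = 2 * ((k : ℝ) + 1) :=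
    Real.mul_self_sqrt (by positivity)
  simp only [id]
  linear_combination (-hermiteFun k x) * hs

end HermiteRecurrence

section HermiteIntegrals

theorem hasGaussianDecay_hermiteFun_comp_mul (j : ℕ) {s : ℝ} (hs : 0 < s) :
    HasGaussianDecay fun x => hermiteFun j (s * x) :=
  (hasGaussianDecay_hermiteFun j).comp_mul hs.ne'

theorem integral_sq_mul_hermiteFun_mul (j k : ℕ) {s t : ℝ} (hs : 0 < s) (ht : 0 < t) :
    (s ^ 4 - t ^ 4) * ∫ x, x ^ 2 * (hermiteFun j (s * x) * hermiteFun k (t * x)) =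
      (s ^ 2 * (2 * j + 1) - t ^ 2 * (2 * k + 1)) *
        ∫ x, hermiteFun j (s * x) * hermiteFun k (t * x) := by
  have hu := hasGaussianDecay_hermiteFun_comp_mul j hs
  have hv := hasGaussianDecay_hermiteFun_comp_mul k ht
  have hu' := ((hasGaussianDecay_hermiteDeriv j).comp_mul hs.ne').const_mul s
  have hv' := ((hasGaussianDecay_hermiteDeriv k).comp_mul ht.ne').const_mul t
  have h2 := (hu.mul hv).id_mul.id_mul
  have hI := hu.mul hv
  have hf := (hu'.mul hv).sub (hu.mul hv')
  have hg := (h2.const_mul (s ^ 4 - t ^ 4)).sub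
    (hI.const_mul (s ^ 2 * (2 * j + 1) - t ^ 2 * (2 * k + 1)))
  have key := hf.integral_deriv_eq_zero hg fun x => by
    have dl : ∀ c : ℝ, HasDerivAt (fun x => c * x) c x := fun c => by
      simpa using (hasDerivAt_id x).const_mul c
    have du : HasDerivAt (fun x => hermiteFun j (s * x)) (s * hermiteDeriv j (s * x)) x :=
      ((hasDerivAt_hermiteFun j (s * x)).comp x (dl s)).congr_deriv (mul_comm _ _)
    have dv : HasDerivAt (fun x => hermiteFun k (t * x)) (t * hermiteDeriv k (t * x)) x :=
      ((hasDerivAt_hermiteFun k (t * x)).comp x (dl t)).congr_deriv (mul_comm _ _)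
    have du' : HasDerivAt (fun x => s * hermiteDeriv j (s * x)) _ x :=
      ((hasDerivAt_hermiteDeriv j (s * x)).comp x (dl s)).const_mul s
    have dv' : HasDerivAt (fun x => t * hermiteDeriv k (t * x)) _ x :=
      ((hasDerivAt_hermiteDeriv k (t * x)).comp x (dl t)).const_mul t
    refine ((du'.fun_mul dv).fun_sub (du.fun_mul dv')).congr_deriv ?_
    ring
  rw [integral_sub (h2.const_mul _).integrable (hI.const_mul _).integrable, integral_const_mul,
    integral_const_mul] at key
  have e : ∀ x : ℝ, x ^ 2 * (hermiteFun j (s * x) * hermiteFun k (t * x)) =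
    x * (x * (hermiteFun j (s * x) * hermiteFun k (t * x))) := fun x => by ring
  simp only [e]
  linarith

theorem integral_hermiteFun_mul_self (k : ℕ) : ∫ x, hermiteFun k x * hermiteFun k x = 1 := by
  induction k with
  | zero =>
    have e : ∀ x, hermiteFun 0 x * hermiteFun 0 x = (√Real.pi)⁻¹ * Real.exp (-1 * x ^ 2) := by
      intro x
      rw [hermiteFun_zero, mul_mul_mul_comm, ← Real.exp_add, ← Real.rpow_add (by positivity)]
      norm_num
      rw [Real.rpow_neg_one]
      congr 2
      ring
    simp only [e]
    rw [integral_const_mul, integral_gaussian, div_one]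
    exact inv_mul_cancel₀ (by positivity)
  | succ k ih =>
    have h0 := hasGaussianDecay_hermiteFun k
    have h1 := hasGaussianDecay_hermiteFun (k + 1)
    have key := (h0.mul h1).integral_deriv_eq_zero
      (((h0.mul h0).sub (h1.mul h1)).const_mul (√(2 * ((k : ℝ) + 1)))) fun x =>
        ((hasDerivAt_hermiteFun k x).fun_mul (hasDerivAt_hermiteFun_succ k x)).congr_deriv
        (by ring)
    rw [integral_const_mul, integral_sub (h0.mul h0).integrable (h1.mul h1).integrable, ih] at key
    have : √(2 * ((k : ℝ) + 1)) ≠ 0 := by positivity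
    have := (mul_eq_zero.1 key).resolve_left this
    linarith

theorem integral_hermiteFun_mul (j k : ℕ) :
    ∫ x, hermiteFun j x * hermiteFun k x = if j = k then 1 else 0 := by
  split_ifs with h
  · rw [h]; exact integral_hermiteFun_mul_self k
  · have := integral_sq_mul_hermiteFun_mul j k one_pos one_pos
    simp only [one_pow, sub_self, zero_mul, one_mul] at this
    have h2 : (2 * (j : ℝ) + 1 - (2 * k + 1)) ≠ 0 := by
      intro h3
      apply h
      have : (j : ℝ) = k := by linarith
      exact_mod_cast this
    exact (mul_eq_zero.1 this.symm).resolve_left h2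

theorem integral_hermiteDeriv_mul_add (j k : ℕ) :
    (∫ x, hermiteDeriv j x * hermiteDeriv k x) + ∫ x, x ^ 2 * (hermiteFun j x * hermiteFun k x) =
      if j = k then 2 * (k : ℝ) + 1 else 0 := by
  have hj := hasGaussianDecay_hermiteFun j
  have hk := hasGaussianDecay_hermiteFun k
  have dj := hasGaussianDecay_hermiteDeriv j
  have dk := hasGaussianDecay_hermiteDeriv k
  have e : ∀ x : ℝ, x ^ 2 * (hermiteFun j x * hermiteFun k x) =
    x * (x * (hermiteFun j x * hermiteFun k x)) := fun x => by ring
  have h2 := (hj.mul hk).id_mul.id_mul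
  have key := (hj.mul dk).integral_deriv_eq_zero
    (((dj.mul dk).add h2).sub ((hj.mul hk).const_mul (2 * (k : ℝ) + 1))) fun x =>
      ((hasDerivAt_hermiteFun j x).fun_mul (hasDerivAt_hermiteDeriv k x)).congr_deriv
      (by rw [hermiteDeriv, hermiteDeriv]; ring)
  rw [integral_sub ((dj.mul dk).add h2).integrable ((hj.mul hk).const_mul _).integrable,
    integral_add (dj.mul dk).integrable h2.integrable, integral_const_mul,
    integral_hermiteFun_mul] at key
  simp only [e]
  split_ifs with h
  · rw [if_pos h] at key; linarith
  · rw [if_neg h] at key; linarith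

theorem integral_sq_mul_hermiteFun_sq_le (k : ℕ) :
    ∫ x, x ^ 2 * (hermiteFun k x * hermiteFun k x) ≤ 2 * k + 1 := by
  have := integral_hermiteDeriv_mul_add k k
  rw [if_pos rfl] at this
  have h2 : 0 ≤ ∫ x, hermiteDeriv k x * hermiteDeriv k x :=
    integral_nonneg fun x => mul_self_nonneg _
  linarith

theorem integral_hermiteDeriv_sq_le (k : ℕ) :
    ∫ x, hermiteDeriv k x * hermiteDeriv k x ≤ 2 * k + 1 := by
  have := integral_hermiteDeriv_mul_add k k
  rw [if_pos rfl] at this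
  have h2 : 0 ≤ ∫ x, x ^ 2 * (hermiteFun k x * hermiteFun k x) :=
    integral_nonneg fun x => mul_nonneg (sq_nonneg _) (mul_self_nonneg _)
  linarith

/-- Agmon's inequality on a half line. -/
theorem HasGaussianDecay.sq_le_integral_Ioi {u v : ℝ → ℝ} (hu : HasGaussianDecay u)
    (hv : HasGaussianDecay v) (h : ∀ x, HasDerivAt u (v x) x) (x₀ : ℝ) {l : ℝ} (hl : 0 < l) :
    u x₀ ^ 2 ≤ l * (∫ x in Ioi x₀, u x * u x) + l⁻¹ * ∫ x in Ioi x₀, v x * v x := by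
  have huu := (hu.mul hu).integrable.integrableOn (s := Ioi x₀)
  have hvv := (hv.mul hv).integrable.integrableOn (s := Ioi x₀)
  have huv := ((hu.mul hv).const_mul 2).integrable.integrableOn (s := Ioi x₀)
  have hlim : Filter.Tendsto (fun x => u x * u x) Filter.atTop (nhds 0) :=
    (hu.mul hu).tendsto_cocompact.mono_left atTop_le_cocompact
  have key := integral_Ioi_of_hasDerivAt_of_tendsto (a := x₀) (f := fun x => u x * u x)
    (f' := fun x => 2 * (u x * v x)) (m := 0) (hu.mul hu).1.continuousWithinAt
    (fun x _ => ((h x).fun_mul (h x)).congr_deriv (by ring)) huv hlim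
  have : u x₀ ^ 2 = ∫ x in Ioi x₀, -(2 * (u x * v x)) := by
    rw [integral_neg, key]; ring
  rw [this, ← integral_const_mul, ← integral_const_mul,
    ← integral_add (huu.const_mul _) (hvv.const_mul _)]
  refine integral_mono huv.neg ((huu.const_mul _).add (hvv.const_mul _)) fun x => ?_
  have e : l * (u x * u x) + l⁻¹ * (v x * v x) - -(2 * (u x * v x)) =
      l⁻¹ * (l * u x + v x) ^ 2 := by
    field_simp; ring
  have : 0 ≤ l⁻¹ * (l * u x + v x) ^ 2 := by positivity
  simp only []
  linarith

theorem HasGaussianDecay.sq_le_integral {u v : ℝ → ℝ} (hu : HasGaussianDecay u)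
    (hv : HasGaussianDecay v) (h : ∀ x, HasDerivAt u (v x) x) (x₀ : ℝ) {l : ℝ} (hl : 0 < l) :
    u x₀ ^ 2 ≤ l * (∫ x, u x * u x) + l⁻¹ * ∫ x, v x * v x := by
  refine (hu.sq_le_integral_Ioi hv h x₀ hl).trans ?_
  gcongr
  · exact .of_forall fun x => mul_self_nonneg _
  · exact (hu.mul hu).integrable
  · exact Measure.restrict_le_self
  · exact .of_forall fun x => mul_self_nonneg _
  · exact (hv.mul hv).integrable
  · exact Measure.restrict_le_self

/-- Local Weyl bound for Hermite functions. -/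
theorem sum_hermiteFun_sq_le (K : ℕ) (x : ℝ) :
    ∑ n ∈ Finset.range (K + 1), hermiteFun n x ^ 2 ≤ 2 * √(2 * K + 1) := by
  set S := ∑ n ∈ Finset.range (K + 1), hermiteFun n x ^ 2 with hS
  set s := Finset.range (K + 1)
  have hS0 : 0 ≤ S := Finset.sum_nonneg fun _ _ => sq_nonneg _
  set u : ℝ → ℝ := fun y => ∑ n ∈ s, hermiteFun n x * hermiteFun n y with hu
  set v : ℝ → ℝ := fun y => ∑ n ∈ s, hermiteFun n x * hermiteDeriv n y with hv
  have hud : HasGaussianDecay u := HasGaussianDecay.sum s fun n _ =>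
    (hasGaussianDecay_hermiteFun n).const_mul _
  have hvd : HasGaussianDecay v := HasGaussianDecay.sum s fun n _ =>
    (hasGaussianDecay_hermiteDeriv n).const_mul _
  have hder : ∀ y, HasDerivAt u (v y) y := fun y =>
    HasDerivAt.fun_sum fun n _ => (hasDerivAt_hermiteFun n y).const_mul _
  have hux : u x = S := by simp only [hu, hS, sq]
  have hdouble : ∀ (g : ℕ → ℝ → ℝ), (∀ n, HasGaussianDecay (g n)) →
      ∫ y, (∑ n ∈ s, hermiteFun n x * g n y) * (∑ n ∈ s, hermiteFun n x * g n y) =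
      ∑ j ∈ s, ∑ k ∈ s, hermiteFun j x * hermiteFun k x * ∫ y, g j y * g k y := by
    intro g hg
    simp only [Finset.sum_mul_sum]
    rw [integral_finsetSum]
    · refine Finset.sum_congr rfl fun j _ => ?_
      rw [integral_finsetSum]
      · refine Finset.sum_congr rfl fun k _ => ?_
        rw [← integral_const_mul]
        congr 1; ext y; ring
      · exact fun k _ => (((hg j).const_mul _).mul ((hg k).const_mul _)).integrable
    · exact fun j _ => (HasGaussianDecay.sum s fun k _ =>
        ((hg j).const_mul _).mul ((hg k).const_mul _)).integrable
  have huu : ∫ y, u y * u y = S := by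
    rw [hdouble _ hasGaussianDecay_hermiteFun]
    simp only [integral_hermiteFun_mul, mul_ite, mul_one, mul_zero, Finset.sum_ite_eq]
    rw [hS]
    exact Finset.sum_congr rfl fun j hj => by rw [if_pos hj, sq]
  have hvv : ∫ y, v y * v y ≤ (2 * K + 1) * S := by
    have h1 := hdouble _ hasGaussianDecay_hermiteDeriv
    have h2 := hdouble (fun n y => y * hermiteFun n y) fun n =>
      (hasGaussianDecay_hermiteFun n).id_mul
    have h3 : 0 ≤ ∫ y, (∑ n ∈ s, hermiteFun n x * (y * hermiteFun n y)) *
      (∑ n ∈ s, hermiteFun n x * (y * hermiteFun n y)) :=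
      integral_nonneg fun y => mul_self_nonneg _
    have h4 : (∫ y, v y * v y) + ∫ y, (∑ n ∈ s, hermiteFun n x * (y * hermiteFun n y)) *
      (∑ n ∈ s, hermiteFun n x * (y * hermiteFun n y)) =
      ∑ j ∈ s, hermiteFun j x ^ 2 * (2 * j + 1) := by
      rw [h1, h2, ← Finset.sum_add_distrib]
      refine Finset.sum_congr rfl fun j hj => ?_
      rw [← Finset.sum_add_distrib]
      have : ∀ k, hermiteFun j x * hermiteFun k x * (∫ y, hermiteDeriv j y * hermiteDeriv k y) +
          hermiteFun j x * hermiteFun k x * ∫ y, y * hermiteFun j y * (y * hermiteFun k y) =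
          if j = k then hermiteFun j x * hermiteFun k x * (2 * (k : ℝ) + 1) else 0 := by
        intro k
        have e : ∀ y, y * hermiteFun j y * (y * hermiteFun k y) =
          y ^ 2 * (hermiteFun j y * hermiteFun k y) := fun y => by ring
        simp only [e]
        rw [← mul_add, integral_hermiteDeriv_mul_add]
        split_ifs <;> simp
      simp only [this, Finset.sum_ite_eq, if_pos hj, sq]
    calc _ ≤ ∑ j ∈ s, hermiteFun j x ^ 2 * (2 * (j : ℝ) + 1) := by linarith
      _ ≤ ∑ j ∈ s, hermiteFun j x ^ 2 * (2 * K + 1) := by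
        refine Finset.sum_le_sum fun j hj => ?_
        have : (j : ℝ) ≤ K := by
          have := Finset.mem_range_succ_iff.1 hj
          exact_mod_cast this
        gcongr
      _ = _ := by rw [← Finset.sum_mul, mul_comm]
  have hl : 0 < √(2 * (K : ℝ) + 1) := by positivity
  have key := hud.sq_le_integral hvd hder x hl
  rw [hux, huu] at key
  have h5 : (√(2 * (K : ℝ) + 1))⁻¹ * ∫ y, v y * v y ≤ √(2 * (K : ℝ) + 1) * S := by
    rw [inv_mul_le_iff₀ hl, ← mul_assoc, Real.mul_self_sqrt (by positivity)]
    exact hvv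
  rcases hS0.eq_or_lt with h0 | h0
  · rw [← h0]; positivity
  · nlinarith

end HermiteIntegrals

section HermiteEquation

variable {u v : ℝ → ℝ} {s : ℝ}

/-- Energy bound for the solutions of `u'' = (x² - s⁶) u`. -/
theorem hermite_energy_le (hs : 0 < s) (hu : HasGaussianDecay u) (hv : HasGaussianDecay v)
    (h : ∀ x, HasDerivAt u (v x) x) (h' : ∀ x, HasDerivAt v ((x ^ 2 - s ^ 6) * u x) x)
    (hu1 : ∫ x, u x * u x = 1) (hv1 : ∫ x, v x * v x ≤ s ^ 6) (x : ℝ) :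
    v x ^ 2 + (s ^ 6 - x ^ 2) * u x ^ 2 ≤ 5 / 2 * s ^ 3 := by
  have huc := hu.1
  have hvc := hv.1
  set E : ℝ → ℝ := fun x => v x ^ 2 + (s ^ 6 - x ^ 2) * u x ^ 2 with hE
  have hd : ∀ x, HasDerivAt E (-2 * x * u x ^ 2) x := fun x =>
    (((h' x).fun_pow 2).fun_add
      (((hasDerivAt_pow 2 x).const_sub (s ^ 6)).fun_mul ((h x).fun_pow 2))).congr_deriv
      (by push_cast; ring)
  have hdiff : Differentiable ℝ E := fun x => (hd x).differentiableAt
  have h0 : E x ≤ E 0 := by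
    rcases le_total 0 x with hx | hx
    · refine antitoneOn_of_deriv_nonpos (convex_Ici 0) hdiff.continuous.continuousOn
        hdiff.differentiableOn (fun y hy => ?_) self_mem_Ici hx hx
      rw [interior_Ici, mem_Ioi] at hy
      rw [(hd y).deriv]
      nlinarith [mul_nonneg hy.le (sq_nonneg (u y))]
    · refine monotoneOn_of_deriv_nonneg (convex_Iic 0) hdiff.continuous.continuousOn
        hdiff.differentiableOn (fun y hy => ?_) hx self_mem_Iic hx
      rw [interior_Iic, mem_Iio] at hy
      rw [(hd y).deriv]
      nlinarith [mul_nonneg (neg_nonneg.2 hy.le) (sq_nonneg (u y))]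
  have hL : (0 : ℝ) ≤ s ^ 3 := by positivity
  have h1 : ∫ x in (0 : ℝ)..s ^ 3, (E x + 2 * x * (s ^ 3 - x) * u x ^ 2) = s ^ 3 * E 0 := by
    rw [intervalIntegral.integral_eq_sub_of_hasDerivAt (f := fun x => (x - s ^ 3) * E x)]
    · ring
    · intro x _
      exact (((hasDerivAt_id x).sub_const (s ^ 3)).fun_mul (hd x)).congr_deriv (by simp; ring)
    · exact Continuous.intervalIntegrable (by fun_prop) _ _
  have hinteg : Integrable fun x => v x * v x + (s ^ 6 + s ^ 6 / 2) * (u x * u x) :=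
    ((hv.mul hv).add ((hu.mul hu).const_mul _)).integrable
  have h2 : ∫ x in (0 : ℝ)..s ^ 3, (E x + 2 * x * (s ^ 3 - x) * u x ^ 2) ≤ 5 / 2 * s ^ 6 := by
    rw [intervalIntegral.integral_of_le hL]
    calc _ ≤ ∫ x in Ioc 0 (s ^ 3), (v x * v x + (s ^ 6 + s ^ 6 / 2) * (u x * u x)) := by
          refine setIntegral_mono_on ?_ hinteg.integrableOn measurableSet_Ioc fun x hx => ?_
          · exact (Continuous.integrableOn_Icc (by fun_prop)).mono_set Ioc_subset_Icc_self
          · have : 2 * x * (s ^ 3 - x) ≤ s ^ 6 / 2 := by nlinarith [sq_nonneg (s ^ 3 - 2 * x)]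
            simp only [hE]
            nlinarith [mul_le_mul_of_nonneg_right this (sq_nonneg (u x)),
              mul_nonneg (sq_nonneg x) (sq_nonneg (u x))]
      _ ≤ ∫ x, (v x * v x + (s ^ 6 + s ^ 6 / 2) * (u x * u x)) :=
          setIntegral_le_integral hinteg (.of_forall fun x => by
            have := mul_self_nonneg (v x)
            have := mul_self_nonneg (u x)
            simp only [Pi.zero_apply]
            positivity)
      _ ≤ _ := by
          rw [integral_add (hv.mul hv).integrable ((hu.mul hu).const_mul _).integrable,
            integral_const_mul, hu1]
          linarith
  have h3 : s ^ 3 * E 0 ≤ s ^ 3 * (5 / 2 * s ^ 3) := by linarith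
  exact h0.trans (le_of_mul_le_mul_left h3 (by positivity))

theorem hermite_sq_le_of_critical (hs : 0 < s) (hu : HasGaussianDecay u) (hv : HasGaussianDecay v)
    (h : ∀ x, HasDerivAt u (v x) x) (h' : ∀ x, HasDerivAt v ((x ^ 2 - s ^ 6) * u x) x)
    (hu1 : ∫ x, u x * u x = 1) (hv1 : ∫ x, v x * v x ≤ s ^ 6) {x : ℝ} (hx : 0 ≤ x)
    (hvx : v x = 0) : u x ^ 2 ≤ 5 / 2 * s := by
  rcases le_total (s ^ 2) (s ^ 6 - x ^ 2) with hD | hD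
  · have := hermite_energy_le hs hu hv h h' hu1 hv1 x
    rw [hvx] at this
    have h3 : s ^ 2 * u x ^ 2 ≤ s ^ 2 * (5 / 2 * s) := by
      nlinarith [mul_le_mul_of_nonneg_right hD (sq_nonneg (u x))]
    exact le_of_mul_le_mul_left h3 (by positivity)
  · have hinteg := (hu.mul hu).integrable
    have hvint := (hv.mul hv).integrable
    have hx2 := hu.id_mul.id_mul.mul hu
    have hw : HasGaussianDecay fun y => (y ^ 2 - s ^ 6) * (u y * u y) := by
      have := hx2.sub ((hu.mul hu).const_mul (s ^ 6))
      convert this using 2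
      ring
    have h1 : ∫ y in Ioi x, (v y * v y + (y ^ 2 - s ^ 6) * (u y * u y)) = 0 := by
      rw [integral_Ioi_of_hasDerivAt_of_tendsto (f := fun y => u y * v y) (m := 0)]
      · rw [hvx]; ring
      · exact (hu.mul hv).1.continuousWithinAt
      · intro y _
        exact ((h y).fun_mul (h' y)).congr_deriv (by ring)
      · exact ((hv.mul hv).add hw).integrable.integrableOn
      · exact (hu.mul hv).tendsto_cocompact.mono_left atTop_le_cocompact
    have hIle : ∫ y in Ioi x, u y * u y ≤ 1 := by
      rw [← hu1]
      exact setIntegral_le_integral hinteg (.of_forall fun y => mul_self_nonneg _)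
    have hVle : ∫ y in Ioi x, v y * v y ≤ s ^ 2 := by
      rw [integral_add hvint.integrableOn hw.integrable.integrableOn] at h1
      have : ∫ y in Ioi x, -((y ^ 2 - s ^ 6) * (u y * u y)) ≤
          ∫ y in Ioi x, s ^ 2 * (u y * u y) := by
        refine setIntegral_mono_on hw.integrable.neg.integrableOn
          (hinteg.const_mul _).integrableOn measurableSet_Ioi fun y hy => ?_
        have hy' : x ^ 2 ≤ y ^ 2 := by
          have := mem_Ioi.1 hy
          gcongr
        nlinarith [mul_self_nonneg (u y)]
      rw [integral_neg, integral_const_mul] at this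
      nlinarith [sq_nonneg s]
    have hA := hu.sq_le_integral_Ioi hv h x hs
    have e : s⁻¹ * s ^ 2 = s := by field_simp
    have h4 : s⁻¹ * ∫ y in Ioi x, v y * v y ≤ s := by
      exact (mul_le_mul_of_nonneg_left hVle (by positivity)).trans e.le
    nlinarith [mul_le_mul_of_nonneg_left hIle hs.le]

theorem hermite_sq_le (hs : 0 < s) (hu : HasGaussianDecay u) (hv : HasGaussianDecay v)
    (h : ∀ x, HasDerivAt u (v x) x) (h' : ∀ x, HasDerivAt v ((x ^ 2 - s ^ 6) * u x) x)
    (hu1 : ∫ x, u x * u x = 1) (hv1 : ∫ x, v x * v x ≤ s ^ 6) (x : ℝ) :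
    u x ^ 2 ≤ 5 / 2 * s := by
  by_cases h0 : u x = 0
  · rw [h0, zero_pow two_ne_zero]; positivity
  have huu := (hu.mul hu).tendsto_cocompact
  obtain ⟨z, hz⟩ := (hu.mul hu).1.exists_forall_ge' x
    ((huu.eventually (gt_mem_nhds (mul_self_pos.2 h0))).mono fun y hy => hy.le)
  have hz0 : u z ≠ 0 := fun hz0 => by
    have := hz x
    rw [hz0, zero_mul] at this
    exact absurd this (not_le.2 (mul_self_pos.2 h0))
  have hvz : v z = 0 := by
    have := (IsLocalMax.hasDerivAt_eq_zero (f := fun y => u y * u y)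
      (Filter.Eventually.of_forall hz) ((h z).fun_mul (h z)))
    have : (2 * u z) * v z = 0 := by linarith
    simpa [hz0] using this
  have hxz : u x ^ 2 ≤ u z ^ 2 := by simpa only [sq] using hz x
  refine hxz.trans ?_
  rcases le_total 0 z with hz1 | hz1
  · exact hermite_sq_le_of_critical hs hu hv h h' hu1 hv1 hz1 hvz
  · have hn : (-1 : ℝ) ≠ 0 := by norm_num
    have hi : ∀ w : ℝ → ℝ, ∫ x, w (-1 * x) = ∫ x, w x := fun w => by
      simp only [neg_one_mul]; exact integral_neg_eq_self w volume
    have hneg : ∀ y : ℝ, HasDerivAt (fun y : ℝ => -1 * y) (-1) y := fun y => by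
      simpa using (hasDerivAt_id y).const_mul (-1 : ℝ)
    have := hermite_sq_le_of_critical (u := fun y => u (-1 * y)) (v := fun y => -1 * v (-1 * y))
      (x := -z) hs
      (hu.comp_mul hn) ((hv.comp_mul hn).const_mul (-1))
      (fun y => ((h (-1 * y)).comp y (hneg y)).congr_deriv (by ring))
      (fun y => (((h' (-1 * y)).comp y (hneg y)).const_mul (-1)).congr_deriv (by ring))
      (by rw [hi fun y => u y * u y, hu1])
      (by
        have e : ∀ y, -1 * v (-1 * y) * (-1 * v (-1 * y)) = (fun y => v y * v y) (-1 * y) :=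
          fun y => by ring
        simp only [e]
        rw [hi fun y => v y * v y]; exact hv1)
      (by linarith) (by simp [hvz])
    simpa using this

end HermiteEquation

theorem hermiteFun_sq_le (n : ℕ) (x : ℝ) :
    hermiteFun n x ^ 2 ≤ 5 / 2 * (2 * (n : ℝ) + 1) ^ (1 / 6 : ℝ) := by
  have hN : (0 : ℝ) < 2 * (n : ℝ) + 1 := by positivity
  have e : ((2 * (n : ℝ) + 1) ^ (1 / 6 : ℝ)) ^ 6 = 2 * (n : ℝ) + 1 := by
    rw [← Real.rpow_natCast, ← Real.rpow_mul hN.le]; norm_num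
  refine hermite_sq_le (by positivity) (hasGaussianDecay_hermiteFun n)
    (hasGaussianDecay_hermiteDeriv n) (hasDerivAt_hermiteFun n) (fun y => ?_)
    (integral_hermiteFun_mul_self n) ?_ x
  · rw [e]; exact hasDerivAt_hermiteDeriv n y
  · rw [e]; exact integral_hermiteDeriv_sq_le n

theorem setIntegral_hermiteFun_sq_le (n : ℕ) {ρ : ℝ} (hρ : 0 ≤ ρ) :
    ∫ y in Icc (-ρ) ρ, hermiteFun n y * hermiteFun n y ≤ 10 * ρ / √(2 * (n : ℝ) + 1) := by
  have hN : (0 : ℝ) < 2 * (n : ℝ) + 1 := by positivity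
  have e : ((2 * (n : ℝ) + 1) ^ (1 / 6 : ℝ)) ^ 6 = 2 * (n : ℝ) + 1 := by
    rw [← Real.rpow_natCast, ← Real.rpow_mul hN.le]; norm_num
  have e3 : ((2 * (n : ℝ) + 1) ^ (1 / 6 : ℝ)) ^ 3 = √(2 * (n : ℝ) + 1) := by
    rw [Real.sqrt_eq_rpow, ← Real.rpow_natCast, ← Real.rpow_mul hN.le]; norm_num
  have hs0 : 0 < √(2 * (n : ℝ) + 1) := by positivity
  have hss : √(2 * (n : ℝ) + 1) * √(2 * (n : ℝ) + 1) = 2 * (n : ℝ) + 1 := Real.mul_self_sqrt hN.le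
  have hinteg := ((hasGaussianDecay_hermiteFun n).mul (hasGaussianDecay_hermiteFun n)).integrable
  rcases le_total (ρ ^ 2) ((2 * (n : ℝ) + 1) / 2) with h | h
  · have h1 : ∀ y ∈ Icc (-ρ) ρ, hermiteFun n y * hermiteFun n y ≤ 5 / √(2 * (n : ℝ) + 1) := by
      intro y hy
      have hE := hermite_energy_le (s := (2 * (n : ℝ) + 1) ^ (1 / 6 : ℝ)) (by positivity)
        (hasGaussianDecay_hermiteFun n)
        (hasGaussianDecay_hermiteDeriv n) (hasDerivAt_hermiteFun n)
        (by rw [e]; exact hasDerivAt_hermiteDeriv n)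
        (integral_hermiteFun_mul_self n) (by rw [e]; exact integral_hermiteDeriv_sq_le n) y
      rw [e, e3] at hE
      have hy2 : y ^ 2 ≤ ρ ^ 2 := sq_le_sq' hy.1 hy.2
      rw [le_div_iff₀ hs0]
      have h5 : (2 * (n : ℝ) + 1) / 2 * hermiteFun n y ^ 2 ≤ 5 / 2 * √(2 * (n : ℝ) + 1) := by
        nlinarith [mul_nonneg (by linarith : 0 ≤ (2 * (n : ℝ) + 1) / 2 - y ^ 2)
          (sq_nonneg (hermiteFun n y)), sq_nonneg (hermiteDeriv n y)]
      refine le_of_mul_le_mul_right (a := √(2 * (n : ℝ) + 1)) ?_ hs0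
      rw [mul_assoc, hss]
      linarith
    calc _ ≤ ∫ y in Icc (-ρ) ρ, 5 / √(2 * (n : ℝ) + 1) :=
          setIntegral_mono_on hinteg.integrableOn (by simp) measurableSet_Icc h1
      _ = _ := by
          rw [setIntegral_const, Real.volume_real_Icc_of_le (by linarith), smul_eq_mul]
          ring
  · calc _ ≤ ∫ y, hermiteFun n y * hermiteFun n y :=
          setIntegral_le_integral hinteg (.of_forall fun y => mul_self_nonneg _)
      _ = 1 := integral_hermiteFun_mul_self n
      _ ≤ _ := by
          rw [le_div_iff₀ hs0, one_mul, Real.sqrt_le_iff]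
          constructor
          · positivity
          · nlinarith

section ProductIntegrals

variable {d : ℕ}

theorem integral_coord_mul_prod (i : Fin d) (w : ℝ → ℝ) (g : Fin d → ℝ → ℝ) :
    ∫ x : Fin d → ℝ, w (x i) * ∏ j, g j (x j) =
      (∫ y, w y * g i y) * ∏ j ∈ Finset.univ.erase i, ∫ y, g j y := by
  have e : ∀ x : Fin d → ℝ, w (x i) * ∏ j, g j (x j) =
      ∏ j, (fun y => (if j = i then w y else 1) * g j y) (x j) := fun x => by
    simp only [Finset.prod_mul_distrib, Finset.prod_ite_eq', Finset.mem_univ, if_true]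
  simp only [e]
  rw [integral_fintype_prod_volume_eq_prod
    (fun j : Fin d => fun y => (if j = i then w y else 1) * g j y),
    ← Finset.mul_prod_erase _ _ (Finset.mem_univ i)]
  congr 1
  · simp
  · refine Finset.prod_congr rfl fun j hj => ?_
    simp [Finset.ne_of_mem_erase hj]

theorem integrable_coord_mul_prod (i : Fin d) {w : ℝ → ℝ} {g : Fin d → ℝ → ℝ}
    (hw : Integrable fun y => w y * g i y) (hg : ∀ j, Integrable (g j)) :
    Integrable fun x : Fin d → ℝ => w (x i) * ∏ j, g j (x j) := by
  have e : (fun x : Fin d → ℝ => w (x i) * ∏ j, g j (x j)) = fun x =>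
      ∏ j, (fun y => (if j = i then w y else 1) * g j y) (x j) := by
    ext x
    simp only [Finset.prod_mul_distrib, Finset.prod_ite_eq', Finset.mem_univ, if_true]
  rw [e]
  refine Integrable.fintype_prod
    (f := fun j : Fin d => fun y => (if j = i then w y else 1) * g j y) fun j => ?_
  by_cases h : j = i
  · subst h; simpa using hw
  · simpa [h] using hg j

theorem integral_mul_sum_sq {X ι : Type*} [MeasurableSpace X] {m : Measure X} (s : Finset ι)
    (w : X → ℝ) (φ : ι → X → ℝ) (c : ι → ℝ)
    (hinteg : ∀ i ∈ s, ∀ j ∈ s, Integrable (fun x => w x * (φ i x * φ j x)) m)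
    (horth : ∀ i ∈ s, ∀ j ∈ s, i ≠ j → ∫ x, w x * (φ i x * φ j x) ∂m = 0) :
    ∫ x, w x * (∑ i ∈ s, c i * φ i x) ^ 2 ∂m =
      ∑ i ∈ s, c i ^ 2 * ∫ x, w x * (φ i x * φ i x) ∂m := by
  have e : ∀ x, w x * (∑ i ∈ s, c i * φ i x) ^ 2 =
      ∑ i ∈ s, ∑ j ∈ s, c i * c j * (w x * (φ i x * φ j x)) := fun x => by
    rw [sq, Finset.sum_mul_sum, Finset.mul_sum]
    refine Finset.sum_congr rfl fun i _ => ?_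
    rw [Finset.mul_sum]
    exact Finset.sum_congr rfl fun j _ => by ring
  simp only [e]
  rw [integral_finsetSum _ fun i hi => integrable_finsetSum _ fun j hj =>
    (hinteg i hi j hj).const_mul _]
  refine Finset.sum_congr rfl fun i hi => ?_
  rw [integral_finsetSum _ fun j hj => (hinteg i hi j hj).const_mul _,
      Finset.sum_eq_single_of_mem i hi]
  · rw [integral_const_mul, sq]
  · intro j hj hji
    rw [integral_const_mul, horth i hi j hj (Ne.symm hji), mul_zero]

end ProductIntegrals

section ScaledHermite

variable {d : ℕ}

theorem scaledHermite_mul {s t : ℝ} (hs : 0 < s) (ht : 0 < t) (ν η : Fin d → ℕ) (x : Fin d → ℝ) :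
    scaledHermite d (s ^ 2) ν x * scaledHermite d (t ^ 2) η x =
      (s * t) ^ ((d : ℝ) / 2) *
        ∏ j, (fun j y => hermiteFun (ν j) (s * y) * hermiteFun (η j) (t * y)) j (x j) := by
  have e : ∀ s : ℝ, 0 < s → |s ^ 2| ^ ((d : ℝ) / 4) = s ^ ((d : ℝ) / 2) := fun s hs => by
    rw [abs_of_pos (by positivity), ← Real.rpow_natCast, ← Real.rpow_mul hs.le]
    congr 1; push_cast; ring
  have e' : ∀ s : ℝ, 0 < s → √|s ^ 2| = s := fun s hs => by
    rw [abs_of_pos (by positivity), Real.sqrt_sq hs.le]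
  simp only [scaledHermite, hermiteFunMulti, e s hs, e t ht, e' s hs, e' t ht]
  rw [Real.mul_rpow hs.le ht.le, Finset.prod_mul_distrib]
  ring

theorem integrable_hermiteFun_mul_scaled (j k : ℕ) {s t : ℝ} (hs : 0 < s) (ht : 0 < t) :
    Integrable fun y => hermiteFun j (s * y) * hermiteFun k (t * y) :=
  ((hasGaussianDecay_hermiteFun_comp_mul j hs).mul
    (hasGaussianDecay_hermiteFun_comp_mul k ht)).integrable

theorem integrable_sq_mul_hermiteFun_mul_scaled (j k : ℕ) {s t : ℝ} (hs : 0 < s) (ht : 0 < t) :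
    Integrable fun y => y ^ 2 * (hermiteFun j (s * y) * hermiteFun k (t * y)) := by
  have := ((hasGaussianDecay_hermiteFun_comp_mul j hs).id_mul.mul
    (hasGaussianDecay_hermiteFun_comp_mul k ht).id_mul).integrable
  convert this using 2
  ring

theorem integral_hermiteFun_mul_scaled (j k : ℕ) {s : ℝ} (hs : 0 < s) :
    ∫ y, hermiteFun j (s * y) * hermiteFun k (s * y) = if j = k then s⁻¹ else 0 := by
  rw [Measure.integral_comp_mul_left (fun y => hermiteFun j y * hermiteFun k y),
    integral_hermiteFun_mul, abs_of_pos (inv_pos.2 hs)]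
  split_ifs <;> simp

theorem integrable_coord_mul_scaledHermite (i : Fin d) {s t : ℝ} (hs : 0 < s) (ht : 0 < t)
    (ν η : Fin d → ℕ) {w : ℝ → ℝ}
    (hw : Integrable fun y => w y * (hermiteFun (ν i) (s * y) * hermiteFun (η i) (t * y))) :
    Integrable fun x : Fin d → ℝ =>
      w (x i) * (scaledHermite d (s ^ 2) ν x * scaledHermite d (t ^ 2) η x) := by
  simp only [scaledHermite_mul hs ht, mul_left_comm (w _) ((s * t) ^ ((d : ℝ) / 2))]
  exact (integrable_coord_mul_prod i hw
    fun j => integrable_hermiteFun_mul_scaled _ _ hs ht).const_mul _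

theorem integral_coord_mul_scaledHermite (i : Fin d) {s t : ℝ} (hs : 0 < s) (ht : 0 < t)
    (ν η : Fin d → ℕ) (w : ℝ → ℝ) :
    ∫ x : Fin d → ℝ, w (x i) * (scaledHermite d (s ^ 2) ν x * scaledHermite d (t ^ 2) η x) =
      (s * t) ^ ((d : ℝ) / 2) *
        ((∫ y, w y * (hermiteFun (ν i) (s * y) * hermiteFun (η i) (t * y))) *
          ∏ j ∈ Finset.univ.erase i, ∫ y, hermiteFun (ν j) (s * y) * hermiteFun (η j) (t * y)) := by
  simp only [scaledHermite_mul hs ht, mul_left_comm (w _) ((s * t) ^ ((d : ℝ) / 2))]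
  rw [integral_const_mul, integral_coord_mul_prod i w
    fun j y => hermiteFun (ν j) (s * y) * hermiteFun (η j) (t * y)]

/-- Multi-indices of the same order are orthogonal for weights depending on one coordinate. -/
theorem integral_coord_mul_scaledHermite_eq_zero (i : Fin d) {s : ℝ} (hs : 0 < s)
    {ν η : Fin d → ℕ} (h : ∑ j, ν j = ∑ j, η j) (hne : ν ≠ η) (w : ℝ → ℝ) :
    ∫ x : Fin d → ℝ, w (x i) * (scaledHermite d (s ^ 2) ν x * scaledHermite d (s ^ 2) η x) = 0 := by
  rw [integral_coord_mul_scaledHermite i hs hs]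
  obtain ⟨j, hj, hjne⟩ : ∃ j ∈ Finset.univ.erase i, ν j ≠ η j := by
    by_contra! hcon
    refine hne (funext fun j => ?_)
    by_cases hji : j = i
    · subst hji
      rw [← Finset.add_sum_erase _ _ (Finset.mem_univ j),
        ← Finset.add_sum_erase _ η (Finset.mem_univ j), Finset.sum_congr rfl hcon] at h
      exact Nat.add_right_cancel h
    · exact hcon j (by simp [hji])
  rw [Finset.prod_eq_zero hj, mul_zero, mul_zero]
  rw [integral_hermiteFun_mul_scaled _ _ hs, if_neg hjne]

theorem integral_coord_mul_scaledHermite_self (i : Fin d) {s : ℝ} (hs : 0 < s)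
    (ν : Fin d → ℕ) (w : ℝ → ℝ) :
    ∫ x : Fin d → ℝ, w (x i) * (scaledHermite d (s ^ 2) ν x * scaledHermite d (s ^ 2) ν x) =
      s * ∫ y, w y * (hermiteFun (ν i) (s * y) * hermiteFun (ν i) (s * y)) := by
  have hd : 1 ≤ d := i.pos
  rw [integral_coord_mul_scaledHermite i hs hs]
  simp only [integral_hermiteFun_mul_scaled _ _ hs, if_true, Finset.prod_const,
    Finset.card_erase_of_mem (Finset.mem_univ i), Finset.card_univ, Fintype.card_fin]
  have e : (s * s) ^ ((d : ℝ) / 2) = s ^ (d - 1) * s := by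
    rw [← pow_succ, Nat.sub_add_cancel hd, ← sq, ← Real.rpow_natCast, ← Real.rpow_mul hs.le,
      ← Real.rpow_natCast]
    congr 1; push_cast; ring
  rw [e, inv_pow]
  field_simp

theorem integrable_normSq_mul_scaledHermite {s t : ℝ} (hs : 0 < s) (ht : 0 < t)
    (ν η : Fin d → ℕ) :
    Integrable fun x : Fin d → ℝ =>
      (∑ i, x i ^ 2) * (scaledHermite d (s ^ 2) ν x * scaledHermite d (t ^ 2) η x) := by
  simp only [Finset.sum_mul]
  exact integrable_finsetSum _ fun i _ => integrable_coord_mul_scaledHermite i hs ht ν η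
    (w := fun y => y ^ 2) (integrable_sq_mul_hermiteFun_mul_scaled _ _ hs ht)

theorem integral_normSq_mul_scaledHermite_eq_zero {s t : ℝ} (hs : 0 < s) (ht : 0 < t) (hst : s ≠ t)
    {ν η : Fin d → ℕ} (h : s ^ 2 * ∑ j, (2 * (ν j : ℝ) + 1) = t ^ 2 * ∑ j, (2 * (η j : ℝ) + 1)) :
    ∫ x : Fin d → ℝ,
      (∑ i, x i ^ 2) * (scaledHermite d (s ^ 2) ν x * scaledHermite d (t ^ 2) η x) = 0 := by
  simp only [Finset.sum_mul]
  rw [integral_finsetSum _ fun i _ => integrable_coord_mul_scaledHermite i hs ht ν η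
    (w := fun y => y ^ 2) (integrable_sq_mul_hermiteFun_mul_scaled _ _ hs ht)]
  have h4 : s ^ 4 - t ^ 4 ≠ 0 := by
    rw [sub_ne_zero]
    intro h4
    exact hst ((pow_left_inj₀ hs.le ht.le (by norm_num)).1 h4)
  refine (mul_eq_zero.1 ?_).resolve_left h4
  have e : ∀ i : Fin d, (s ^ 4 - t ^ 4) * ∫ x : Fin d → ℝ,
      x i ^ 2 * (scaledHermite d (s ^ 2) ν x * scaledHermite d (t ^ 2) η x) =
      (s ^ 2 * (2 * (ν i : ℝ) + 1) - t ^ 2 * (2 * (η i : ℝ) + 1)) * ((s * t) ^ ((d : ℝ) / 2) *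
        ∏ j, ∫ y, hermiteFun (ν j) (s * y) * hermiteFun (η j) (t * y)) := fun i => by
    rw [integral_coord_mul_scaledHermite i hs ht ν η fun y => y ^ 2,
      ← Finset.mul_prod_erase _ _ (Finset.mem_univ i)]
    have := integral_sq_mul_hermiteFun_mul (ν i) (η i) hs ht
    linear_combination ((s * t) ^ ((d : ℝ) / 2) *
      ∏ j ∈ Finset.univ.erase i, ∫ y, hermiteFun (ν j) (s * y) * hermiteFun (η j) (t * y)) * this
  rw [Finset.mul_sum, Finset.sum_congr rfl fun i _ => e i, ← Finset.sum_mul,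
    Finset.sum_sub_distrib, ← Finset.mul_sum, ← Finset.mul_sum, h, sub_self, zero_mul]

theorem integral_normSq_mul_scaledHermite_self_le {s : ℝ} (hs : 0 < s) (ν : Fin d → ℕ) :
    ∫ x : Fin d → ℝ, (∑ i, x i ^ 2) * (scaledHermite d (s ^ 2) ν x * scaledHermite d (s ^ 2) ν x) ≤
      (∑ j, (2 * (ν j : ℝ) + 1)) / s ^ 2 := by
  simp only [Finset.sum_mul]
  rw [integral_finsetSum _ fun i _ => integrable_coord_mul_scaledHermite i hs hs ν ν
    (w := fun y => y ^ 2) (integrable_sq_mul_hermiteFun_mul_scaled _ _ hs hs), Finset.sum_div]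
  refine Finset.sum_le_sum fun i _ => ?_
  rw [integral_coord_mul_scaledHermite_self i hs ν fun y => y ^ 2]
  have e : ∀ y : ℝ, y ^ 2 * (hermiteFun (ν i) (s * y) * hermiteFun (ν i) (s * y)) =
      (s ^ 2)⁻¹ * (fun y => y ^ 2 * (hermiteFun (ν i) y * hermiteFun (ν i) y)) (s * y) := by
    intro y; field_simp
  simp only [e]
  rw [integral_const_mul, Measure.integral_comp_mul_left
    (fun y => y ^ 2 * (hermiteFun (ν i) y * hermiteFun (ν i) y)), abs_of_pos (inv_pos.2 hs),
    smul_eq_mul]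
  have := integral_sq_mul_hermiteFun_sq_le (ν i)
  rw [le_div_iff₀ (by positivity)]
  refine le_trans (le_of_eq ?_) this
  field_simp

theorem setIntegral_coord_mul_scaledHermite_self_le (i : Fin d) {s : ℝ} (hs : 0 < s)
    (ν : Fin d → ℕ) {ρ : ℝ} (hρ : 0 ≤ ρ) :
    ∫ x : Fin d → ℝ, (Icc (-ρ) ρ).indicator 1 (x i) *
      (scaledHermite d (s ^ 2) ν x * scaledHermite d (s ^ 2) ν x) ≤
        10 * (s * ρ) / √(2 * (ν i : ℝ) + 1) := by
  rw [integral_coord_mul_scaledHermite_self i hs ν]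
  have e : ∀ y : ℝ, (Icc (-ρ) ρ).indicator (1 : ℝ → ℝ) y *
      (hermiteFun (ν i) (s * y) * hermiteFun (ν i) (s * y)) =
      ((Icc (-(s * ρ)) (s * ρ)).indicator fun y => hermiteFun (ν i) y * hermiteFun (ν i) y)
        (s * y) := by
    intro y
    have : y ∈ Icc (-ρ) ρ ↔ s * y ∈ Icc (-(s * ρ)) (s * ρ) := by
      rw [mem_Icc, mem_Icc, ← mul_neg, mul_le_mul_iff_right₀ hs, mul_le_mul_iff_right₀ hs]
    by_cases h : y ∈ Icc (-ρ) ρ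
    · rw [indicator_of_mem h, indicator_of_mem (this.1 h), Pi.one_apply, one_mul]
    · rw [indicator_of_notMem h, indicator_of_notMem (this.not.1 h), zero_mul]
  simp only [e]
  rw [Measure.integral_comp_mul_left, integral_indicator measurableSet_Icc,
    abs_of_pos (inv_pos.2 hs), smul_eq_mul, mul_inv_cancel_left₀ hs.ne']
  exact setIntegral_hermiteFun_sq_le _ (by positivity)

theorem integrable_scaledHermite_mul {s t : ℝ} (hs : 0 < s) (ht : 0 < t) (ν η : Fin d → ℕ) :
    Integrable fun x : Fin d → ℝ => scaledHermite d (s ^ 2) ν x * scaledHermite d (t ^ 2) η x := by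
  simp only [scaledHermite_mul hs ht]
  exact (Integrable.fintype_prod fun j => integrable_hermiteFun_mul_scaled _ _ hs ht).const_mul _

end ScaledHermite

section Fiberwise

variable {X ι κ : Type*} [MeasurableSpace X] {m : Measure X}

theorem integrable_mul_sum_sq {s : Finset ι} {w : X → ℝ} {F : ι → X → ℝ}
    (hinteg : ∀ i ∈ s, ∀ j ∈ s, Integrable (fun x => w x * (F i x * F j x)) m) :
    Integrable (fun x => w x * (∑ i ∈ s, F i x) ^ 2) m := by
  have e : (fun x => w x * (∑ i ∈ s, F i x) ^ 2) =
      fun x => ∑ i ∈ s, ∑ j ∈ s, w x * (F i x * F j x) := by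
    ext x
    rw [sq, Finset.sum_mul_sum, Finset.mul_sum]
    exact Finset.sum_congr rfl fun i _ => Finset.mul_sum _ _ _
  rw [e]
  exact integrable_finsetSum _ fun i hi => integrable_finsetSum _ fun j hj => hinteg i hi j hj

/-- Weighted Cauchy–Schwarz for a sum split into fibres. -/
theorem integral_mul_sum_sq_le_fiberwise [DecidableEq κ] {s : Finset ι} {t : Finset κ} {g : ι → κ}
    (hg : ∀ i ∈ s, g i ∈ t) {θ : κ → ℝ} (hθ : ∀ k ∈ t, 0 < θ k) {Θ : ℝ} (hΘ : ∑ k ∈ t, θ k ≤ Θ)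
    {w : X → ℝ} (hw : ∀ x, 0 ≤ w x) {F : ι → X → ℝ}
    (hinteg : ∀ i ∈ s, ∀ j ∈ s, Integrable (fun x => w x * (F i x * F j x)) m) :
    ∫ x, w x * (∑ i ∈ s, F i x) ^ 2 ∂m ≤
      Θ * ∑ k ∈ t, (θ k)⁻¹ * ∫ x, w x * (∑ i ∈ s with g i = k, F i x) ^ 2 ∂m := by
  have hi : ∀ k, Integrable (fun x => w x * (∑ i ∈ s with g i = k, F i x) ^ 2) m := fun k =>
    integrable_mul_sum_sq fun i hi j hj =>
      hinteg i (Finset.mem_of_mem_filter i hi) j (Finset.mem_of_mem_filter j hj)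
  have hsum : ∀ x, (∑ i ∈ s, F i x) ^ 2 ≤
      Θ * ∑ k ∈ t, (θ k)⁻¹ * (∑ i ∈ s with g i = k, F i x) ^ 2 := fun x => by
    rw [← Finset.sum_fiberwise_of_maps_to hg]
    refine (Finset.sum_sq_le_sum_mul_sum_of_sq_le_mul t (fun k hk => (hθ k hk).le)
      (g := fun k => (θ k)⁻¹ * (∑ i ∈ s with g i = k, F i x) ^ 2)
      (fun k hk => mul_nonneg (inv_nonneg.2 (hθ k hk).le) (sq_nonneg _))
      (fun k hk => (mul_inv_cancel_left₀ (hθ k hk).ne' _).ge)).trans ?_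
    exact mul_le_mul_of_nonneg_right hΘ (Finset.sum_nonneg fun k hk =>
      mul_nonneg (inv_nonneg.2 (hθ k hk).le) (sq_nonneg _))
  calc _ ≤ ∫ x, Θ * ∑ k ∈ t, (θ k)⁻¹ * (w x * (∑ i ∈ s with g i = k, F i x) ^ 2) ∂m := by
        refine integral_mono (integrable_mul_sum_sq hinteg)
          ((integrable_finsetSum _ fun k _ => (hi k).const_mul _).const_mul _) fun x => ?_
        refine (mul_le_mul_of_nonneg_left (hsum x) (hw x)).trans (le_of_eq ?_)
        simp only [Finset.mul_sum]
        exact Finset.sum_congr rfl fun k _ => by ring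
    _ = _ := by
        rw [integral_const_mul, integral_finsetSum _ fun k _ => (hi k).const_mul _]
        simp only [integral_const_mul]

end Fiberwise

section Synthesis

variable {d : ℕ} {μ : ℝ}

/-- `2|ν| + d`, the eigenvalue of the Hermite operator on `Φ_ν`. -/
noncomputable def hermiteEigenvalue (d : ℕ) (ν : Fin d → ℕ) : ℝ := 2 * ((∑ j, ν j : ℕ) : ℝ) + d

/-- The Hermite function `Φ^a_ν` at the scale `a = μ / (2|ν| + d)`. -/
noncomputable def grushinFun (d : ℕ) (μ : ℝ) (ν : Fin d → ℕ) (x : Fin d → ℝ) : ℝ :=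
  scaledHermite d (μ / hermiteEigenvalue d ν) ν x

theorem hermiteEigenvalue_eq_sum (ν : Fin d → ℕ) :
    hermiteEigenvalue d ν = ∑ j, (2 * (ν j : ℝ) + 1) := by
  simp [hermiteEigenvalue, Finset.sum_add_distrib, Finset.mul_sum]

theorem hermiteEigenvalue_pos (hd : 1 ≤ d) (ν : Fin d → ℕ) : 0 < hermiteEigenvalue d ν := by
  have : (0 : ℝ) < d := by exact_mod_cast hd
  rw [hermiteEigenvalue]; positivity

theorem exists_grushinFun_eq (hd : 1 ≤ d) (hμ : 0 < μ) (ν : Fin d → ℕ) :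
    ∃ s > 0, s ^ 2 = μ / hermiteEigenvalue d ν ∧ grushinFun d μ ν = scaledHermite d (s ^ 2) ν := by
  have h := div_pos hμ (hermiteEigenvalue_pos hd ν)
  refine ⟨√(μ / hermiteEigenvalue d ν), Real.sqrt_pos.2 h, Real.sq_sqrt h.le, ?_⟩
  rw [Real.sq_sqrt h.le]
  rfl

theorem integrable_grushinFun_mul (hd : 1 ≤ d) (hμ : 0 < μ) (ν η : Fin d → ℕ) :
    Integrable fun x => grushinFun d μ ν x * grushinFun d μ η x := by
  obtain ⟨s, hs, -, e⟩ := exists_grushinFun_eq hd hμ ν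
  obtain ⟨t, ht, -, e'⟩ := exists_grushinFun_eq hd hμ η
  rw [e, e']
  exact integrable_scaledHermite_mul hs ht ν η

theorem integrable_normSq_mul_grushinFun (hd : 1 ≤ d) (hμ : 0 < μ) (ν η : Fin d → ℕ) :
    Integrable fun x : Fin d → ℝ =>
      (∑ i, x i ^ 2) * (grushinFun d μ ν x * grushinFun d μ η x) := by
  obtain ⟨s, hs, -, e⟩ := exists_grushinFun_eq hd hμ ν
  obtain ⟨t, ht, -, e'⟩ := exists_grushinFun_eq hd hμ η
  rw [e, e']
  exact integrable_normSq_mul_scaledHermite hs ht ν η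

theorem integrable_indicator_mul_grushinFun (hd : 1 ≤ d) (hμ : 0 < μ) (ν η : Fin d → ℕ)
    (i : Fin d) {S : Set ℝ} (hS : MeasurableSet S) :
    Integrable fun x : Fin d → ℝ =>
      S.indicator 1 (x i) * (grushinFun d μ ν x * grushinFun d μ η x) := by
  have h : MeasurableSet {x : Fin d → ℝ | x i ∈ S} := measurable_pi_apply i hS
  refine ((integrable_grushinFun_mul hd hμ ν η).indicator h).congr (.of_forall fun x => ?_)
  simp only
  by_cases hx : x i ∈ S
  · rw [indicator_of_mem (by exact hx), indicator_of_mem hx, Pi.one_apply, one_mul]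
  · rw [indicator_of_notMem (by exact hx), indicator_of_notMem hx, zero_mul]

theorem integral_normSq_mul_grushinFun_eq_zero (hd : 1 ≤ d) (hμ : 0 < μ) {ν η : Fin d → ℕ}
    (hne : ν ≠ η) :
    ∫ x : Fin d → ℝ, (∑ i, x i ^ 2) * (grushinFun d μ ν x * grushinFun d μ η x) = 0 := by
  have hν := hermiteEigenvalue_pos hd ν
  have hη := hermiteEigenvalue_pos hd η
  obtain ⟨s, hs, hs2, e⟩ := exists_grushinFun_eq hd hμ ν
  obtain ⟨t, ht, ht2, e'⟩ := exists_grushinFun_eq hd hμ η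
  rw [e, e']
  by_cases hst : s = t
  · subst hst
    have hN : hermiteEigenvalue d ν = hermiteEigenvalue d η := by
      rw [hs2] at ht2
      field_simp at ht2
      exact ht2.symm
    have hsum : ∑ j, ν j = ∑ j, η j := by
      simp only [hermiteEigenvalue] at hN
      exact_mod_cast (by linarith : ((∑ j, ν j : ℕ) : ℝ) = ((∑ j, η j : ℕ) : ℝ))
    simp only [Finset.sum_mul]
    rw [integral_finsetSum _ fun i _ => integrable_coord_mul_scaledHermite i hs hs ν η
      (w := fun y => y ^ 2) (integrable_sq_mul_hermiteFun_mul_scaled _ _ hs hs)]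
    exact Finset.sum_eq_zero fun i _ =>
      integral_coord_mul_scaledHermite_eq_zero i hs hsum hne fun y => y ^ 2
  · refine integral_normSq_mul_scaledHermite_eq_zero hs ht hst ?_
    rw [← hermiteEigenvalue_eq_sum, ← hermiteEigenvalue_eq_sum, hs2, ht2]
    field_simp

theorem integral_normSq_mul_grushinFun_self_le (hd : 1 ≤ d) (hμ : 0 < μ) (ν : Fin d → ℕ) :
    ∫ x : Fin d → ℝ, (∑ i, x i ^ 2) * (grushinFun d μ ν x * grushinFun d μ ν x) ≤
      hermiteEigenvalue d ν ^ 2 / μ := by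
  have hν := hermiteEigenvalue_pos hd ν
  obtain ⟨s, hs, hs2, e⟩ := exists_grushinFun_eq hd hμ ν
  rw [e]
  refine (integral_normSq_mul_scaledHermite_self_le hs ν).trans (le_of_eq ?_)
  rw [← hermiteEigenvalue_eq_sum, hs2]
  field_simp

theorem integral_indicator_mul_grushinFun_eq_zero (hd : 1 ≤ d) (hμ : 0 < μ) {ν η : Fin d → ℕ}
    (hsum : ∑ j, ν j = ∑ j, η j) (hne : ν ≠ η) (i : Fin d) (w : ℝ → ℝ) :
    ∫ x : Fin d → ℝ, w (x i) * (grushinFun d μ ν x * grushinFun d μ η x) = 0 := by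
  obtain ⟨s, hs, hs2, e⟩ := exists_grushinFun_eq hd hμ ν
  have e' : grushinFun d μ η = scaledHermite d (s ^ 2) η := by
    ext x
    rw [hs2, grushinFun, hermiteEigenvalue, hermiteEigenvalue, hsum]
  rw [e, e']
  exact integral_coord_mul_scaledHermite_eq_zero i hs hsum hne w

theorem integral_indicator_mul_grushinFun_self_le (hd : 1 ≤ d) (hμ : 0 < μ) (ν : Fin d → ℕ)
    (i : Fin d) (hi : hermiteEigenvalue d ν ≤ d * (2 * (ν i : ℝ) + 1)) {ρ : ℝ} (hρ : 0 ≤ ρ) :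
    ∫ x : Fin d → ℝ, (Icc (-ρ) ρ).indicator 1 (x i) * (grushinFun d μ ν x * grushinFun d μ ν x) ≤
      10 * ρ * √(μ * d) / hermiteEigenvalue d ν := by
  have hν := hermiteEigenvalue_pos hd ν
  have hd' : (0 : ℝ) < d := by exact_mod_cast hd
  obtain ⟨s, hs, hs2, e⟩ := exists_grushinFun_eq hd hμ ν
  rw [e]
  refine (setIntegral_coord_mul_scaledHermite_self_le i hs ν hρ).trans ?_
  rw [div_le_div_iff₀ (by positivity) hν]
  have h1 : s * hermiteEigenvalue d ν ≤ √(μ * d) * √(2 * (ν i : ℝ) + 1) := by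
    rw [← Real.sqrt_mul (by positivity)]
    refine Real.le_sqrt_of_sq_le ?_
    rw [mul_pow, hs2, div_mul_eq_mul_div, sq, ← mul_assoc, mul_div_cancel_right₀ _ hν.ne',
        mul_assoc]
    gcongr
  calc _ = 10 * ρ * (s * hermiteEigenvalue d ν) := by ring
    _ ≤ 10 * ρ * (√(μ * d) * √(2 * (ν i : ℝ) + 1)) := by gcongr
    _ = _ := by ring

theorem integral_block_sq_le (hd : 1 ≤ d) (hμ : 0 < μ) (s : Finset (Fin d → ℕ))
    (c : (Fin d → ℕ) → ℝ)
    (i : Fin d) (hi : ∀ ν ∈ s, hermiteEigenvalue d ν ≤ d * (2 * (ν i : ℝ) + 1)) {n : ℕ} {τ : ℝ}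
    (hτ : 0 < τ) (hτn : τ ^ 3 = 2 ^ n) (h1 : ∀ ν ∈ s, 2 ^ n ≤ hermiteEigenvalue d ν)
    (h2 : ∀ ν ∈ s, hermiteEigenvalue d ν ≤ 2 * 2 ^ n) :
    ∫ x, (∑ ν ∈ s, c ν / hermiteEigenvalue d ν * grushinFun d μ ν x) ^ 2 ≤
      (2 + 20 * √d) * τ⁻¹ * ∑ ν ∈ s, c ν ^ 2 / hermiteEigenvalue d ν := by
  set N := hermiteEigenvalue d with hN
  have hNpos : ∀ ν, 0 < N ν := hermiteEigenvalue_pos hd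
  set F : (Fin d → ℝ) → ℝ := fun x => ∑ ν ∈ s, c ν / N ν * grushinFun d μ ν x with hF
  have hsm : 0 < √μ := Real.sqrt_pos.2 hμ
  have hsm2 : √μ ^ 2 = μ := Real.sq_sqrt hμ.le
  set ρ : ℝ := τ ^ 2 / √μ with hρ
  have hρ0 : 0 < ρ := by positivity
  have hint0 := integrable_mul_sum_sq (m := volume) (s := s) (w := fun _ => (1 : ℝ))
    (F := fun ν (x : Fin d → ℝ) => c ν / N ν * grushinFun d μ ν x) (fun ν _ η _ => by
      refine ((integrable_grushinFun_mul hd hμ ν η).const_mul (c ν / N ν * (c η / N η))).congr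
        (.of_forall fun x => ?_)
      simp only; ring)
  have hintI' : ∀ ν ∈ s, ∀ η ∈ s, Integrable fun x : Fin d → ℝ => (Icc (-ρ) ρ).indicator 1 (x i) *
      ((c ν / N ν * grushinFun d μ ν x) * (c η / N η * grushinFun d μ η x)) := fun ν _ η _ => by
    refine ((integrable_indicator_mul_grushinFun hd hμ ν η i (measurableSet_Icc (a := -ρ) (b :=
        ρ))).const_mul
      (c ν / N ν * (c η / N η))).congr (.of_forall fun x => ?_)
    simp only; ring
  have hintI := integrable_mul_sum_sq (m := volume) hintI'
  have hintX := integrable_mul_sum_sq (m := volume) (s := s)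
    (w := fun x : Fin d → ℝ => ∑ i, x i ^ 2)
    (F := fun ν (x : Fin d → ℝ) => c ν / N ν * grushinFun d μ ν x) (fun ν _ η _ => by
      refine ((integrable_normSq_mul_grushinFun hd hμ ν η).const_mul
          (c ν / N ν * (c η / N η))).congr
        (.of_forall fun x => ?_)
      simp only; ring)
  have hsplit : ∀ x : Fin d → ℝ, F x ^ 2 ≤
      (Icc (-ρ) ρ).indicator 1 (x i) * F x ^ 2 + (ρ ^ 2)⁻¹ * ((∑ i, x i ^ 2) * F x ^ 2) :=
          fun x => by
    have hX : 0 ≤ ∑ i, x i ^ 2 := Finset.sum_nonneg fun _ _ => sq_nonneg _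
    by_cases hx : x i ∈ Icc (-ρ) ρ
    · rw [indicator_of_mem hx, Pi.one_apply, one_mul]
      have : 0 ≤ (ρ ^ 2)⁻¹ * ((∑ i, x i ^ 2) * F x ^ 2) := by positivity
      linarith
    · rw [indicator_of_notMem hx, zero_mul, zero_add, ← mul_assoc]
      refine le_mul_of_one_le_left (sq_nonneg _) ?_
      rw [inv_mul_eq_div, one_le_div (by positivity)]
      have h3 : ρ ^ 2 ≤ x i ^ 2 := by
        rw [mem_Icc, ← abs_le, not_le] at hx
        rw [← sq_abs (x i)]
        gcongr
      exact h3.trans (Finset.single_le_sum (f := fun i => x i ^ 2) (fun _ _ => sq_nonneg _)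
        (Finset.mem_univ i))
  have hout : ∫ x : Fin d → ℝ, (∑ i, x i ^ 2) * F x ^ 2 ≤
      2 * 2 ^ n / μ * ∑ ν ∈ s, c ν ^ 2 / N ν := by
    rw [integral_mul_sum_sq s (fun x : Fin d → ℝ => ∑ i, x i ^ 2) (grushinFun d μ)
      (fun ν => c ν / N ν)
      (fun ν _ η _ => integrable_normSq_mul_grushinFun hd hμ ν η)
      (fun ν _ η _ h => integral_normSq_mul_grushinFun_eq_zero hd hμ h), Finset.mul_sum]
    refine Finset.sum_le_sum fun ν hν => ?_
    have hp := hNpos ν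
    calc _ ≤ (c ν / N ν) ^ 2 * (N ν ^ 2 / μ) := by
          gcongr
          exact integral_normSq_mul_grushinFun_self_le hd hμ ν
      _ = N ν / μ * (c ν ^ 2 / N ν) := by field_simp
      _ ≤ _ := by
          gcongr
          exact h2 ν hν
  have hin : ∫ x : Fin d → ℝ, (Icc (-ρ) ρ).indicator 1 (x i) * F x ^ 2 ≤
      20 * ρ * √(μ * d) / 2 ^ n * ∑ ν ∈ s, c ν ^ 2 / N ν := by
    set K : Finset ℕ := s.image fun ν => ∑ j, ν j with hK
    have hcard : (K.card : ℝ) ≤ 2 * 2 ^ n := by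
      have : K ⊆ Finset.range (2 ^ n + 1) := by
        intro k hk
        obtain ⟨ν, hν, rfl⟩ := Finset.mem_image.1 hk
        have := h2 ν hν
        rw [hN, hermiteEigenvalue] at this
        rw [Finset.mem_range, Nat.lt_succ_iff]
        have h5 : ((∑ j, ν j : ℕ) : ℝ) ≤ 2 ^ n := by
          have : (0 : ℝ) ≤ d := by positivity
          linarith
        exact_mod_cast h5
      have := Finset.card_le_card this
      rw [Finset.card_range] at this
      have h5 : (1 : ℝ) ≤ 2 ^ n := one_le_pow₀ (by norm_num)
      have h6 : (K.card : ℝ) ≤ 2 ^ n + 1 := by exact_mod_cast this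
      linarith
    have hΘ : ∑ k ∈ K, (2 * (k : ℝ) + d)⁻¹ ≤ 2 := by
      calc _ ≤ ∑ k ∈ K, ((2 : ℝ) ^ n)⁻¹ := by
            refine Finset.sum_le_sum fun k hk => ?_
            obtain ⟨ν, hν, rfl⟩ := Finset.mem_image.1 hk
            exact inv_anti₀ (by positivity) (h1 ν hν)
        _ ≤ (2 * 2 ^ n) * ((2 : ℝ) ^ n)⁻¹ := by
            rw [Finset.sum_const, nsmul_eq_mul]
            gcongr
        _ = 2 := by field_simp
    have hw : ∀ x : Fin d → ℝ, 0 ≤ (Icc (-ρ) ρ).indicator (1 : ℝ → ℝ) (x i) :=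
      fun x => indicator_nonneg (fun _ _ => zero_le_one) _
    refine (integral_mul_sum_sq_le_fiberwise (m := volume) (g := fun ν : Fin d → ℕ => ∑ j, ν j)
      (θ := fun k : ℕ => (2 * (k : ℝ) + d)⁻¹) (fun ν hν => Finset.mem_image_of_mem _ hν)
      (fun k _ => ?_) hΘ hw hintI').trans ?_
    · have : (0 : ℝ) < d := by exact_mod_cast hd
      positivity
    rw [← Finset.sum_fiberwise_of_maps_to (s := s) (t := K)
      (g := fun ν => ∑ j, ν j) (fun ν hν => Finset.mem_image_of_mem _ hν), Finset.mul_sum,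
      Finset.mul_sum]
    refine Finset.sum_le_sum fun k _ => ?_
    rw [integral_mul_sum_sq _ (fun x : Fin d → ℝ => (Icc (-ρ) ρ).indicator 1 (x i)) (grushinFun d μ)
      (fun ν => c ν / N ν)
      (fun ν _ η _ => integrable_indicator_mul_grushinFun hd hμ ν η i measurableSet_Icc)
      (fun ν hν η hη h => integral_indicator_mul_grushinFun_eq_zero hd hμ
        (by rw [(Finset.mem_filter.1 hν).2, (Finset.mem_filter.1 hη).2]) h i _),
      Finset.mul_sum, Finset.mul_sum, Finset.mul_sum]
    refine Finset.sum_le_sum fun ν hν => ?_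
    have hp := hNpos ν
    obtain ⟨hνs, hνk⟩ := Finset.mem_filter.1 hν
    have hk : (2 * (k : ℝ) + d)⁻¹⁻¹ = N ν := by rw [inv_inv, hN, hermiteEigenvalue, hνk]
    rw [hk]
    calc _ ≤ 2 * (N ν * ((c ν / N ν) ^ 2 * (10 * ρ * √(μ * d) / N ν))) := by
          gcongr
          exact integral_indicator_mul_grushinFun_self_le hd hμ ν i (hi ν hνs) hρ0.le
      _ = 20 * ρ * √(μ * d) / N ν * (c ν ^ 2 / N ν) := by field_simp; ring
      _ ≤ _ := by
          gcongr
          exact h1 ν hνs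
  calc ∫ x, F x ^ 2 ≤ ∫ x : Fin d → ℝ, ((Icc (-ρ) ρ).indicator 1 (x i) * F x ^ 2 +
        (ρ ^ 2)⁻¹ * ((∑ i, x i ^ 2) * F x ^ 2)) :=
        integral_mono (by simpa only [one_mul] using hint0) (hintI.add (hintX.const_mul _)) hsplit
    _ ≤ 20 * ρ * √(μ * d) / 2 ^ n * (∑ ν ∈ s, c ν ^ 2 / N ν) +
        (ρ ^ 2)⁻¹ * (2 * 2 ^ n / μ * ∑ ν ∈ s, c ν ^ 2 / N ν) := by
        rw [integral_add hintI (hintX.const_mul _), integral_const_mul]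
        gcongr
    _ = _ := by
        rw [← hτn, Real.sqrt_mul hμ.le, hρ]
        rw [show (τ ^ 2 / √μ) ^ 2 = τ ^ 4 / μ by rw [div_pow, hsm2]; ring]
        field_simp
        ring

end Synthesis

section SynthesisLTwo

variable {d : ℕ}

theorem exists_coord_hermiteEigenvalue_le (hd : 1 ≤ d) (ν : Fin d → ℕ) :
    ∃ i, hermiteEigenvalue d ν ≤ d * (2 * (ν i : ℝ) + 1) := by
  have : Nonempty (Fin d) := ⟨⟨0, hd⟩⟩
  obtain ⟨i, -, hi⟩ := Finset.exists_max_image Finset.univ ν Finset.univ_nonempty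
  refine ⟨i, ?_⟩
  rw [hermiteEigenvalue_eq_sum]
  refine (Finset.sum_le_card_nsmul _ _ (2 * (ν i : ℝ) + 1) fun j hj => ?_).trans ?_
  · have : (ν j : ℝ) ≤ ν i := by exact_mod_cast hi j hj
    linarith
  · simp; linarith

theorem integrable_one_mul_grushinFun (hd : 1 ≤ d) {μ : ℝ} (hμ : 0 < μ) (c : (Fin d → ℕ) → ℝ)
    (ν η : Fin d → ℕ) :
    Integrable fun x : Fin d → ℝ => (fun _ => (1 : ℝ)) x *
      ((c ν * grushinFun d μ ν x) * (c η * grushinFun d μ η x)) := by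
  refine ((integrable_grushinFun_mul hd hμ ν η).const_mul (c ν * c η)).congr
    (.of_forall fun x => ?_)
  simp only; ring

theorem integral_sq_le_of_coord (hd : 1 ≤ d) {μ : ℝ} (hμ : 0 < μ) (s : Finset (Fin d → ℕ))
    (c : (Fin d → ℕ) → ℝ) (i : Fin d)
    (hi : ∀ ν ∈ s, hermiteEigenvalue d ν ≤ d * (2 * (ν i : ℝ) + 1)) :
    ∫ x, (∑ ν ∈ s, c ν / hermiteEigenvalue d ν * grushinFun d μ ν x) ^ 2 ≤
      (1 - (2 : ℝ) ^ (-(1 / 3) : ℝ))⁻¹ * (2 + 20 * √d) *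
        ∑ ν ∈ s, c ν ^ 2 / hermiteEigenvalue d ν := by
  set x₀ : ℝ := (2 : ℝ) ^ (-(1 / 3) : ℝ) with hx
  have hx0 : 0 < x₀ := by positivity
  have hx1 : x₀ < 1 := Real.rpow_lt_one_of_one_lt_of_neg (by norm_num) (by norm_num)
  have hx3 : x₀ ^ 3 = 2⁻¹ := by
    rw [hx, ← Real.rpow_natCast, ← Real.rpow_mul (by norm_num), ← Real.rpow_neg_one]
    norm_num
  set g : (Fin d → ℕ) → ℕ := fun ν => Nat.log 2 (2 * (∑ j, ν j) + d) with hg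
  have hN : ∀ ν, hermiteEigenvalue d ν = ((2 * (∑ j, ν j) + d : ℕ) : ℝ) := fun ν => by
    rw [hermiteEigenvalue]; push_cast; rfl
  have hΘ : ∑ k ∈ s.image g, x₀ ^ k ≤ (1 - x₀)⁻¹ := by
    rw [← tsum_geometric_of_lt_one hx0.le hx1]
    exact (summable_geometric_of_lt_one hx0.le hx1).sum_le_tsum _ fun _ _ => by positivity
  have := integral_mul_sum_sq_le_fiberwise (m := volume) (g := g) (s := s)
    (t := s.image g) (fun ν hν => Finset.mem_image_of_mem _ hν)
    (θ := fun k : ℕ => x₀ ^ k) (fun k _ => by positivity) hΘ (w := fun _ => (1 : ℝ))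
    (fun _ => zero_le_one)
    (F := fun ν (x : Fin d → ℝ) => c ν / hermiteEigenvalue d ν * grushinFun d μ ν x)
    (fun ν _ η _ => integrable_one_mul_grushinFun hd hμ (fun ν => c ν / hermiteEigenvalue d ν) ν η)
  simp only [one_mul] at this
  refine this.trans ?_
  rw [mul_assoc]
  refine mul_le_mul_of_nonneg_left ?_ (inv_nonneg.2 (sub_nonneg.2 hx1.le))
  rw [← Finset.sum_fiberwise_of_maps_to (s := s) (t := s.image g) (g := g)
    (fun ν hν => Finset.mem_image_of_mem _ hν), Finset.mul_sum]
  refine Finset.sum_le_sum fun k _ => ?_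
  have hb := integral_block_sq_le hd hμ (s.filter fun ν => g ν = k) c i
    (fun ν hν => hi ν (Finset.mem_of_mem_filter ν hν)) (n := k) (τ := (x₀ ^ k)⁻¹) (by positivity)
    (by rw [inv_pow, ← pow_mul, mul_comm, pow_mul, hx3, inv_pow, inv_inv])
    (fun ν hν => by
      rw [hN ν, ← (Finset.mem_filter.1 hν).2]
      exact_mod_cast Nat.pow_log_le_self 2 (by omega))
    (fun ν hν => by
      rw [hN ν, ← (Finset.mem_filter.1 hν).2, ← pow_succ']
      exact_mod_cast (Nat.lt_pow_succ_log_self one_lt_two _).le)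
  rw [inv_inv] at hb
  calc _ ≤ (x₀ ^ k)⁻¹ * _ := mul_le_mul_of_nonneg_left hb (by positivity)
    _ = _ := by field_simp

theorem exists_integral_synthesis_sq_le (hd : 1 ≤ d) :
    ∃ C > 0, ∀ μ : ℝ, 0 < μ → ∀ (s : Finset (Fin d → ℕ)) (c : (Fin d → ℕ) → ℝ),
      ∫ x, (∑ ν ∈ s, c ν / hermiteEigenvalue d ν * grushinFun d μ ν x) ^ 2 ≤
        C * ∑ ν ∈ s, c ν ^ 2 / hermiteEigenvalue d ν := by
  have hd' : (0 : ℝ) < d := by exact_mod_cast hd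
  have hx1 : (2 : ℝ) ^ (-(1 / 3) : ℝ) < 1 :=
    Real.rpow_lt_one_of_one_lt_of_neg (by norm_num) (by norm_num)
  have hx2 := inv_pos.2 (sub_pos.2 hx1)
  refine ⟨d * ((1 - (2 : ℝ) ^ (-(1 / 3) : ℝ))⁻¹ * (2 + 20 * √d)), by positivity,
    fun μ hμ s c => ?_⟩
  choose g hg using exists_coord_hermiteEigenvalue_le hd
  have := integral_mul_sum_sq_le_fiberwise (m := volume) (g := g) (s := s)
    (t := Finset.univ) (fun ν _ => Finset.mem_univ _)
    (θ := fun _ => 1) (fun k _ => one_pos) (Θ := d) (by simp) (w := fun _ => (1 : ℝ))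
    (fun _ => zero_le_one)
    (F := fun ν (x : Fin d → ℝ) => c ν / hermiteEigenvalue d ν * grushinFun d μ ν x)
    (fun ν _ η _ => integrable_one_mul_grushinFun hd hμ (fun ν => c ν / hermiteEigenvalue d ν) ν η)
  simp only [one_mul, inv_one] at this
  refine this.trans ?_
  rw [mul_assoc]
  refine mul_le_mul_of_nonneg_left ?_ hd'.le
  rw [← Finset.sum_fiberwise_of_maps_to (s := s) (t := Finset.univ) (g := g)
    (fun ν _ => Finset.mem_univ _), Finset.mul_sum]
  refine Finset.sum_le_sum fun i _ => integral_sq_le_of_coord hd hμ _ c i fun ν hν => ?_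
  rw [← (Finset.mem_filter.1 hν).2]
  exact hg ν

/-- Orthonormality of the scaled Hermite functions of a fixed order. -/
theorem integral_sum_grushinFun_sq (hd : 1 ≤ d) {μ : ℝ} (hμ : 0 < μ) (s : Finset (Fin d → ℕ))
    {k : ℕ} (hs : ∀ ν ∈ s, ∑ j, ν j = k) (c : (Fin d → ℕ) → ℝ) :
    ∫ x, (∑ ν ∈ s, c ν * grushinFun d μ ν x) ^ 2 = ∑ ν ∈ s, c ν ^ 2 := by
  have := integral_mul_sum_sq (m := volume) s (fun _ => (1 : ℝ)) (grushinFun d μ) c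
    (fun ν _ η _ => by simpa only [one_mul] using integrable_grushinFun_mul hd hμ ν η)
    (fun ν hν η hη h => integral_indicator_mul_grushinFun_eq_zero hd hμ
      ((hs ν hν).trans (hs η hη).symm) h ⟨0, hd⟩ fun _ => 1)
  simp only [one_mul] at this
  rw [this]
  refine Finset.sum_congr rfl fun ν _ => ?_
  obtain ⟨t, ht, -, e⟩ := exists_grushinFun_eq hd hμ ν
  have h1 := integral_coord_mul_scaledHermite_self ⟨0, hd⟩ ht ν fun _ => 1
  simp only [one_mul] at h1
  rw [e, h1, integral_hermiteFun_mul_scaled _ _ ht, if_pos rfl, mul_inv_cancel₀ ht.ne', mul_one]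

end SynthesisLTwo

section Pointwise

theorem sum_hermiteFunMulti_sq_le (m k : ℕ) (x : Fin (m + 1) → ℝ) :
    ∑ ν ∈ Finset.Nat.antidiagonalTuple (m + 1) k, hermiteFunMulti (m + 1) ν x ^ 2 ≤
      5 / 2 * 2 ^ m * (2 * (k : ℝ) + 1) ^ ((m + 1 : ℝ) / 2 - 1 / 3) := by
  have hk : (0 : ℝ) < 2 * k + 1 := by positivity
  have hmaps : ∀ ν ∈ Finset.Nat.antidiagonalTuple (m + 1) k,
      Fin.tail ν ∈ Fintype.piFinset fun _ : Fin m => Finset.range (k + 1) := fun ν hν => by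
    rw [Finset.Nat.mem_antidiagonalTuple] at hν
    rw [Fintype.mem_piFinset]
    intro j
    rw [Finset.mem_range, Nat.lt_succ_iff, ← hν]
    exact Finset.single_le_sum (f := ν) (fun _ _ => Nat.zero_le _) (Finset.mem_univ j.succ)
  have hinj : Set.InjOn (Fin.tail : (Fin (m + 1) → ℕ) → Fin m → ℕ)
      (Finset.Nat.antidiagonalTuple (m + 1) k) := fun ν hν η hη h => by
    rw [Finset.mem_coe, Finset.Nat.mem_antidiagonalTuple, Fin.sum_univ_succ] at hν hη
    have hj : ∀ j : Fin m, ν j.succ = η j.succ := fun j => congrFun h j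
    simp only [hj] at hν
    funext j
    refine Fin.cases ?_ hj j
    omega
  calc _ ≤ ∑ ν ∈ Finset.Nat.antidiagonalTuple (m + 1) k,
        5 / 2 * (2 * (k : ℝ) + 1) ^ (1 / 6 : ℝ) * ∏ j, hermiteFun (Fin.tail ν j)
            (x j.succ) ^ 2 := by
        refine Finset.sum_le_sum fun ν hν => ?_
        rw [hermiteFunMulti, Fin.prod_univ_succ, mul_pow, ← Finset.prod_pow]
        refine mul_le_mul_of_nonneg_right ?_ (Finset.prod_nonneg fun _ _ => sq_nonneg _)
        refine (hermiteFun_sq_le _ _).trans ?_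
        have : (ν 0 : ℝ) ≤ k := by
          rw [Finset.Nat.mem_antidiagonalTuple] at hν
          rw [← hν]
          exact_mod_cast Finset.single_le_sum (f := ν) (fun _ _ => Nat.zero_le _)
            (Finset.mem_univ 0)
        gcongr
    _ ≤ 5 / 2 * (2 * (k : ℝ) + 1) ^ (1 / 6 : ℝ) *
        ∑ η ∈ Fintype.piFinset fun _ : Fin m => Finset.range (k + 1),
          ∏ j, hermiteFun (η j) (x j.succ) ^ 2 := by
        rw [← Finset.mul_sum]
        refine mul_le_mul_of_nonneg_left ?_ (by positivity)
        rw [← Finset.sum_image (f := fun η : Fin m → ℕ => ∏ j, hermiteFun (η j) (x j.succ) ^ 2)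
            hinj]
        exact Finset.sum_le_sum_of_subset_of_nonneg (Finset.image_subset_iff.2 hmaps)
          fun _ _ _ => Finset.prod_nonneg fun _ _ => sq_nonneg _
    _ ≤ 5 / 2 * (2 * (k : ℝ) + 1) ^ (1 / 6 : ℝ) * ∏ _j : Fin m, (2 * √(2 * k + 1)) := by
        rw [← Finset.prod_univ_sum (fun _ : Fin m => Finset.range (k + 1))
          fun j n => hermiteFun n (x j.succ) ^ 2]
        refine mul_le_mul_of_nonneg_left ?_ (by positivity)
        exact Finset.prod_le_prod (fun _ _ => Finset.sum_nonneg fun _ _ => sq_nonneg _)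
          fun j _ => sum_hermiteFun_sq_le k (x j.succ)
    _ = _ := by
        rw [Finset.prod_const, Finset.card_univ, Fintype.card_fin, mul_pow, Real.sqrt_eq_rpow,
          ← Real.rpow_natCast, ← Real.rpow_natCast, ← Real.rpow_mul hk.le]
        rw [show ((m + 1 : ℝ) / 2 - 1 / 3) = 1 / 6 + 1 / 2 * (m : ℝ) by ring, Real.rpow_add hk]
        ring

theorem exists_sum_grushinFun_sq_le {d : ℕ} (hd : 1 ≤ d) :
    ∃ C > 0, ∀ μ : ℝ, 0 < μ → ∀ (k : ℕ) (x : Fin d → ℝ),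
      ∑ ν ∈ Finset.Nat.antidiagonalTuple d k, grushinFun d μ ν x ^ 2 ≤
        C * μ ^ ((d : ℝ) / 2) * (2 * (k : ℝ) + d) ^ (-(1 / 3) : ℝ) := by
  obtain ⟨m, rfl⟩ : ∃ m, d = m + 1 := ⟨d - 1, by omega⟩
  refine ⟨5 / 2 * 2 ^ m, by positivity, fun μ hμ k x => ?_⟩
  have hk : (0 : ℝ) < 2 * k + (m + 1 : ℕ) := by positivity
  set a := μ / (2 * (k : ℝ) + (m + 1 : ℕ)) with ha
  have ha0 : 0 < a := by positivity
  have e : ∀ ν ∈ Finset.Nat.antidiagonalTuple (m + 1) k, grushinFun (m + 1) μ ν x ^ 2 =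
      a ^ (((m + 1 : ℕ) : ℝ) / 2) * hermiteFunMulti (m + 1) ν (fun j => √a * x j) ^ 2 := by
    intro ν hν
    rw [Finset.Nat.mem_antidiagonalTuple] at hν
    rw [grushinFun, hermiteEigenvalue, hν, ← ha, scaledHermite, mul_pow, abs_of_pos ha0,
      ← Real.rpow_natCast, ← Real.rpow_mul ha0.le]
    congr 2
    push_cast; ring
  rw [Finset.sum_congr rfl e, ← Finset.mul_sum]
  calc _ ≤ a ^ (((m + 1 : ℕ) : ℝ) / 2) *
        (5 / 2 * 2 ^ m * (2 * (k : ℝ) + 1) ^ ((m + 1 : ℝ) / 2 - 1 / 3)) := by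
        gcongr
        exact sum_hermiteFunMulti_sq_le m k _
    _ ≤ a ^ (((m + 1 : ℕ) : ℝ) / 2) *
        (5 / 2 * 2 ^ m * (2 * (k : ℝ) + (m + 1 : ℕ)) ^ ((m + 1 : ℝ) / 2 - 1 / 3)) := by
        have h1 : (0 : ℝ) ≤ m := by positivity
        gcongr
        · linarith
        · push_cast; linarith
    _ = _ := by
        rw [ha, Real.div_rpow hμ.le hk.le, Real.rpow_sub hk, Real.rpow_neg hk.le]
        push_cast
        field_simp

end Pointwise

section Interpolation

variable {X : Type*} [MeasurableSpace X] {m : Measure X}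

/-- Interpolation between `L²` and a uniform bound. -/
theorem eLpNorm_le_of_eLpNorm_two_le {f : X → ℂ} {r : ℝ≥0∞} (hr : 2 ≤ r) {A B : ℝ} (hA : 0 ≤ A)
    (hB : 0 ≤ B) (h2 : eLpNorm f 2 m ≤ ENNReal.ofReal A) (hf : ∀ x, ‖f x‖ ≤ B) :
    eLpNorm f r m ≤ ENNReal.ofReal (A ^ (2 * (1 / r).toReal) * B ^ (1 - 2 * (1 / r).toReal)) := by
  rcases eq_or_ne r ∞ with rfl | hr'
  · simp only [one_div, ENNReal.inv_top, ENNReal.toReal_zero, mul_zero, Real.rpow_zero, sub_zero,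
      Real.rpow_one, one_mul]
    rw [eLpNorm_exponent_top]
    refine eLpNormEssSup_le_of_ae_bound (.of_forall hf)
  have hr2 : 2 ≤ r.toReal := by
    have := ENNReal.toReal_mono hr' hr
    simpa using this
  have hr0 : 0 < r.toReal := by linarith
  have hrne : r ≠ 0 := (lt_of_lt_of_le two_pos hr).ne'
  rw [eLpNorm_eq_lintegral_rpow_enorm_toReal two_ne_zero ENNReal.ofNat_ne_top] at h2
  rw [eLpNorm_eq_lintegral_rpow_enorm_toReal hrne hr']
  have hpt : ∀ x, ‖f x‖ₑ ^ r.toReal ≤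
      ENNReal.ofReal B ^ (r.toReal - 2) * ‖f x‖ₑ ^ (2 : ℝ≥0∞).toReal := fun x => by
    rw [ENNReal.toReal_ofNat]
    calc ‖f x‖ₑ ^ r.toReal = ‖f x‖ₑ ^ (r.toReal - 2) * ‖f x‖ₑ ^ (2 : ℝ) := by
          rw [← ENNReal.rpow_add_of_nonneg _ _ (by linarith) (by norm_num)]
          congr 1; ring
      _ ≤ _ := by
          gcongr
          rw [← ofReal_norm]
          exact ENNReal.ofReal_le_ofReal (hf x)
  have hI : ∫⁻ x, ‖f x‖ₑ ^ (2 : ℝ≥0∞).toReal ∂m ≤ ENNReal.ofReal (A ^ 2) := by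
    have := ENNReal.rpow_le_rpow h2 (z := 2) (by norm_num)
    rw [← ENNReal.rpow_mul] at this
    simp only [ENNReal.toReal_ofNat, one_div] at this ⊢
    rw [inv_mul_cancel₀ two_ne_zero, ENNReal.rpow_one, ENNReal.ofReal_rpow_of_nonneg hA
        (by norm_num)]
      at this
    exact_mod_cast this
  calc _ ≤ (ENNReal.ofReal B ^ (r.toReal - 2) * ENNReal.ofReal (A ^ 2)) ^ (1 / r.toReal) := by
        gcongr
        refine (lintegral_mono hpt).trans ?_
        rw [lintegral_const_mul' _ _ (ENNReal.rpow_ne_top_of_nonneg (by linarith)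
          ENNReal.ofReal_ne_top)]
        exact mul_le_mul' le_rfl hI
    _ = _ := by
        rw [ENNReal.ofReal_rpow_of_nonneg hB (by linarith), ← ENNReal.ofReal_mul (by positivity),
          ENNReal.ofReal_rpow_of_nonneg (by positivity) (by positivity), one_div r,
          ENNReal.toReal_inv, Real.mul_rpow (by positivity) (by positivity), ← Real.rpow_mul hB,
          ← Real.rpow_natCast, ← Real.rpow_mul hA, mul_comm]
        congr 3
        · push_cast; rw [one_div]
        · field_simp

end Interpolation

section GrushinComplex

variable {d : ℕ} {μ : ℝ}

theorem continuous_grushinFun (ν : Fin d → ℕ) : Continuous (grushinFun d μ ν) := by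
  unfold grushinFun scaledHermite hermiteFunMulti
  refine continuous_const.mul (continuous_finsetProd _ fun j _ => ?_)
  exact (continuous_hermiteFun _).comp (continuous_const.mul (continuous_apply j))

theorem continuous_sum_grushinFun (s : Finset (Fin d → ℕ)) (c : (Fin d → ℕ) → ℂ) :
    Continuous fun x => ∑ ν ∈ s, c ν * (grushinFun d μ ν x : ℂ) :=
  continuous_finsetSum _ fun ν _ => continuous_const.mul
    (Complex.continuous_ofReal.comp (continuous_grushinFun ν))

theorem integrable_sum_grushinFun_sq (hd : 1 ≤ d) (hμ : 0 < μ) (s : Finset (Fin d → ℕ))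
    (c : (Fin d → ℕ) → ℝ) : Integrable fun x => (∑ ν ∈ s, c ν * grushinFun d μ ν x) ^ 2 := by
  have := integrable_mul_sum_sq (m := volume) (s := s) (w := fun _ => (1 : ℝ))
    (F := fun ν (x : Fin d → ℝ) => c ν * grushinFun d μ ν x)
    fun ν _ η _ => integrable_one_mul_grushinFun hd hμ c ν η
  simpa only [one_mul] using this

theorem eLpNorm_two_sum_grushinFun (hd : 1 ≤ d) (hμ : 0 < μ) (s : Finset (Fin d → ℕ))
    (c : (Fin d → ℕ) → ℂ) :
    eLpNorm (fun x => ∑ ν ∈ s, c ν * (grushinFun d μ ν x : ℂ)) 2 volume =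
      ENNReal.ofReal √((∫ x, (∑ ν ∈ s, (c ν).re * grushinFun d μ ν x) ^ 2) +
        ∫ x, (∑ ν ∈ s, (c ν).im * grushinFun d μ ν x) ^ 2) := by
  have h1 := integrable_sum_grushinFun_sq hd hμ s fun ν => (c ν).re
  have h2 := integrable_sum_grushinFun_sq hd hμ s fun ν => (c ν).im
  rw [← integral_add h1 h2, eLpNorm_eq_lintegral_rpow_enorm_toReal two_ne_zero ENNReal.ofNat_ne_top,
    Real.sqrt_eq_rpow, ← ENNReal.ofReal_rpow_of_nonneg (integral_nonneg fun x => by positivity)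
      (by norm_num)]
  erw [ofReal_integral_eq_lintegral_ofReal (h1.add h2) (.of_forall fun x => by
    simp only [Pi.add_apply, Pi.zero_apply]; positivity)]
  simp only [ENNReal.toReal_ofNat]
  congr 1
  refine lintegral_congr fun x => ?_
  rw [← ofReal_norm, ENNReal.ofReal_rpow_of_nonneg (norm_nonneg _) (by norm_num)]
  congr 1
  rw [Real.rpow_two, Complex.sq_norm, Complex.normSq_apply, Complex.re_sum, Complex.im_sum]
  simp only [Complex.re_mul_ofReal, Complex.im_mul_ofReal, Pi.add_apply]
  ring

theorem sq_norm_eq_re_add_im (z : ℂ) : ‖z‖ ^ 2 = z.re ^ 2 + z.im ^ 2 := by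
  rw [Complex.sq_norm, Complex.normSq_apply]; ring

theorem eLpNorm_two_sum_grushinFun_eq (hd : 1 ≤ d) (hμ : 0 < μ) (k : ℕ) (c : (Fin d → ℕ) → ℂ) :
    eLpNorm (fun x => ∑ ν ∈ Finset.Nat.antidiagonalTuple d k, c ν * (grushinFun d μ ν x : ℂ)) 2
      volume = ENNReal.ofReal √(∑ ν ∈ Finset.Nat.antidiagonalTuple d k, ‖c ν‖ ^ 2) := by
  have hs : ∀ ν ∈ Finset.Nat.antidiagonalTuple d k, ∑ j, ν j = k :=
    fun ν hν => Finset.Nat.mem_antidiagonalTuple.1 hν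
  rw [eLpNorm_two_sum_grushinFun hd hμ, integral_sum_grushinFun_sq hd hμ _ hs,
    integral_sum_grushinFun_sq hd hμ _ hs, ← Finset.sum_add_distrib]
  simp only [sq_norm_eq_re_add_im]

theorem exists_eLpNorm_two_synthesis_le (hd : 1 ≤ d) :
    ∃ C > 0, ∀ μ : ℝ, 0 < μ → ∀ (s : Finset (Fin d → ℕ)) (c : (Fin d → ℕ) → ℂ),
      eLpNorm (fun x => ∑ ν ∈ s, ((hermiteEigenvalue d ν)⁻¹ : ℝ) * c ν * (grushinFun d μ ν x : ℂ)) 2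
        volume ≤ ENNReal.ofReal (C * √(∑ ν ∈ s, (hermiteEigenvalue d ν)⁻¹ * ‖c ν‖ ^ 2)) := by
  obtain ⟨C, hC, h⟩ := exists_integral_synthesis_sq_le hd
  refine ⟨√C, Real.sqrt_pos.2 hC, fun μ hμ s c => ?_⟩
  rw [eLpNorm_two_sum_grushinFun hd hμ s fun ν => ((hermiteEigenvalue d ν)⁻¹ : ℝ) * c ν,
    ← Real.sqrt_mul hC.le]
  refine ENNReal.ofReal_le_ofReal (Real.sqrt_le_sqrt ?_)
  have e : ∑ ν ∈ s, (hermiteEigenvalue d ν)⁻¹ * ‖c ν‖ ^ 2 =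
      ∑ ν ∈ s, (c ν).re ^ 2 / hermiteEigenvalue d ν +
        ∑ ν ∈ s, (c ν).im ^ 2 / hermiteEigenvalue d ν := by
    rw [← Finset.sum_add_distrib]
    refine Finset.sum_congr rfl fun ν _ => ?_
    rw [sq_norm_eq_re_add_im]; ring
  rw [e, mul_add]
  refine add_le_add ?_ ?_
  · simpa only [Complex.re_ofReal_mul, mul_comm (_⁻¹ : ℝ), div_eq_mul_inv] using h μ hμ s fun ν =>
      (c ν).re
  · simpa only [Complex.im_ofReal_mul, mul_comm (_⁻¹ : ℝ), div_eq_mul_inv] using h μ hμ s fun ν =>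
      (c ν).im

theorem exists_eLpNorm_sum_grushinFun_le (hd : 1 ≤ d) :
    ∃ C > 0, ∀ r : ℝ≥0∞, 2 ≤ r → ∀ μ : ℝ, 0 < μ → ∀ (k : ℕ) (c : (Fin d → ℕ) → ℂ),
      eLpNorm (fun x => ∑ ν ∈ Finset.Nat.antidiagonalTuple d k, c ν * (grushinFun d μ ν x : ℂ)) r
        volume ≤ ENNReal.ofReal (√(∑ ν ∈ Finset.Nat.antidiagonalTuple d k, ‖c ν‖ ^ 2) *
          (C * μ ^ ((d : ℝ) / 4) * (2 * (k : ℝ) + d) ^ (-(1 / 6) : ℝ)) ^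
            (1 - 2 * (1 / r).toReal)) := by
  obtain ⟨C, hC, h⟩ := exists_sum_grushinFun_sq_le hd
  refine ⟨√C, Real.sqrt_pos.2 hC, fun r hr μ hμ k c => ?_⟩
  have hk : (0 : ℝ) < 2 * k + d := by positivity
  set D := √(∑ ν ∈ Finset.Nat.antidiagonalTuple d k, ‖c ν‖ ^ 2) with hD
  set G := √C * μ ^ ((d : ℝ) / 4) * (2 * (k : ℝ) + d) ^ (-(1 / 6) : ℝ) with hG
  have hD0 : 0 ≤ D := Real.sqrt_nonneg _
  have hG0 : 0 ≤ G := by positivity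
  have hpt : ∀ x, ‖∑ ν ∈ Finset.Nat.antidiagonalTuple d k, c ν * (grushinFun d μ ν x : ℂ)‖ ≤
      D * G := fun x => by
    refine (norm_sum_le _ _).trans ?_
    simp only [norm_mul, Complex.norm_real, Real.norm_eq_abs]
    refine (Real.sum_mul_le_sqrt_mul_sqrt _ _ _).trans ?_
    refine mul_le_mul_of_nonneg_left ?_ hD0
    simp only [sq_abs]
    refine (Real.sqrt_le_sqrt (h μ hμ k x)).trans_eq ?_
    rw [Real.sqrt_mul (by positivity), Real.sqrt_mul hC.le, Real.sqrt_eq_rpow (μ ^ _),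
      Real.sqrt_eq_rpow ((2 * (k : ℝ) + d) ^ _), ← Real.rpow_mul hμ.le, ← Real.rpow_mul hk.le]
    congr 2
    · congr 1; ring
    · norm_num
  rcases eq_or_lt_of_le hD0 with h0 | h0
  · have : (fun x => ∑ ν ∈ Finset.Nat.antidiagonalTuple d k, c ν * (grushinFun d μ ν x : ℂ))
      = 0 := by
      funext x
      have := hpt x
      rw [← h0, zero_mul] at this
      exact norm_le_zero_iff.1 this
    rw [this, eLpNorm_zero]
    exact zero_le
  refine (eLpNorm_le_of_eLpNorm_two_le hr hD0 (mul_nonneg hD0 hG0)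
    (eLpNorm_two_sum_grushinFun_eq hd hμ k c).le hpt).trans_eq ?_
  rw [Real.mul_rpow hD0 hG0, ← mul_assoc, ← Real.rpow_add h0]
  congr 3
  rw [show 2 * (1 / r).toReal + (1 - 2 * (1 / r).toReal) = 1 by ring, Real.rpow_one]

end GrushinComplex

section Synthesis

variable {d : ℕ}

theorem one_sub_two_mul_nonneg {r : ℝ≥0∞} (hr : 2 ≤ r) : 0 ≤ 1 - 2 * (1 / r).toReal := by
  have : (1 / r).toReal ≤ (1 / 2 : ℝ≥0∞).toReal :=
    ENNReal.toReal_mono (by simp) (ENNReal.div_le_div_left hr 1)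
  have h2 : (1 / 2 : ℝ≥0∞).toReal = 1 / 2 := by simp
  linarith

theorem disjoint_antidiagonalTuple (N : ℕ) :
    Set.PairwiseDisjoint (Finset.range N : Set ℕ) (Finset.Nat.antidiagonalTuple d) := by
  intro k _ l _ hkl
  refine Finset.disjoint_left.2 fun ν h1 h2 => hkl ?_
  rw [← Finset.Nat.mem_antidiagonalTuple.1 h1, Finset.Nat.mem_antidiagonalTuple.1 h2]

theorem hermiteEigenvalue_eq {k : ℕ} {ν : Fin d → ℕ} (hν : ν ∈ Finset.Nat.antidiagonalTuple d k) :
    hermiteEigenvalue d ν = 2 * (k : ℝ) + d := by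
  rw [hermiteEigenvalue, Finset.Nat.mem_antidiagonalTuple.1 hν]

/-- Mapping properties `ℓ² → L^r` of the synthesis operator of the family of rescaled Hermite
functions. -/
theorem exists_eLpNorm_synthesis_le (hd : 1 ≤ d) {r : ℝ≥0∞} (hr : 2 ≤ r) :
    ∃ C > 0, ∀ μ : ℝ, 0 < μ → ∀ (N : ℕ) (c : (Fin d → ℕ) → ℂ),
      eLpNorm (fun x => ∑ ν ∈ (Finset.range N).biUnion (Finset.Nat.antidiagonalTuple d),
        ((hermiteEigenvalue d ν)⁻¹ : ℝ) * c ν * (grushinFun d μ ν x : ℂ)) r volume ≤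
      ENNReal.ofReal (C * μ ^ ((d : ℝ) / 4 * (1 - 2 * (1 / r).toReal)) *
        √(∑ ν ∈ (Finset.range N).biUnion (Finset.Nat.antidiagonalTuple d),
          (hermiteEigenvalue d ν)⁻¹ * ‖c ν‖ ^ 2)) := by
  set θ := 1 - 2 * (1 / r).toReal with hθ
  have hθ0 : 0 ≤ θ := one_sub_two_mul_nonneg hr
  have hd' : (1 : ℝ) ≤ d := by exact_mod_cast hd
  rcases eq_or_lt_of_le hθ0 with h0 | h0
  · have hr2 : r = 2 := by
      have h1 : (1 / r).toReal = 1 / 2 := by linarith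
      rw [one_div, ENNReal.toReal_inv] at h1
      have h2 : r.toReal = 2 := by rw [← inv_inv r.toReal, h1]; norm_num
      rw [← ENNReal.ofReal_toReal (a := r) fun h => by simp [h] at h2, h2]
      simp
    obtain ⟨C, hC, h⟩ := exists_eLpNorm_two_synthesis_le hd
    refine ⟨C, hC, fun μ hμ N c => ?_⟩
    rw [hr2, ← h0, mul_zero, Real.rpow_zero, mul_one]
    exact h μ hμ _ c
  obtain ⟨C, hC, h⟩ := exists_eLpNorm_sum_grushinFun_le hd
  have hsum : Summable fun k : ℕ => (2 * (k : ℝ) + d) ^ (-(1 + θ / 3)) := by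
    refine Summable.of_nonneg_of_le (fun k => by positivity) (fun k => ?_)
      ((summable_nat_add_iff 1).2 (Real.summable_nat_rpow.2 (show -(1 + θ / 3) < -1 by linarith)))
    push_cast
    exact Real.rpow_le_rpow_of_nonpos (by positivity) (by linarith [k.cast_nonneg (α := ℝ)])
      (by linarith)
  set Z := ∑' k : ℕ, (2 * (k : ℝ) + d) ^ (-(1 + θ / 3)) with hZ
  have hZ0 : 0 < Z := hsum.tsum_pos (fun k => by positivity) 0 (by positivity)
  refine ⟨C ^ θ * √Z, by positivity, fun μ hμ N c => ?_⟩
  rw [Finset.sum_biUnion (disjoint_antidiagonalTuple N)]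
  simp only [Finset.sum_biUnion (disjoint_antidiagonalTuple N)]
  set D : ℕ → ℝ := fun k => √(∑ ν ∈ Finset.Nat.antidiagonalTuple d k, ‖c ν‖ ^ 2) with hD
  have hN : ∀ k : ℕ, (0 : ℝ) < 2 * k + d := fun k => by positivity
  have hG : ∀ k : ℕ, (C * μ ^ ((d : ℝ) / 4) * (2 * (k : ℝ) + d) ^ (-(1 / 6) : ℝ)) ^ θ =
      C ^ θ * μ ^ ((d : ℝ) / 4 * θ) * (2 * (k : ℝ) + d) ^ (-(θ / 6)) := fun k => by
    rw [Real.mul_rpow (by positivity) (by positivity), Real.mul_rpow (by positivity)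
        (by positivity),
      ← Real.rpow_mul hμ.le, ← Real.rpow_mul (hN k).le]
    congr 2; ring
  have hk : ∀ k : ℕ, eLpNorm (fun x => ∑ ν ∈ Finset.Nat.antidiagonalTuple d k,
      ((hermiteEigenvalue d ν)⁻¹ : ℝ) * c ν * (grushinFun d μ ν x : ℂ)) r volume ≤
      ENNReal.ofReal ((2 * (k : ℝ) + d)⁻¹ * (D k *
        (C ^ θ * μ ^ ((d : ℝ) / 4 * θ) * (2 * (k : ℝ) + d) ^ (-(θ / 6))))) := fun k => by
    have e : (fun x => ∑ ν ∈ Finset.Nat.antidiagonalTuple d k,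
        ((hermiteEigenvalue d ν)⁻¹ : ℝ) * c ν * (grushinFun d μ ν x : ℂ)) =
        ((2 * (k : ℝ) + d)⁻¹ : ℝ) • fun x => ∑ ν ∈ Finset.Nat.antidiagonalTuple d k,
          c ν * (grushinFun d μ ν x : ℂ) := by
      funext x
      rw [Pi.smul_apply, Finset.smul_sum]
      refine Finset.sum_congr rfl fun ν hν => ?_
      rw [hermiteEigenvalue_eq hν, Complex.real_smul, mul_assoc]
    rw [e, eLpNorm_const_smul, Real.enorm_eq_ofReal (by positivity),
      ENNReal.ofReal_mul (by positivity), ← hG k]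
    exact mul_le_mul' le_rfl (h r hr μ hμ k c)
  have e1 : (fun x => ∑ k ∈ Finset.range N, ∑ ν ∈ Finset.Nat.antidiagonalTuple d k,
      ((hermiteEigenvalue d ν)⁻¹ : ℝ) * c ν * (grushinFun d μ ν x : ℂ)) =
      ∑ k ∈ Finset.range N, fun x => ∑ ν ∈ Finset.Nat.antidiagonalTuple d k,
      ((hermiteEigenvalue d ν)⁻¹ : ℝ) * c ν * (grushinFun d μ ν x : ℂ) := by
    funext x; rw [Finset.sum_apply]
  rw [e1]
  refine (eLpNorm_sum_le (fun k _ => ?_) (one_le_two.trans hr)).trans ?_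
  · exact (continuous_sum_grushinFun _
      fun ν => ((hermiteEigenvalue d ν)⁻¹ : ℝ) * c ν).aestronglyMeasurable
  refine (Finset.sum_le_sum fun k _ => hk k).trans ?_
  rw [← ENNReal.ofReal_sum_of_nonneg fun k _ => by positivity]
  refine ENNReal.ofReal_le_ofReal ?_
  calc _ = C ^ θ * μ ^ ((d : ℝ) / 4 * θ) * ∑ k ∈ Finset.range N,
        (√(2 * (k : ℝ) + d)⁻¹ * D k) * (√(2 * (k : ℝ) + d)⁻¹ * (2 * (k : ℝ) + d) ^ (-(θ / 6))) := by
        rw [Finset.mul_sum]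
        refine Finset.sum_congr rfl fun k _ => ?_
        have := Real.mul_self_sqrt (inv_nonneg.2 (hN k).le)
        linear_combination -(D k * C ^ θ * μ ^ ((d : ℝ) / 4 * θ) * (2 * (k : ℝ) + d) ^
            (-(θ / 6))) * this
    _ ≤ C ^ θ * μ ^ ((d : ℝ) / 4 * θ) * (√(∑ k ∈ Finset.range N, (2 * (k : ℝ) + d)⁻¹ * D k ^ 2) *
        √Z) := by
        refine mul_le_mul_of_nonneg_left ((Real.sum_mul_le_sqrt_mul_sqrt _ _ _).trans ?_)
          (by positivity)
        simp only [mul_pow, Real.sq_sqrt (inv_nonneg.2 (hN _).le)]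
        refine mul_le_mul_of_nonneg_left (Real.sqrt_le_sqrt ?_) (Real.sqrt_nonneg _)
        refine le_trans (Finset.sum_le_sum fun k _ => ?_) (hsum.sum_le_tsum (Finset.range N)
          fun k _ => by positivity)
        rw [← Real.rpow_natCast, ← Real.rpow_mul (hN k).le, ← Real.rpow_neg_one,
          ← Real.rpow_add (hN k)]
        refine le_of_eq ?_
        congr 1; push_cast; ring
    _ = _ := by
        have : ∀ k ∈ Finset.range N, (2 * (k : ℝ) + d)⁻¹ * D k ^ 2 =
            ∑ ν ∈ Finset.Nat.antidiagonalTuple d k, (hermiteEigenvalue d ν)⁻¹ * ‖c ν‖ ^ 2 := by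
          intro k _
          rw [hD]
          simp only
          rw [Real.sq_sqrt (Finset.sum_nonneg fun _ _ => by positivity), Finset.mul_sum]
          exact Finset.sum_congr rfl fun ν hν => by rw [hermiteEigenvalue_eq hν]
        rw [Finset.sum_congr rfl this]
        ring

end Synthesis

section Duality

/-- Duality between the synthesis and the analysis operator of a finite weighted family. -/
theorem sqrt_sum_integral_sq_le {X ι : Type*} [MeasurableSpace X] {m : Measure X} {q q' : ℝ≥0∞}
    [q.HolderConjugate q'] (s : Finset ι) (w : ι → ℝ) (hw : ∀ i ∈ s, 0 ≤ w i)
    {φ : ι → X → ℝ} {M : ℝ} (hφ : ∀ i ∈ s, AEStronglyMeasurable (φ i) m)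
    (h : ∀ c : ι → ℂ, eLpNorm (fun x => ∑ i ∈ s, (w i : ℂ) * c i * (φ i x : ℂ)) q' m ≤
      ENNReal.ofReal (M * √(∑ i ∈ s, w i * ‖c i‖ ^ 2)))
    {f : X → ℂ} (hf : AEStronglyMeasurable f m)
    (hinteg : ∀ i ∈ s, Integrable (fun x => f x * (φ i x : ℂ)) m) :
    ENNReal.ofReal √(∑ i ∈ s, w i * ‖∫ x, f x * (φ i x : ℂ) ∂m‖ ^ 2) ≤
      ENNReal.ofReal M * eLpNorm f q m := by
  set c : ι → ℂ := fun i => ∫ x, f x * (φ i x : ℂ) ∂m with hc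
  set A := √(∑ i ∈ s, w i * ‖c i‖ ^ 2) with hA
  have hA0 : 0 ≤ A := Real.sqrt_nonneg _
  have hsum0 : 0 ≤ ∑ i ∈ s, w i * ‖c i‖ ^ 2 :=
    Finset.sum_nonneg fun i hi => mul_nonneg (hw i hi) (by positivity)
  rcases eq_or_lt_of_le hA0 with h0 | h0
  · rw [← h0, ENNReal.ofReal_zero]; exact zero_le
  set g : X → ℂ := fun x => ∑ i ∈ s, (w i : ℂ) * (starRingEnd ℂ) (c i) * (φ i x : ℂ) with hg
  have hgm : AEStronglyMeasurable g m := Finset.aestronglyMeasurable_fun_sum _ fun i hi =>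
    (Complex.continuous_ofReal.comp_aestronglyMeasurable (hφ i hi)).const_mul _
  have e : ∫ x, (g x • f x) ∂m = ((A ^ 2 : ℝ) : ℂ) := by
    have : ∀ x, g x • f x = ∑ i ∈ s, (w i : ℂ) * (starRingEnd ℂ) (c i) * (f x * (φ i x : ℂ)) :=
      fun x => by
        rw [hg, smul_eq_mul, Finset.sum_mul]
        exact Finset.sum_congr rfl fun i _ => by ring
    simp only [this]
    rw [integral_finsetSum _ fun i hi => (hinteg i hi).const_mul _, hA, Real.sq_sqrt hsum0]
    push_cast
    refine Finset.sum_congr rfl fun i _ => ?_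
    rw [integral_const_mul, mul_assoc]
    congr 1
    rw [Complex.conj_mul']
  have h1 : ENNReal.ofReal (A ^ 2) ≤ eLpNorm g q' m * eLpNorm f q m := by
    have h2 : ENNReal.ofReal (A ^ 2) = ‖∫ x, (g x • f x) ∂m‖ₑ := by
      rw [e, ← ofReal_norm, Complex.norm_real, Real.norm_of_nonneg (sq_nonneg _)]
    rw [h2]
    refine (enorm_integral_le_lintegral_enorm _).trans ?_
    rw [← eLpNorm_one_eq_lintegral_enorm]
    have : ENNReal.HolderTriple q' q 1 := ENNReal.HolderTriple.symm (p := q) (q := q')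
    have h3 : eLpNorm (g • f) 1 m ≤ eLpNorm g q' m * eLpNorm f q m :=
      eLpNorm_smul_le_mul_eLpNorm hf hgm
    exact h3
  have h3 := h fun i => (starRingEnd ℂ) (c i)
  simp only [RCLike.norm_conj] at h3
  have h4 : ENNReal.ofReal A * ENNReal.ofReal A ≤
      ENNReal.ofReal A * (ENNReal.ofReal M * eLpNorm f q m) := by
    rw [← ENNReal.ofReal_mul hA0, ← sq]
    refine h1.trans ((mul_le_mul' h3 le_rfl).trans_eq ?_)
    rw [mul_comm M, ENNReal.ofReal_mul hA0, mul_assoc]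
  exact (ENNReal.mul_le_mul_iff_right (ENNReal.ofReal_pos.2 h0).ne' ENNReal.ofReal_ne_top).1 h4

end Duality

section GrushinCoeff

variable {d₁ d₂ : ℕ} {μ : ℝ}

/-- The partial Hermite coefficient of `f` with respect to the rescaled Hermite function `ν`. -/
noncomputable def grushinCoeff (d₁ d₂ : ℕ) (μ : ℝ) (f : (Fin d₁ → ℝ) × (Fin d₂ → ℝ) → ℂ)
    (ν : Fin d₁ → ℕ) (s : Fin d₂ → ℝ) : ℂ :=
  ∫ y, f (y, s) * (grushinFun d₁ μ ν y : ℂ)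

theorem exists_norm_grushinFun_le (hd : 1 ≤ d₁) (hμ : 0 < μ) (ν : Fin d₁ → ℕ) :
    ∃ B, ∀ x, ‖grushinFun d₁ μ ν x‖ ≤ B := by
  obtain ⟨C, -, h⟩ := exists_sum_grushinFun_sq_le hd
  refine ⟨√(C * μ ^ ((d₁ : ℝ) / 2) * (2 * ((∑ j, ν j : ℕ) : ℝ) + d₁) ^ (-(1 / 3) : ℝ)), fun x => ?_⟩
  refine Real.abs_le_sqrt (le_trans ?_ (h μ hμ (∑ j, ν j) x))
  exact Finset.single_le_sum (f := fun ν => grushinFun d₁ μ ν x ^ 2) (fun _ _ => sq_nonneg _)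
    (Finset.Nat.mem_antidiagonalTuple.2 rfl)

variable {f : (Fin d₁ → ℝ) × (Fin d₂ → ℝ) → ℂ}

theorem integrable_mul_grushinFun_fst (hd : 1 ≤ d₁) (hμ : 0 < μ) (hf : Integrable f)
    (ν : Fin d₁ → ℕ) : Integrable fun z => f z * (grushinFun d₁ μ ν z.1 : ℂ) := by
  obtain ⟨B, hB⟩ := exists_norm_grushinFun_le hd hμ ν
  refine hf.mul_bdd (c := B) ((Complex.continuous_ofReal.comp
    ((continuous_grushinFun ν).comp continuous_fst)).aestronglyMeasurable) (.of_forall fun z => ?_)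
  rw [Complex.norm_real]
  exact hB _

theorem ae_integrable_mul_grushinFun (hd : 1 ≤ d₁) (hμ : 0 < μ) (hf : Integrable f) :
    ∀ᵐ s : Fin d₂ → ℝ, ∀ ν, Integrable fun y => f (y, s) * (grushinFun d₁ μ ν y : ℂ) := by
  rw [ae_all_iff]
  intro ν
  have := integrable_mul_grushinFun_fst hd hμ hf ν
  rw [Measure.volume_eq_prod] at this
  exact this.prod_left_ae

theorem integrable_grushinCoeff (hd : 1 ≤ d₁) (hμ : 0 < μ) (hf : Integrable f)
    (ν : Fin d₁ → ℕ) : Integrable (grushinCoeff d₁ d₂ μ f ν) := by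
  have := integrable_mul_grushinFun_fst hd hμ hf ν
  rw [Measure.volume_eq_prod] at this
  exact this.integral_prod_right

theorem stronglyMeasurable_grushinCoeff (hf : Continuous f) (ν : Fin d₁ → ℕ) :
    StronglyMeasurable (grushinCoeff d₁ d₂ μ f ν) := by
  have h : Continuous fun z => f z * (grushinFun d₁ μ ν z.1 : ℂ) :=
    hf.mul (Complex.continuous_ofReal.comp ((continuous_grushinFun ν).comp continuous_fst))
  exact h.stronglyMeasurable.integral_prod_left'

theorem integral_partialFT_mul_grushinFun (hd : 1 ≤ d₁) (hμ : 0 < μ) (hf : Integrable f)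
    (lam : Fin d₂ → ℝ) (ν : Fin d₁ → ℕ) :
    ∫ y, partialFT d₁ d₂ f lam y * (grushinFun d₁ μ ν y : ℂ) =
      ∫ s, Complex.exp (Complex.I * (∑ j, lam j * s j : ℝ)) * grushinCoeff d₁ d₂ μ f ν s := by
  have hE : Continuous fun z : (Fin d₁ → ℝ) × (Fin d₂ → ℝ) =>
      Complex.exp (Complex.I * (∑ j, lam j * z.2 j : ℝ)) := by fun_prop
  have hi : Integrable fun z : (Fin d₁ → ℝ) × (Fin d₂ → ℝ) =>
      Complex.exp (Complex.I * (∑ j, lam j * z.2 j : ℝ)) *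
        (f z * (grushinFun d₁ μ ν z.1 : ℂ)) :=
    (integrable_mul_grushinFun_fst hd hμ hf ν).bdd_mul hE.aestronglyMeasurable
      (.of_forall fun z => (norm_cexp_I_mul_ofReal _).le)
  rw [Measure.volume_eq_prod] at hi
  simp only [partialFT, grushinCoeff, ← integral_const_mul, ← integral_mul_const]
  refine Eq.trans (integral_congr_ae (.of_forall fun y => integral_congr_ae
    (.of_forall fun s => ?_))) (integral_integral_swap (f := fun y s =>
      Complex.exp (Complex.I * (∑ j, lam j * s j : ℝ)) *
        (f (y, s) * (grushinFun d₁ μ ν y : ℂ))) hi)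
  simp only; ring

theorem hermiteProj_partialFT (hd : 1 ≤ d₁) (hμ : 0 < μ) (hf : Integrable f) (k : ℕ)
    (lam : Fin d₂ → ℝ) (x : Fin d₁ → ℝ) :
    hermiteProj d₁ k (μ / (2 * (k : ℝ) + d₁)) (partialFT d₁ d₂ f lam) x =
      ∑ ν ∈ Finset.Nat.antidiagonalTuple d₁ k,
        (∫ s, Complex.exp (Complex.I * (∑ j, lam j * s j : ℝ)) * grushinCoeff d₁ d₂ μ f ν s) *
          (grushinFun d₁ μ ν x : ℂ) := by
  refine Finset.sum_congr rfl fun ν hν => ?_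
  rw [← hermiteEigenvalue_eq hν, ← integral_partialFT_mul_grushinFun hd hμ hf]
  rfl

theorem integral_sphere_mul_cexp {c : (Fin d₂ → ℝ) → ℂ} (hc : Integrable c) (a : ℝ)
    (t : Fin d₂ → ℝ) :
    Integrable (fun ω : sphere (0 : EuclideanSpace ℝ (Fin d₂)) 1 =>
      (∫ s, Complex.exp (Complex.I * (∑ j, a * (ω : EuclideanSpace ℝ (Fin d₂)) j * s j : ℝ)) *
          c s) *
        Complex.exp (-Complex.I * (a * ∑ j, t j * (ω : EuclideanSpace ℝ (Fin d₂)) j : ℝ)))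
        (sphereMeasure d₂) ∧
    ∫ ω : sphere (0 : EuclideanSpace ℝ (Fin d₂)) 1,
      (∫ s, Complex.exp (Complex.I * (∑ j, a * (ω : EuclideanSpace ℝ (Fin d₂)) j * s j : ℝ)) *
          c s) *
        Complex.exp (-Complex.I * (a * ∑ j, t j * (ω : EuclideanSpace ℝ (Fin d₂)) j : ℝ))
        ∂(sphereMeasure d₂) = sphereConv a c t := by
  have e : ∀ (ω : sphere (0 : EuclideanSpace ℝ (Fin d₂)) 1) (s : Fin d₂ → ℝ),
      Complex.exp (Complex.I * (∑ j, a * (ω : EuclideanSpace ℝ (Fin d₂)) j * s j : ℝ)) * c s *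
        Complex.exp (-Complex.I * (a * ∑ j, t j * (ω : EuclideanSpace ℝ (Fin d₂)) j : ℝ)) =
      Complex.exp (Complex.I * (∑ j, (a • (s - t)) j * (ω : EuclideanSpace ℝ (Fin d₂)) j : ℝ)) *
        c s := fun ω s => by
    rw [mul_right_comm, ← Complex.exp_add]
    congr 2
    have : ∑ j, (a • (s - t)) j * (ω : EuclideanSpace ℝ (Fin d₂)) j =
        ∑ j, a * (ω : EuclideanSpace ℝ (Fin d₂)) j * s j -
          a * ∑ j, t j * (ω : EuclideanSpace ℝ (Fin d₂)) j := by
      rw [Finset.mul_sum, ← Finset.sum_sub_distrib]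
      refine Finset.sum_congr rfl fun j _ => ?_
      simp only [Pi.smul_apply, Pi.sub_apply, smul_eq_mul]; ring
    rw [this]; push_cast; ring
  have hE : Continuous fun z : sphere (0 : EuclideanSpace ℝ (Fin d₂)) 1 × (Fin d₂ → ℝ) =>
      Complex.exp (Complex.I *
        (∑ j, (a • (z.2 - t)) j * (z.1 : EuclideanSpace ℝ (Fin d₂)) j : ℝ)) := by
    simp only [Pi.smul_apply, Pi.sub_apply]
    fun_prop
  have hi : Integrable (fun z : sphere (0 : EuclideanSpace ℝ (Fin d₂)) 1 × (Fin d₂ → ℝ) =>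
      Complex.exp (Complex.I *
        (∑ j, (a • (z.2 - t)) j * (z.1 : EuclideanSpace ℝ (Fin d₂)) j : ℝ)) * c z.2)
      ((volume : Measure (EuclideanSpace ℝ (Fin d₂))).toSphere.prod volume) :=
    (hc.comp_snd _).bdd_mul hE.aestronglyMeasurable
      (.of_forall fun z => (norm_cexp_I_mul_ofReal _).le)
  simp only [← integral_mul_const, e, sphereConv, sphereMeasure]
  refine ⟨hi.integral_prod_left, ?_⟩
  rw [integral_integral_swap hi]
  refine integral_congr_ae (.of_forall fun s => ?_)
  simp only [sphereKernel, smul_eq_mul]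
  rw [integral_mul_const]

/-- The coefficient of `restOp` at the rescaled Hermite function `ν`. -/
noncomputable def restCoeff (d₁ d₂ : ℕ) (μ : ℝ) (f : (Fin d₁ → ℝ) × (Fin d₂ → ℝ) → ℂ)
    (ν : Fin d₁ → ℕ) (t : Fin d₂ → ℝ) : ℂ :=
  ((μ / hermiteEigenvalue d₁ ν) ^ (d₂ - 1) : ℝ) *
    sphereConv (μ / hermiteEigenvalue d₁ ν) (grushinCoeff d₁ d₂ μ f ν) t

theorem restOp_eq_tsum (hd₁ : 1 ≤ d₁) (hd₂ : 1 ≤ d₂) (hμ : 0 < μ) (hf : Integrable f)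
    (x : Fin d₁ → ℝ) (t : Fin d₂ → ℝ) :
    restOp d₁ d₂ μ f x t = (1 / (2 * Real.pi) : ℝ) * ∑' k : ℕ,
      ∑ ν ∈ Finset.Nat.antidiagonalTuple d₁ k,
        ((hermiteEigenvalue d₁ ν)⁻¹ : ℝ) * restCoeff d₁ d₂ μ f ν t * (grushinFun d₁ μ ν x : ℂ) := by
  rw [restOp]
  congr 2
  funext k
  have hk : (0 : ℝ) < 2 * k + d₁ := by
    have : (1 : ℝ) ≤ d₁ := by exact_mod_cast hd₁
    positivity
  set a := μ / (2 * (k : ℝ) + d₁) with ha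
  have e : ∀ ε : sphere (0 : EuclideanSpace ℝ (Fin d₂)) 1,
      hermiteProj d₁ k a (partialFT d₁ d₂ f fun j => a * (ε : EuclideanSpace ℝ (Fin d₂)) j) x *
        Complex.exp (-Complex.I *
          (μ * (∑ j, t j * (ε : EuclideanSpace ℝ (Fin d₂)) j) / (2 * (k : ℝ) + d₁) : ℝ)) =
      ∑ ν ∈ Finset.Nat.antidiagonalTuple d₁ k,
        ((∫ s, Complex.exp (Complex.I * (∑ j, a * (ε : EuclideanSpace ℝ (Fin d₂)) j * s j : ℝ)) *
          grushinCoeff d₁ d₂ μ f ν s) *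
        Complex.exp (-Complex.I * (a * ∑ j, t j * (ε : EuclideanSpace ℝ (Fin d₂)) j : ℝ))) *
          (grushinFun d₁ μ ν x : ℂ) := fun ε => by
    rw [hermiteProj_partialFT hd₁ hμ hf, Finset.sum_mul]
    refine Finset.sum_congr rfl fun ν _ => ?_
    rw [mul_right_comm, ha, div_mul_eq_mul_div]
  simp only [e]
  rw [integral_finsetSum, Finset.mul_sum]
  · refine Finset.sum_congr rfl fun ν hν => ?_
    rw [integral_mul_const, (integral_sphere_mul_cexp (integrable_grushinCoeff hd₁ hμ hf ν) a t).2,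
      restCoeff, hermiteEigenvalue_eq hν, ← ha, ← mul_assoc, ← mul_assoc]
    congr 2
    rw [← Complex.ofReal_mul]
    congr 1
    obtain ⟨m, rfl⟩ : ∃ m, d₂ = m + 1 := ⟨d₂ - 1, by omega⟩
    rw [ha, Nat.add_sub_cancel, div_pow, pow_succ]
    field_simp
  · intro ν _
    exact (integral_sphere_mul_cexp (integrable_grushinCoeff hd₁ hμ hf ν) a t).1.mul_const _

end GrushinCoeff

section Series

variable {X : Type*} [MeasurableSpace X] {m : Measure X}

/-- Fatou's lemma for the (possibly junk-valued) sum of a series of functions. -/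
theorem eLpNorm_tsum_le {u : ℕ → X → ℂ} (hu : ∀ k, Measurable (u k)) {r B : ℝ≥0∞}
    (h : ∀ N, eLpNorm (fun x => ∑ k ∈ Finset.range N, u k x) r m ≤ B) :
    eLpNorm (fun x => ∑' k, u k x) r m ≤ B := by
  set A : Set X := {x | ∑' k, ‖u k x‖ₑ ≠ ∞} with hA
  have hAm : MeasurableSet A := by
    have : Measurable fun x => ∑' k, ‖u k x‖ₑ := Measurable.tsum fun k => (hu k).enorm
    exact (this (measurableSet_singleton ∞)).compl
  have hsum : ∀ x, x ∈ A ↔ Summable fun k => u k x := fun x => by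
    rw [← summable_norm_iff, hA, Set.mem_ofPred_eq]
    simp only [enorm_eq_nnnorm, ENNReal.tsum_coe_ne_top_iff_summable]
    exact NNReal.summable_coe.symm
  have hmeas : ∀ N, Measurable fun x => ∑ k ∈ Finset.range N, u k x :=
    fun N => Finset.measurable_sum _ fun k _ => hu k
  refine (Lp.eLpNorm_lim_le_liminf_eLpNorm
    (f := fun N => A.indicator fun x => ∑ k ∈ Finset.range N, u k x)
    (fun N => ((hmeas N).indicator hAm).aestronglyMeasurable) _ (.of_forall fun x => ?_)).trans ?_
  · by_cases hx : x ∈ A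
    · simpa only [indicator_of_mem hx] using ((hsum x).1 hx).hasSum.tendsto_sum_nat
    · simp only [indicator_of_notMem hx, tsum_eq_zero_of_not_summable fun hs => hx ((hsum x).2 hs)]
      exact tendsto_const_nhds
  · refine Filter.liminf_le_of_frequently_le' (Filter.Frequently.of_forall fun N => ?_)
    exact (eLpNorm_indicator_le _).trans (h N)

theorem sqrt_sum_norm_integral_sq_le {ι : Type*} (s : Finset ι) {g : ι → X → ℂ}
    (hg : ∀ i ∈ s, Integrable (g i) m) :
    ENNReal.ofReal √(∑ i ∈ s, ‖∫ x, g i x ∂m‖ ^ 2) ≤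
      ∫⁻ x, ENNReal.ofReal √(∑ i ∈ s, ‖g i x‖ ^ 2) ∂m := by
  set V : X → EuclideanSpace ℂ s := fun x => WithLp.toLp 2 fun i => g i x with hV
  have hVi : ∀ i : s, Integrable (fun x => V x i) m := fun i => hg i i.2
  have hn : ∀ x, ‖V x‖ = √(∑ i ∈ s, ‖g i x‖ ^ 2) := fun x => by
    rw [EuclideanSpace.norm_eq, ← Finset.sum_coe_sort s]
  have hI : ‖∫ x, V x ∂m‖ = √(∑ i ∈ s, ‖∫ x, g i x ∂m‖ ^ 2) := by
    rw [EuclideanSpace.norm_eq, ← Finset.sum_coe_sort s]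
    congr 1
    refine Finset.sum_congr rfl fun i _ => ?_
    rw [eval_integral_piLp hVi]
  rw [← hI, ofReal_norm]
  refine (enorm_integral_le_lintegral_enorm _).trans_eq ?_
  refine lintegral_congr fun x => ?_
  rw [← ofReal_norm, hn]

end Series

section Exponents

theorem exists_holderConjugate {q : ℝ≥0∞} (hq1 : 1 ≤ q) (hq2 : q ≤ 2) :
    ∃ q' : ℝ≥0∞, q.HolderConjugate q' ∧ 2 ≤ q' ∧
      1 - 2 * (1 / q').toReal = 2 * (1 / q).toReal - 1 := by
  have hc := ENNReal.HolderConjugate.conjExponent hq1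
  refine ⟨_, hc, ?_, ?_⟩
  all_goals
    set q' := q.conjExponent
    have h := ENNReal.HolderConjugate.inv_add_inv_eq_one q q'
    have hq : q⁻¹ ≠ ∞ := ENNReal.inv_ne_top.2 (one_pos.trans_le hq1).ne'
    have hq' : q'⁻¹ ≠ ∞ := fun e => by simp [e] at h
    have h' := congrArg ENNReal.toReal h
    rw [ENNReal.toReal_add hq hq', ENNReal.toReal_one] at h'
  · rw [← ENNReal.inv_le_inv, ← ENNReal.toReal_le_toReal hq' (by simp)]
    have h2 := ENNReal.toReal_mono hq (ENNReal.inv_le_inv.2 hq2)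
    simp only [ENNReal.toReal_inv, ENNReal.toReal_ofNat] at h2 h' ⊢
    linarith
  · rw [one_div, one_div]
    linarith

end Exponents

section Analysis

variable {d₁ d₂ : ℕ}

theorem exists_sqrt_sum_grushinCoeff_le (hd : 1 ≤ d₁) {q : ℝ≥0∞} (hq1 : 1 ≤ q) (hq2 : q ≤ 2) :
    ∃ C > 0, ∀ μ : ℝ, 0 < μ → ∀ f : (Fin d₁ → ℝ) × (Fin d₂ → ℝ) → ℂ, Continuous f →
      Integrable f → ∀ᵐ s, ∀ N : ℕ,
      ENNReal.ofReal √(∑ ν ∈ (Finset.range N).biUnion (Finset.Nat.antidiagonalTuple d₁),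
        (hermiteEigenvalue d₁ ν)⁻¹ * ‖grushinCoeff d₁ d₂ μ f ν s‖ ^ 2) ≤
      ENNReal.ofReal (C * μ ^ ((d₁ : ℝ) / 4 * (2 * (1 / q).toReal - 1))) *
        eLpNorm (fun x => f (x, s)) q volume := by
  obtain ⟨q', hqq', hq', e⟩ := exists_holderConjugate hq1 hq2
  obtain ⟨C, hC, h⟩ := exists_eLpNorm_synthesis_le hd hq'
  refine ⟨C, hC, fun μ hμ f hfc hfi => ?_⟩
  filter_upwards [ae_integrable_mul_grushinFun hd hμ hfi] with s hs N
  rw [← e]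
  exact sqrt_sum_integral_sq_le _ (fun ν => (hermiteEigenvalue d₁ ν)⁻¹)
    (fun ν _ => (inv_pos.2 (hermiteEigenvalue_pos hd ν)).le)
    (fun ν _ => (continuous_grushinFun ν).aestronglyMeasurable) (h μ hμ N)
    (by fun_prop : Continuous fun x => f (x, s)).aestronglyMeasurable fun ν _ => hs ν

theorem exists_sqrt_sum_grushinCoeff_le_of_eq (hd : 1 ≤ d₁) {q : ℝ≥0∞} (hq1 : 1 ≤ q)
    (hq2 : q ≤ 2) :
    ∃ C > 0, ∀ μ : ℝ, 0 < μ → ∀ f : (Fin d₁ → ℝ) × (Fin d₂ → ℝ) → ℂ, Continuous f →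
      Integrable f → ∀ᵐ s, ∀ k : ℕ,
      ENNReal.ofReal √(∑ ν ∈ Finset.Nat.antidiagonalTuple d₁ k, ‖grushinCoeff d₁ d₂ μ f ν s‖ ^ 2) ≤
      ENNReal.ofReal (C * μ ^ ((d₁ : ℝ) / 4 * (2 * (1 / q).toReal - 1))) *
        eLpNorm (fun x => f (x, s)) q volume := by
  obtain ⟨q', hqq', hq', e⟩ := exists_holderConjugate hq1 hq2
  obtain ⟨C, hC, h⟩ := exists_eLpNorm_sum_grushinFun_le hd
  refine ⟨C ^ (2 * (1 / q).toReal - 1), by positivity, fun μ hμ f hfc hfi => ?_⟩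
  filter_upwards [ae_integrable_mul_grushinFun hd hμ hfi] with s hs k
  have := sqrt_sum_integral_sq_le (q := q) (q' := q') (m := volume)
    (Finset.Nat.antidiagonalTuple d₁ k) (fun _ => (1 : ℝ))
    (fun _ _ => zero_le_one) (φ := grushinFun d₁ μ)
    (M := C ^ (2 * (1 / q).toReal - 1) * μ ^ ((d₁ : ℝ) / 4 * (2 * (1 / q).toReal - 1)))
    (fun ν _ => (continuous_grushinFun ν).aestronglyMeasurable) (fun c => ?_)
    (by fun_prop : Continuous fun x => f (x, s)).aestronglyMeasurable fun ν _ => hs ν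
  · simpa only [one_mul, grushinCoeff] using this
  · simp only [Complex.ofReal_one, one_mul]
    refine (h q' hq' μ hμ k c).trans (ENNReal.ofReal_le_ofReal ?_)
    rw [mul_comm]
    refine mul_le_mul_of_nonneg_right ?_ (Real.sqrt_nonneg _)
    have h0 := one_sub_two_mul_nonneg hq'
    have hk : (1 : ℝ) ≤ 2 * k + d₁ := by
      have : (1 : ℝ) ≤ d₁ := by exact_mod_cast hd
      linarith [k.cast_nonneg (α := ℝ)]
    rw [e] at h0 ⊢
    rw [Real.rpow_mul hμ.le, ← Real.mul_rpow hC.le (by positivity)]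
    refine Real.rpow_le_rpow (by positivity) ?_ h0
    exact mul_le_of_le_one_right (by positivity)
      (Real.rpow_le_one_of_one_le_of_nonpos hk (by norm_num))

end Analysis

section Endpoint

variable {d₁ d₂ : ℕ}

theorem one_le_hermiteEigenvalue (hd : 1 ≤ d₁) (ν : Fin d₁ → ℕ) : 1 ≤ hermiteEigenvalue d₁ ν := by
  have : (1 : ℝ) ≤ d₁ := by exact_mod_cast hd
  rw [hermiteEigenvalue]
  linarith [(∑ j, ν j).cast_nonneg (α := ℝ)]

theorem eLpNorm_restOp_le (hd₁ : 1 ≤ d₁) (hd₂ : 1 ≤ d₂) {μ : ℝ} (hμ : 0 < μ)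
    {f : (Fin d₁ → ℝ) × (Fin d₂ → ℝ) → ℂ} (hf : Integrable f) {r B : ℝ≥0∞} (t : Fin d₂ → ℝ)
    (h : ∀ N, eLpNorm (fun x => ∑ k ∈ Finset.range N, ∑ ν ∈ Finset.Nat.antidiagonalTuple d₁ k,
      ((hermiteEigenvalue d₁ ν)⁻¹ : ℝ) * restCoeff d₁ d₂ μ f ν t * (grushinFun d₁ μ ν x : ℂ)) r
        volume ≤ B) :
    eLpNorm (fun x => restOp d₁ d₂ μ f x t) r volume ≤ B := by
  simp only [restOp_eq_tsum hd₁ hd₂ hμ hf]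
  have hpi : ‖(1 / (2 * Real.pi) : ℝ)‖ ≤ 1 := by
    have := Real.pi_gt_three
    rw [Real.norm_of_nonneg (by positivity), div_le_one (by positivity)]
    linarith
  refine (eLpNorm_mono fun x => ?_).trans (eLpNorm_tsum_le (fun k => ?_) h)
  · rw [norm_mul, Complex.norm_real]
    exact mul_le_of_le_one_left (norm_nonneg _) hpi
  · exact (continuous_sum_grushinFun _ fun ν =>
      ((hermiteEigenvalue d₁ ν)⁻¹ : ℝ) * restCoeff d₁ d₂ μ f ν t).measurable

theorem sqrt_sum_restCoeff_sq_le (hd₁ : 1 ≤ d₁) {μ : ℝ} (hμ : 0 < μ)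
    {f : (Fin d₁ → ℝ) × (Fin d₂ → ℝ) → ℂ} (hf : Integrable f) (S : Finset (Fin d₁ → ℕ))
    (t : Fin d₂ → ℝ) :
    ENNReal.ofReal √(∑ ν ∈ S, (hermiteEigenvalue d₁ ν)⁻¹ * ‖restCoeff d₁ d₂ μ f ν t‖ ^ 2) ≤
      ENNReal.ofReal ((volume : Measure (EuclideanSpace ℝ (Fin d₂))).toSphere.real univ *
        μ ^ (d₂ - 1)) * ∫⁻ s, ENNReal.ofReal √(∑ ν ∈ S, (hermiteEigenvalue d₁ ν)⁻¹ *
          ‖grushinCoeff d₁ d₂ μ f ν s‖ ^ 2) := by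
  set σ := (volume : Measure (EuclideanSpace ℝ (Fin d₂))).toSphere.real univ with hσ
  have hl : ∀ ν, 0 < hermiteEigenvalue d₁ ν := hermiteEigenvalue_pos hd₁
  set A : (Fin d₁ → ℕ) → ℝ := fun ν => μ / hermiteEigenvalue d₁ ν with hA
  set g : (Fin d₁ → ℕ) → (Fin d₂ → ℝ) → ℂ := fun ν s =>
    ((√(hermiteEigenvalue d₁ ν)⁻¹ * A ν ^ (d₂ - 1) : ℝ) : ℂ) *
      (sphereKernel d₂ (A ν • (s - t)) • grushinCoeff d₁ d₂ μ f ν s) with hg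
  have hgi : ∀ ν ∈ S, Integrable (g ν) := fun ν _ =>
    (integrable_sphereKernel_smul (A ν) (integrable_grushinCoeff hd₁ hμ hf ν) t).const_mul _
  have e : ∀ ν, (hermiteEigenvalue d₁ ν)⁻¹ * ‖restCoeff d₁ d₂ μ f ν t‖ ^ 2 =
      ‖∫ s, g ν s‖ ^ 2 := fun ν => by
    have hAν : μ / hermiteEigenvalue d₁ ν = A ν := rfl
    rw [hg]
    simp only
    rw [integral_const_mul, restCoeff, hAν, sphereConv, norm_mul, norm_mul, Complex.norm_real,
      Complex.norm_real, norm_mul, Real.norm_of_nonneg (Real.sqrt_nonneg _), mul_pow, mul_pow,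
      mul_pow, Real.sq_sqrt (inv_nonneg.2 (hl ν).le)]
    ring
  simp only [e]
  refine (sqrt_sum_norm_integral_sq_le S hgi).trans ?_
  rw [← lintegral_const_mul' _ _ ENNReal.ofReal_ne_top]
  refine lintegral_mono fun s => ?_
  have hσ0 : 0 ≤ σ * μ ^ (d₂ - 1) := by positivity
  simp only
  rw [← ENNReal.ofReal_mul hσ0, ← Real.sqrt_sq hσ0, ← Real.sqrt_mul (sq_nonneg _), Finset.mul_sum]
  refine ENNReal.ofReal_le_ofReal (Real.sqrt_le_sqrt (Finset.sum_le_sum fun ν _ => ?_))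
  have hA0 : 0 ≤ A ν := (div_pos hμ (hl ν)).le
  have h1 : A ν ^ (d₂ - 1) * ‖sphereKernel d₂ (A ν • (s - t))‖ ≤ σ * μ ^ (d₂ - 1) := by
    rw [mul_comm]
    exact mul_le_mul (norm_sphereKernel_le _ _) (pow_le_pow_left₀ hA0
      (div_le_self hμ.le (one_le_hermiteEigenvalue hd₁ ν)) _) (by positivity) (by positivity)
  rw [hg]
  simp only
  rw [norm_mul, Complex.norm_real, norm_mul, Real.norm_of_nonneg (Real.sqrt_nonneg _), norm_smul,
    Real.norm_of_nonneg (pow_nonneg hA0 _), mul_pow, mul_pow, mul_pow,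
    Real.sq_sqrt (inv_nonneg.2 (hl ν).le)]
  have h2 : (A ν ^ (d₂ - 1) * ‖sphereKernel d₂ (A ν • (s - t))‖) ^ 2 ≤ (σ * μ ^ (d₂ - 1)) ^ 2 :=
    pow_le_pow_left₀ (by positivity) h1 2
  calc _ = (A ν ^ (d₂ - 1) * ‖sphereKernel d₂ (A ν • (s - t))‖) ^ 2 *
        ((hermiteEigenvalue d₁ ν)⁻¹ * ‖grushinCoeff d₁ d₂ μ f ν s‖ ^ 2) := by ring
    _ ≤ _ := mul_le_mul_of_nonneg_right h2 (mul_nonneg (inv_nonneg.2 (hl ν).le) (sq_nonneg _))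

theorem exists_eLpNorm_restOp_le_lintegral (hd₁ : 1 ≤ d₁) (hd₂ : 1 ≤ d₂) {q r : ℝ≥0∞}
    (hq1 : 1 ≤ q) (hq2 : q ≤ 2) (hr : 2 ≤ r) :
    ∃ C > 0, ∀ μ : ℝ, 0 < μ → ∀ f : (Fin d₁ → ℝ) × (Fin d₂ → ℝ) → ℂ, Continuous f →
      Integrable f → ∀ t, eLpNorm (fun x => restOp d₁ d₂ μ f x t) r volume ≤
        ENNReal.ofReal (C * μ ^ ((d₂ : ℝ) - 1 + (d₁ : ℝ) / 2 * ((1 / q).toReal - (1 / r).toReal))) *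
          ∫⁻ s, eLpNorm (fun x => f (x, s)) q volume := by
  obtain ⟨C₁, hC₁, h₁⟩ := exists_eLpNorm_synthesis_le hd₁ hr
  obtain ⟨C₂, hC₂, h₂⟩ := exists_sqrt_sum_grushinCoeff_le (d₂ := d₂) hd₁ hq1 hq2
  set σ := (volume : Measure (EuclideanSpace ℝ (Fin d₂))).toSphere.real univ with hσ
  have hσ0 : 0 ≤ σ := measureReal_nonneg
  refine ⟨C₁ * ((σ + 1) * C₂), by positivity, fun μ hμ f hfc hfi t => ?_⟩
  refine eLpNorm_restOp_le hd₁ hd₂ hμ hfi t fun N => ?_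
  have e1 := h₁ μ hμ N fun ν => restCoeff d₁ d₂ μ f ν t
  simp only [Finset.sum_biUnion (disjoint_antidiagonalTuple N)] at e1
  refine e1.trans ?_
  simp only [← Finset.sum_biUnion (disjoint_antidiagonalTuple N)]
  rw [ENNReal.ofReal_mul (by positivity)]
  calc _ ≤ ENNReal.ofReal (C₁ * μ ^ ((d₁ : ℝ) / 4 * (1 - 2 * (1 / r).toReal))) *
        (ENNReal.ofReal (σ * μ ^ (d₂ - 1)) *
          (ENNReal.ofReal (C₂ * μ ^ ((d₁ : ℝ) / 4 * (2 * (1 / q).toReal - 1))) *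
            ∫⁻ s, eLpNorm (fun x => f (x, s)) q volume)) := by
        refine mul_le_mul' le_rfl ((sqrt_sum_restCoeff_sq_le hd₁ hμ hfi _ t).trans
          (mul_le_mul' le_rfl ?_))
        rw [← lintegral_const_mul' _ _ ENNReal.ofReal_ne_top]
        refine lintegral_mono_ae ?_
        filter_upwards [h₂ μ hμ f hfc hfi] with s hs
        exact hs N
    _ ≤ _ := by
        rw [← mul_assoc, ← mul_assoc, ← ENNReal.ofReal_mul (by positivity),
          ← ENNReal.ofReal_mul (by positivity)]
        refine mul_le_mul' (ENNReal.ofReal_le_ofReal ?_) le_rfl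
        have e : μ ^ ((d₂ : ℝ) - 1 + (d₁ : ℝ) / 2 * ((1 / q).toReal - (1 / r).toReal)) =
            μ ^ ((d₁ : ℝ) / 4 * (1 - 2 * (1 / r).toReal)) * μ ^ (d₂ - 1) *
              μ ^ ((d₁ : ℝ) / 4 * (2 * (1 / q).toReal - 1)) := by
          rw [← Real.rpow_natCast, ← Real.rpow_add hμ, ← Real.rpow_add hμ]
          congr 1
          push_cast [hd₂]
          ring
        rw [e]
        calc _ = C₁ * (σ * C₂) * (μ ^ ((d₁ : ℝ) / 4 * (1 - 2 * (1 / r).toReal)) * μ ^ (d₂ - 1) *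
              μ ^ ((d₁ : ℝ) / 4 * (2 * (1 / q).toReal - 1))) := by ring
          _ ≤ _ := by gcongr; linarith

end Endpoint

section CoeffVector

variable {d₁ d₂ : ℕ} {μ : ℝ} {f : (Fin d₁ → ℝ) × (Fin d₂ → ℝ) → ℂ}

/-- The vector of the coefficients `grushinCoeff` with `|ν| = k`. -/
noncomputable def grushinCoeffVec (d₁ d₂ : ℕ) (μ : ℝ) (f : (Fin d₁ → ℝ) × (Fin d₂ → ℝ) → ℂ)
    (k : ℕ) (s : Fin d₂ → ℝ) : EuclideanSpace ℂ (Finset.Nat.antidiagonalTuple d₁ k) :=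
  WithLp.toLp 2 fun ν => grushinCoeff d₁ d₂ μ f ν s

theorem norm_grushinCoeffVec (k : ℕ) (s : Fin d₂ → ℝ) : ‖grushinCoeffVec d₁ d₂ μ f k s‖ =
    √(∑ ν ∈ Finset.Nat.antidiagonalTuple d₁ k, ‖grushinCoeff d₁ d₂ μ f ν s‖ ^ 2) := by
  rw [EuclideanSpace.norm_eq, ← Finset.sum_coe_sort (Finset.Nat.antidiagonalTuple d₁ k)]
  rfl

theorem stronglyMeasurable_grushinCoeffVec (hf : Continuous f) (k : ℕ) :
    StronglyMeasurable (grushinCoeffVec d₁ d₂ μ f k) := by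
  have h : Measurable fun s (ν : Finset.Nat.antidiagonalTuple d₁ k) =>
      grushinCoeff d₁ d₂ μ f ν s :=
    measurable_pi_lambda _ fun ν => (stronglyMeasurable_grushinCoeff hf _).measurable
  exact (PiLp.continuous_toLp 2 _).comp_stronglyMeasurable h.stronglyMeasurable

theorem integrable_grushinCoeffVec (hd : 1 ≤ d₁) (hμ : 0 < μ) (hf : Integrable f) (k : ℕ) :
    Integrable (grushinCoeffVec d₁ d₂ μ f k) :=
  Integrable.of_eval_piLp fun ν => integrable_grushinCoeff hd hμ hf ν

theorem sqrt_sum_restCoeff_sq (hd : 1 ≤ d₁) (hμ : 0 < μ) (hf : Integrable f) (k : ℕ)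
    (t : Fin d₂ → ℝ) :
    √(∑ ν ∈ Finset.Nat.antidiagonalTuple d₁ k, ‖restCoeff d₁ d₂ μ f ν t‖ ^ 2) =
      (μ / (2 * (k : ℝ) + d₁)) ^ (d₂ - 1) *
        ‖sphereConv (μ / (2 * (k : ℝ) + d₁)) (grushinCoeffVec d₁ d₂ μ f k) t‖ := by
  set a := μ / (2 * (k : ℝ) + d₁) with ha
  have ha0 : 0 ≤ a := by positivity
  have h : ‖sphereConv a (grushinCoeffVec d₁ d₂ μ f k) t‖ =
      √(∑ ν ∈ Finset.Nat.antidiagonalTuple d₁ k,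
        ‖sphereConv a (grushinCoeff d₁ d₂ μ f ν) t‖ ^ 2) := by
    rw [EuclideanSpace.norm_eq, ← Finset.sum_coe_sort (Finset.Nat.antidiagonalTuple d₁ k)]
    congr 1
    refine Finset.sum_congr rfl fun ν _ => ?_
    rw [sphereConv, eval_integral_piLp fun ν =>
      (integrable_sphereKernel_smul a (integrable_grushinCoeff hd hμ hf ν.1) t)]
    rfl
  rw [h, ← Real.sqrt_sq (pow_nonneg ha0 (d₂ - 1)), ← Real.sqrt_mul (sq_nonneg _), Finset.mul_sum]
  congr 1
  refine Finset.sum_congr rfl fun ν hν => ?_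
  rw [restCoeff, hermiteEigenvalue_eq hν, ← ha, norm_mul, mul_pow, Complex.norm_real,
    Real.norm_of_nonneg (pow_nonneg ha0 _)]

theorem sqrt_sum_inv_mul_restCoeff_sq (hd : 1 ≤ d₁) (hμ : 0 < μ) (hf : Integrable f) (k : ℕ)
    (t : Fin d₂ → ℝ) :
    √(∑ ν ∈ Finset.Nat.antidiagonalTuple d₁ k,
      ‖(((hermiteEigenvalue d₁ ν)⁻¹ : ℝ) : ℂ) * restCoeff d₁ d₂ μ f ν t‖ ^ 2) =
      (2 * (k : ℝ) + d₁)⁻¹ * ((μ / (2 * (k : ℝ) + d₁)) ^ (d₂ - 1) *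
        ‖sphereConv (μ / (2 * (k : ℝ) + d₁)) (grushinCoeffVec d₁ d₂ μ f k) t‖) := by
  have hk : 0 ≤ (2 * (k : ℝ) + d₁)⁻¹ := by positivity
  rw [← sqrt_sum_restCoeff_sq hd hμ hf, ← Real.sqrt_sq hk, ← Real.sqrt_mul (sq_nonneg _),
    Finset.mul_sum]
  congr 1
  refine Finset.sum_congr rfl fun ν hν => ?_
  rw [hermiteEigenvalue_eq hν, norm_mul, mul_pow, Complex.norm_real, Real.norm_of_nonneg hk]

theorem exists_eLpNorm_restOp_le_tsum (hd₁ : 1 ≤ d₁) (hd₂ : 1 ≤ d₂) {r : ℝ≥0∞} (hr : 2 ≤ r) :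
    ∃ C > 0, ∀ μ : ℝ, 0 < μ → ∀ f : (Fin d₁ → ℝ) × (Fin d₂ → ℝ) → ℂ, Integrable f → ∀ t,
      eLpNorm (fun x => restOp d₁ d₂ μ f x t) r volume ≤
        ∑' k : ℕ, ENNReal.ofReal (C * μ ^ ((d₁ : ℝ) / 4 * (1 - 2 * (1 / r).toReal)) *
          ((2 * (k : ℝ) + d₁)⁻¹ * (μ / (2 * (k : ℝ) + d₁)) ^ (d₂ - 1))) *
          ‖sphereConv (μ / (2 * (k : ℝ) + d₁)) (grushinCoeffVec d₁ d₂ μ f k) t‖ₑ := by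
  obtain ⟨C, hC, h⟩ := exists_eLpNorm_sum_grushinFun_le hd₁
  have h0 := one_sub_two_mul_nonneg hr
  refine ⟨C ^ (1 - 2 * (1 / r).toReal), by positivity, fun μ hμ f hf t => ?_⟩
  refine eLpNorm_restOp_le hd₁ hd₂ hμ hf t fun N => ?_
  set u : ℕ → (Fin d₁ → ℝ) → ℂ := fun k x => ∑ ν ∈ Finset.Nat.antidiagonalTuple d₁ k,
    ((hermiteEigenvalue d₁ ν)⁻¹ : ℝ) * restCoeff d₁ d₂ μ f ν t * (grushinFun d₁ μ ν x : ℂ) with hu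
  have hum : ∀ k, AEStronglyMeasurable (u k) := fun k =>
    (continuous_sum_grushinFun _ fun ν =>
      ((hermiteEigenvalue d₁ ν)⁻¹ : ℝ) * restCoeff d₁ d₂ μ f ν t).aestronglyMeasurable
  have htri := eLpNorm_sum_le (s := Finset.range N) (fun k _ => hum k) (one_le_two.trans hr)
  rw [Finset.sum_fn] at htri
  refine htri.trans (le_trans ?_ (ENNReal.sum_le_tsum (Finset.range N)))
  refine Finset.sum_le_sum fun k _ => ?_
  have hk : (1 : ℝ) ≤ 2 * k + d₁ := by
    have : (1 : ℝ) ≤ d₁ := by exact_mod_cast hd₁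
    linarith [k.cast_nonneg (α := ℝ)]
  refine (h r hr μ hμ k fun ν =>
    ((hermiteEigenvalue d₁ ν)⁻¹ : ℝ) * restCoeff d₁ d₂ μ f ν t).trans ?_
  rw [← ofReal_norm, ← ENNReal.ofReal_mul (by positivity)]
  refine ENNReal.ofReal_le_ofReal ?_
  rw [sqrt_sum_inv_mul_restCoeff_sq hd₁ hμ hf]
  have h1 : (C * μ ^ ((d₁ : ℝ) / 4) * (2 * (k : ℝ) + d₁) ^ (-(1 / 6) : ℝ)) ^
      (1 - 2 * (1 / r).toReal) ≤
      C ^ (1 - 2 * (1 / r).toReal) * μ ^ ((d₁ : ℝ) / 4 * (1 - 2 * (1 / r).toReal)) := by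
    rw [Real.rpow_mul hμ.le, ← Real.mul_rpow hC.le (by positivity)]
    refine Real.rpow_le_rpow (by positivity) ?_ h0
    exact mul_le_of_le_one_right (by positivity)
      (Real.rpow_le_one_of_one_le_of_nonpos hk (by norm_num))
  calc _ ≤ _ := mul_le_mul_of_nonneg_left h1 (by positivity)
    _ = _ := by ring

end CoeffVector

section Interior

theorem lintegral_tsum_rpow_le {X : Type*} [MeasurableSpace X] {m : Measure X} [SigmaFinite m]
    {G : ℕ → X → ℝ≥0∞} (hG : ∀ k, Measurable (G k)) {q : ℝ} (hq : 1 ≤ q) :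
    (∫⁻ x, (∑' k, G k x) ^ q ∂m) ^ (1 / q) ≤ ∑' k, (∫⁻ x, G k x ^ q ∂m) ^ (1 / q) := by
  have h : Measurable (Function.uncurry fun x k => G k x) :=
    measurable_from_prod_countable_left fun k => hG k
  simpa only [lintegral_count] using lintegral_rpow_lintegral_le (μ := m) (ν := .count) h hq

theorem lintegral_const_mul_rpow {X : Type*} [MeasurableSpace X] {m : Measure X}
    (a : ℝ) (g : X → ℝ≥0∞) {q : ℝ} (hq : 0 < q) :
    (∫⁻ x, (ENNReal.ofReal a * g x) ^ q ∂m) ^ (1 / q) =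
      ENNReal.ofReal a * (∫⁻ x, g x ^ q ∂m) ^ (1 / q) := by
  simp only [ENNReal.mul_rpow_of_nonneg _ _ hq.le]
  rw [lintegral_const_mul' _ _ (ENNReal.rpow_ne_top_of_nonneg hq.le ENNReal.ofReal_ne_top),
    ENNReal.mul_rpow_of_nonneg _ _ (by positivity), ← ENNReal.rpow_mul, mul_one_div_cancel hq.ne',
    ENNReal.rpow_one]

theorem exists_lintegral_eLpNorm_restOp_rpow_le {d₁ m : ℕ} (hd₁ : 1 ≤ d₁) {p p' : ℝ}
    (hp : p.HolderConjugate p') (hp' : 2 < p') (hm : 4 ≤ (m : ℝ) * (p' - 2)) {q r : ℝ≥0∞}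
    (hq1 : 1 ≤ q) (hq2 : q ≤ 2) (hr : 2 ≤ r) :
    ∃ C > 0, ∀ μ : ℝ, 0 < μ → ∀ f : (Fin d₁ → ℝ) × (Fin (m + 1) → ℝ) → ℂ, Continuous f →
      Integrable f →
      (∫⁻ t, eLpNorm (fun x => restOp d₁ (m + 1) μ f x t) r volume ^ p') ^ (1 / p') ≤
        ENNReal.ofReal (C * μ ^ ((m : ℝ) - 2 * ((m : ℝ) + 1) / p' +
          (d₁ : ℝ) / 2 * ((1 / q).toReal - (1 / r).toReal))) *
          (∫⁻ s, eLpNorm (fun x => f (x, s)) q volume ^ p) ^ (1 / p) := by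
  obtain ⟨C₁, hC₁, h₁⟩ := exists_eLpNorm_restOp_le_tsum (d₂ := m + 1) hd₁ (by omega) hr
  obtain ⟨C₂, hC₂, h₂⟩ := exists_lintegral_enorm_sphereConv_rpow_le hp hp' hm
  obtain ⟨C₃, hC₃, h₃⟩ := exists_sqrt_sum_grushinCoeff_le_of_eq (d₂ := m + 1) hd₁ hq1 hq2
  have hp0 := hp.pos
  have hd : (1 : ℝ) ≤ d₁ := by exact_mod_cast hd₁
  set β : ℝ := m + 1 - 2 * ((m : ℝ) + 1) / p' with hβ
  have hβ1 : 1 < β := by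
    have : β = ((m : ℝ) + 1) * (p' - 2) / p' := by
      rw [hβ]; field_simp
    rw [this, lt_div_iff₀ (by linarith)]
    linarith
  have hsum : Summable fun k : ℕ => (2 * (k : ℝ) + d₁) ^ (-β) := by
    refine Summable.of_nonneg_of_le (fun k => by positivity) (fun k => ?_)
      ((summable_nat_add_iff 1).2 (Real.summable_nat_rpow.2 (show -β < -1 by linarith)))
    push_cast
    exact Real.rpow_le_rpow_of_nonpos (by positivity) (by linarith [k.cast_nonneg (α := ℝ)])
      (by linarith)
  set Z := ∑' k : ℕ, (2 * (k : ℝ) + d₁) ^ (-β) with hZ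
  have hZ0 : 0 < Z := hsum.tsum_pos (fun k => by positivity) 0 (by positivity)
  refine ⟨C₁ * C₂ * C₃ * Z, by positivity, fun μ hμ f hfc hfi => ?_⟩
  set M := (∫⁻ s, eLpNorm (fun x => f (x, s)) q volume ^ p) ^ (1 / p) with hM
  set E := (m : ℝ) - 2 * ((m : ℝ) + 1) / p' +
    (d₁ : ℝ) / 2 * ((1 / q).toReal - (1 / r).toReal) with hE
  have hc : ∀ k, (∫⁻ s, ‖grushinCoeffVec d₁ (m + 1) μ f k s‖ₑ ^ p) ^ (1 / p) ≤
      ENNReal.ofReal (C₃ * μ ^ ((d₁ : ℝ) / 4 * (2 * (1 / q).toReal - 1))) * M := fun k => by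
    rw [hM, ← lintegral_const_mul_rpow _ _ hp0]
    refine ENNReal.rpow_le_rpow (lintegral_mono_ae ?_) (by positivity)
    filter_upwards [h₃ μ hμ f hfc hfi] with s hs
    refine ENNReal.rpow_le_rpow ?_ hp0.le
    rw [← ofReal_norm, norm_grushinCoeffVec]
    exact hs k
  have hterm : ∀ k : ℕ, (∫⁻ t, (ENNReal.ofReal (C₁ * μ ^ ((d₁ : ℝ) / 4 * (1 - 2 * (1 / r).toReal)) *
      ((2 * (k : ℝ) + d₁)⁻¹ * (μ / (2 * (k : ℝ) + d₁)) ^ (m + 1 - 1))) *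
        ‖sphereConv (μ / (2 * (k : ℝ) + d₁)) (grushinCoeffVec d₁ (m + 1) μ f k) t‖ₑ) ^ p') ^
          (1 / p') ≤ ENNReal.ofReal (C₁ * C₂ * C₃ * μ ^ E * (2 * (k : ℝ) + d₁) ^ (-β)) * M :=
    fun k => by
    have hk : (0 : ℝ) < 2 * k + d₁ := by positivity
    rw [lintegral_const_mul_rpow _ _ (by linarith)]
    refine (mul_le_mul' le_rfl ((h₂ _ (μ / (2 * (k : ℝ) + d₁)) (by positivity)
      (grushinCoeffVec d₁ (m + 1) μ f k) (integrable_grushinCoeffVec hd₁ hμ hfi k)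
      (stronglyMeasurable_grushinCoeffVec hfc k)).trans (mul_le_mul' le_rfl (hc k)))).trans_eq ?_
    rw [← mul_assoc, ← mul_assoc, ← ENNReal.ofReal_mul (by positivity),
      ← ENNReal.ofReal_mul (by positivity)]
    congr 2
    have e1 : μ ^ E = μ ^ ((d₁ : ℝ) / 4 * (1 - 2 * (1 / r).toReal)) * μ ^ m *
        μ ^ (-(2 * ((m : ℝ) + 1) / p')) * μ ^ ((d₁ : ℝ) / 4 * (2 * (1 / q).toReal - 1)) := by
      rw [← Real.rpow_natCast, ← Real.rpow_add hμ, ← Real.rpow_add hμ, ← Real.rpow_add hμ, hE]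
      congr 1
      ring
    have e2 : (2 * (k : ℝ) + d₁) ^ (-β) = (2 * (k : ℝ) + d₁)⁻¹ * ((2 * (k : ℝ) + d₁) ^ m)⁻¹ *
        ((2 * (k : ℝ) + d₁) ^ (-(2 * ((m : ℝ) + 1) / p')))⁻¹ := by
      rw [← Real.rpow_natCast, ← Real.rpow_neg hk.le, ← Real.rpow_neg hk.le,
        ← Real.rpow_neg_one (2 * (k : ℝ) + d₁), ← Real.rpow_add hk, ← Real.rpow_add hk, hβ]
      congr 1
      ring
    rw [e1, e2, Real.div_rpow hμ.le hk.le, Nat.add_sub_cancel, div_pow]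
    simp only [div_eq_mul_inv]
    ring
  calc _ ≤ (∫⁻ t, (∑' k : ℕ, ENNReal.ofReal (C₁ * μ ^ ((d₁ : ℝ) / 4 * (1 - 2 * (1 / r).toReal)) *
      ((2 * (k : ℝ) + d₁)⁻¹ * (μ / (2 * (k : ℝ) + d₁)) ^ (m + 1 - 1))) *
        ‖sphereConv (μ / (2 * (k : ℝ) + d₁)) (grushinCoeffVec d₁ (m + 1) μ f k) t‖ₑ) ^ p') ^
          (1 / p') :=
        ENNReal.rpow_le_rpow (lintegral_mono fun t =>
          ENNReal.rpow_le_rpow (h₁ μ hμ f hfi t) (by linarith)) (by positivity)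
    _ ≤ _ := lintegral_tsum_rpow_le (fun k => (continuous_sphereConv _
        (integrable_grushinCoeffVec hd₁ hμ hfi k)).enorm.measurable.const_mul _) (by linarith)
    _ ≤ _ := ENNReal.tsum_le_tsum hterm
    _ = _ := by
        rw [ENNReal.tsum_mul_right, ← ENNReal.ofReal_tsum_of_nonneg (fun k => by positivity)
          (hsum.mul_left _), tsum_mul_left, ← hZ]
        congr 2
        ring

end Interior

end

theorem integrable_schwartzMap_prod {d₁ d₂ : ℕ}
    (f : SchwartzMap ((Fin d₁ → ℝ) × (Fin d₂ → ℝ)) ℂ) : Integrable f := by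
  have : ((volume : Measure (Fin d₁ → ℝ)).prod
    (volume : Measure (Fin d₂ → ℝ))).IsAddHaarMeasure := Measure.prod.instIsAddHaarMeasure _ _
  exact f.integrable (μ := (volume : Measure (Fin d₁ → ℝ)).prod volume)

theorem restriction_theorem_grushin (d₁ d₂ : ℕ) (hd₁ : 1 ≤ d₁) (hd₂ : 1 ≤ d₂)
    (p p' q r : ℝ≥0∞) (hp1 : 1 ≤ p) (hp2 : p ≤ 2 * ((d₂ : ℝ≥0∞) + 1) / ((d₂ : ℝ≥0∞) + 3))
    (hpp' : 1 / p + 1 / p' = 1) (hq1 : 1 ≤ q) (hq2 : q ≤ 2) (hr : 2 ≤ r) :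
    ∃ C > (0 : ℝ), ∀ (f : SchwartzMap ((Fin d₁ → ℝ) × (Fin d₂ → ℝ)) ℂ) (μ : ℝ), 0 < μ →
      mixedNorm d₁ d₂ r p' (fun z => restOp d₁ d₂ μ f z.1 z.2) ≤
        ENNReal.ofReal (C * μ ^ (2 * (d₂ : ℝ) * ((1 / p).toReal - 1 / 2) +
            ((d₁ : ℝ) / 2) * ((1 / q).toReal - (1 / r).toReal) - 1)) *
          mixedNorm d₁ d₂ q p f := by
  rw [one_div, one_div] at hpp'
  rcases hp1.eq_or_lt with rfl | hp1
  · obtain rfl : p' = ∞ := by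
      rw [inv_one] at hpp'
      exact ENNReal.inv_eq_zero.1 (ENNReal.add_right_inj ENNReal.one_ne_top |>.1
        (hpp'.trans (add_zero 1).symm))
    obtain ⟨C, hC, h⟩ := exists_eLpNorm_restOp_le_lintegral hd₁ hd₂ hq1 hq2 hr
    refine ⟨C, hC, fun f μ hμ => ?_⟩
    have e : 2 * (d₂ : ℝ) * ((1 / 1 : ℝ≥0∞).toReal - 1 / 2) +
        ((d₁ : ℝ) / 2) * ((1 / q).toReal - (1 / r).toReal) - 1 =
        (d₂ : ℝ) - 1 + (d₁ : ℝ) / 2 * ((1 / q).toReal - (1 / r).toReal) := by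
      rw [div_one, ENNReal.toReal_one]
      ring
    rw [e, mixedNorm, mixedNorm, lpNormENN, lpNormENN, if_pos rfl, if_neg ENNReal.one_ne_top]
    simp only [ENNReal.toReal_one, ENNReal.rpow_one, div_one]
    exact essSup_le_of_ae_le _ (.of_forall (h μ hμ f f.continuous (integrable_schwartzMap_prod f)))
  · obtain ⟨m, rfl⟩ : ∃ m, d₂ = m + 1 := ⟨d₂ - 1, by omega⟩
    have hbt : 2 * (((m + 1 : ℕ) : ℝ≥0∞) + 1) / (((m + 1 : ℕ) : ℝ≥0∞) + 3) ≠ ∞ :=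
      ENNReal.div_ne_top (by finiteness) (by simp)
    have hpt : p ≠ ∞ := ne_top_of_le_ne_top hbt hp2
    have hp't : p' ≠ ∞ := by
      rintro rfl
      rw [ENNReal.inv_top, add_zero, ENNReal.inv_eq_one] at hpp'
      exact hp1.ne' hpp'
    have hp'0 : p' ≠ 0 := by
      rintro rfl
      simp at hpp'
    have hP1 : 1 < p.toReal := by
      simpa using (ENNReal.toReal_lt_toReal ENNReal.one_ne_top hpt).2 hp1
    have hP2 : p.toReal * ((m : ℝ) + 4) ≤ 2 * ((m : ℝ) + 2) := by
      have := ENNReal.toReal_mono hbt hp2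
      rw [ENNReal.toReal_div, ENNReal.toReal_mul, ENNReal.toReal_add (by simp) (by simp),
        ENNReal.toReal_add (by simp) (by simp)] at this
      simp only [ENNReal.toReal_natCast, ENNReal.toReal_ofNat, ENNReal.toReal_one] at this
      rw [le_div_iff₀ (by positivity)] at this
      push_cast at this
      linarith
    have hc : p.toReal⁻¹ + p'.toReal⁻¹ = 1 := by
      have := congrArg ENNReal.toReal hpp'
      rwa [ENNReal.toReal_add (ENNReal.inv_ne_top.2 (zero_lt_one.trans hp1).ne')
        (ENNReal.inv_ne_top.2 hp'0), ENNReal.toReal_inv, ENNReal.toReal_inv,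
        ENNReal.toReal_one] at this
    have hP : p.toReal.HolderConjugate p'.toReal := Real.holderConjugate_iff.2 ⟨hP1, hc⟩
    have hP'0 : 0 < p'.toReal := hP.symm.pos
    have hm : 4 ≤ (m : ℝ) * (p'.toReal - 2) := by
      have hmul : p.toReal + p'.toReal = p.toReal * p'.toReal := by
        field_simp at hc
        linarith
      have hP0 : 0 < p.toReal - 1 := by linarith
      refine le_of_mul_le_mul_left ?_ hP0
      have : (p.toReal - 1) * ((m : ℝ) * (p'.toReal - 2)) =
          m * (p.toReal * p'.toReal - p'.toReal) - 2 * m * (p.toReal - 1) := by ring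
      rw [this, ← hmul]
      linarith
    have hp'2 : 2 < p'.toReal := by
      by_contra! hle
      have := mul_nonpos_of_nonneg_of_nonpos m.cast_nonneg (sub_nonpos.2 hle)
      linarith
    obtain ⟨C, hC, h⟩ := exists_lintegral_eLpNorm_restOp_rpow_le hd₁ hP hp'2 hm hq1 hq2 hr
    refine ⟨C, hC, fun f μ hμ => ?_⟩
    have e : 2 * ((m + 1 : ℕ) : ℝ) * ((1 / p).toReal - 1 / 2) +
        ((d₁ : ℝ) / 2) * ((1 / q).toReal - (1 / r).toReal) - 1 =
        (m : ℝ) - 2 * ((m : ℝ) + 1) / p'.toReal +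
          (d₁ : ℝ) / 2 * ((1 / q).toReal - (1 / r).toReal) := by
      rw [one_div p, ENNReal.toReal_inv, eq_sub_of_add_eq hc]
      push_cast
      ring
    rw [e, mixedNorm, mixedNorm, lpNormENN, lpNormENN, if_neg hp't, if_neg hpt]
    exact h μ hμ f f.continuous (integrable_schwartzMap_prod f)
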